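/- Let X and Y be random variables with values in separable metric spaces (𝒳, d) and (𝒴, d), Z := (X, Y), θ := L(Z), μ := L(X), ν := L(Y), and θₙ the empirical measure of Z₁, ..., Zₙ, where (Z_k)_{k∈ℕ} is strictly stationary with L(Z₁) = θ. Suppose 𝒳 and 𝒴 are of negative type via mappings φ and ψ respectively, and 𝒳 × 𝒴 is σ-compact. If X and Y are independent, have finite (1+ε)-moments for some ε > 0 (i.e. E d(X, x₀)^{1+ε} < ∞ and E d(Y, y₀)^{1+ε} < ∞), and (Z_k) is absolutely regular with mixing coefficients β(n) = O(n^{-r}) for some r > 6(1 + 2ε^{-1}), then n·dcov(θₙ) converges in distribution to ζ := Σ_{k=1}^∞ λ_k ζ_k², where (λ_k, φ_k) are the pairs of non-negative eigenvalues and eigenfunctions of the integral operator f ↦ ∫ δ_θ(·, z) f(z) dθ(z) on L²(θ), and (ζ_k) is a sequence of centered Gaussian random variables with Cov(ζ_i, ζ_j) = lim_{n→∞} n^{-1} Σ_{t,u=1}^n Cov(φ_i(Z_t), φ_j(Z_u)). -/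

import Mathlib

open MeasureTheory Filter Topology ProbabilityTheory
open scoped ENNReal NNReal

noncomputable section

/-- The shift map on path space. -/
def shift {𝒵 : Type*} (x : ℕ → 𝒵) : ℕ → 𝒵 := fun i => x (i + 1)

/-- Empirical measure of `Z₁, …, Zₙ` (indexed here as `Z 0, …, Z (n-1)`). -/
def emp {Ω 𝒵 : Type*} [MeasurableSpace 𝒵] (Z : ℕ → Ω → 𝒵) (n : ℕ) (ω : Ω) : Measure 𝒵 :=
  (n : ℝ≥0∞)⁻¹ • ∑ k ∈ Finset.range n, Measure.dirac (Z k ω)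

/-- `a_μ(x) = ∫ ρ(x,x') dμ(x')`. -/
def aM {X : Type*} [MeasurableSpace X] (ρ : X → X → ℝ) (μ : Measure X) (x : X) : ℝ :=
  ∫ x', ρ x x' ∂μ

/-- `D(μ) = ∫ ρ(x,x') dμ²(x,x')`. -/
def DM {X : Type*} [MeasurableSpace X] (ρ : X → X → ℝ) (μ : Measure X) : ℝ :=
  ∫ p : X × X, ρ p.1 p.2 ∂(μ.prod μ)

/-- `d_μ(x,x') = ρ(x,x') - a_μ(x) - a_μ(x') + D(μ)`. -/
def dM {X : Type*} [MeasurableSpace X] (ρ : X → X → ℝ) (μ : Measure X) (x x' : X) : ℝ :=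
  ρ x x' - aM ρ μ x - aM ρ μ x' + DM ρ μ

/-- `δ_θ(z,z') = d_μ(x,x') d_ν(y,y')` where `μ, ν` are the marginals of `θ`. -/
def deltaTheta {X Y : Type*} [MeasurableSpace X] [MeasurableSpace Y]
    (ρX : X → X → ℝ) (ρY : Y → Y → ℝ) (θ : Measure (X × Y)) (z z' : X × Y) : ℝ :=
  dM ρX (θ.map Prod.fst) z.1 z'.1 * dM ρY (θ.map Prod.snd) z.2 z'.2

/-- The distance covariance `dcov(θ) = ∫ δ_θ dθ²`. -/
def dcov {X Y : Type*} [MeasurableSpace X] [MeasurableSpace Y]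
    (ρX : X → X → ℝ) (ρY : Y → Y → ℝ) (θ : Measure (X × Y)) : ℝ :=
  ∫ p : (X × Y) × (X × Y), deltaTheta ρX ρY θ p.1 p.2 ∂(θ.prod θ)

/-- The `β`-dependence (absolute regularity) coefficient of two sub-σ-algebras. -/
def betaDep {Ω : Type*} [MeasurableSpace Ω] (P : Measure Ω)
    (A B : MeasurableSpace Ω) : ℝ :=
  sSup {r | ∃ (I J : ℕ) (a : Fin I → Set Ω) (b : Fin J → Set Ω),
    (∀ i, MeasurableSet[A] (a i)) ∧ (∀ j, MeasurableSet[B] (b j)) ∧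
    Pairwise (Function.onFun Disjoint a) ∧ Pairwise (Function.onFun Disjoint b) ∧
    (⋃ i, a i) = Set.univ ∧ (⋃ j, b j) = Set.univ ∧
    r = (1 / 2) * ∑ i, ∑ j,
      |(P (a i ∩ b j)).toReal - (P (a i)).toReal * (P (b j)).toReal|}

/-- The σ-algebra generated by `Z 0, …, Z (l-1)`, i.e. by `Z₁, …, Z_l`. -/
def sigmaUpTo {Ω 𝒵 : Type*} [m𝒵 : MeasurableSpace 𝒵] (Z : ℕ → Ω → 𝒵) (l : ℕ) :
    MeasurableSpace Ω :=
  ⨆ i ∈ Finset.range l, MeasurableSpace.comap (Z i) m𝒵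

/-- The σ-algebra generated by `Z l, Z (l+1), …`. -/
def sigmaFrom {Ω 𝒵 : Type*} [m𝒵 : MeasurableSpace 𝒵] (Z : ℕ → Ω → 𝒵) (l : ℕ) :
    MeasurableSpace Ω :=
  ⨆ i ∈ {i : ℕ | l ≤ i}, MeasurableSpace.comap (Z i) m𝒵

/-- The β-mixing coefficient `β(n) = sup_l β(σ(Z₁,…,Z_l), σ(Z_{l+n}, …))` of the process. -/
def betaProc {Ω 𝒵 : Type*} [MeasurableSpace Ω] [MeasurableSpace 𝒵]
    (P : Measure Ω) (Z : ℕ → Ω → 𝒵) (n : ℕ) : ℝ :=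
  sSup {r | ∃ l : ℕ, r = betaDep P (sigmaUpTo Z (l + 1)) (sigmaFrom Z (l + n))}

set_option linter.unusedSectionVars false

section

/-! ## Part 1: consequences of absolute regularity -/

/-- sets of the product which are determined by finite measurable partitions -/
def gridAlg (𝒰 𝒱 : Type*) [MeasurableSpace 𝒰] [MeasurableSpace 𝒱] : Set (Set (𝒰 × 𝒱)) :=
  {E | ∃ (I J : ℕ) (f : 𝒰 → Fin I) (g : 𝒱 → Fin J) (S : Set (Fin I × Fin J)),
    Measurable f ∧ Measurable g ∧ E = (fun p : 𝒰 × 𝒱 => (f p.1, g p.2)) ⁻¹' S}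

lemma gridAlg_isSetAlgebra (𝒰 𝒱 : Type*) [MeasurableSpace 𝒰] [MeasurableSpace 𝒱] :
    IsSetAlgebra (gridAlg 𝒰 𝒱) where
  empty_mem := ⟨1, 1, fun _ => 0, fun _ => 0, ∅, measurable_const, measurable_const, by simp⟩
  compl_mem := by
    rintro s ⟨I, J, f, g, S, hf, hg, rfl⟩
    exact ⟨I, J, f, g, Sᶜ, hf, hg, rfl⟩
  union_mem := by
    rintro s t ⟨I, J, f, g, S, hf, hg, rfl⟩ ⟨I', J', f', g', S', hf', hg', rfl⟩
    refine ⟨I * I', J * J', fun x => finProdFinEquiv (f x, f' x),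
      fun y => finProdFinEquiv (g y, g' y),
      {p | ((finProdFinEquiv.symm p.1).1, (finProdFinEquiv.symm p.2).1) ∈ S ∨
        ((finProdFinEquiv.symm p.1).2, (finProdFinEquiv.symm p.2).2) ∈ S'},
      (measurable_of_finite _).comp (hf.prodMk hf'), (measurable_of_finite _).comp (hg.prodMk hg'), ?_⟩
    ext p
    simp only [Set.mem_union, Set.mem_preimage, Set.mem_ofPred_eq, Equiv.symm_apply_apply]

lemma gridAlg_generate (𝒰 𝒱 : Type*) [MeasurableSpace 𝒰] [MeasurableSpace 𝒱] :
    (Prod.instMeasurableSpace : MeasurableSpace (𝒰 × 𝒱)) = MeasurableSpace.generateFrom (gridAlg 𝒰 𝒱) := by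
  classical
  apply le_antisymm
  · rw [← generateFrom_prod]
    apply MeasurableSpace.generateFrom_mono
    rintro s ⟨A, hA, B, hB, rfl⟩
    refine ⟨2, 2, fun x => if x ∈ A then 1 else 0, fun y => if y ∈ B then 1 else 0, {(1, 1)},
      Measurable.ite hA measurable_const measurable_const,
      Measurable.ite hB measurable_const measurable_const, ?_⟩
    ext p
    simp only [Set.mem_prod, Set.mem_preimage, Set.mem_singleton_iff, Prod.mk.injEq]
    by_cases h1 : p.1 ∈ A <;> by_cases h2 : p.2 ∈ B <;> simp [h1, h2]
  · apply MeasurableSpace.generateFrom_le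
    rintro s ⟨I, J, f, g, S, hf, hg, rfl⟩
    exact ((hf.comp measurable_fst).prodMk (hg.comp measurable_snd)) (Set.toFinite S).measurableSet

lemma betaDep_set_bdd {Ω : Type*} {A B : MeasurableSpace Ω} [mΩ : MeasurableSpace Ω] (P : Measure Ω) [IsProbabilityMeasure P]
    (hA : A ≤ mΩ) (hB : B ≤ mΩ) :
    ∀ s ∈ {r | ∃ (I J : ℕ) (a : Fin I → Set Ω) (b : Fin J → Set Ω),
    (∀ i, MeasurableSet[A] (a i)) ∧ (∀ j, MeasurableSet[B] (b j)) ∧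
    Pairwise (Function.onFun Disjoint a) ∧ Pairwise (Function.onFun Disjoint b) ∧
    (⋃ i, a i) = Set.univ ∧ (⋃ j, b j) = Set.univ ∧
    r = (1 / 2) * ∑ i, ∑ j,
      |(P (a i ∩ b j)).toReal - (P (a i)).toReal * (P (b j)).toReal|}, s ≤ 1 := by
  rintro s ⟨I, J, a, b, ha, hb, hda, hdb, hua, hub, rfl⟩
  have h1 : ∑ i, (P (a i)).toReal = 1 := by
    have := measureReal_iUnion_fintype (μ := P) hda (fun i => hA _ (ha i))
    rw [hua] at this
    simpa [Measure.real] using this.symm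
  have h2 : ∑ j, (P (b j)).toReal = 1 := by
    have := measureReal_iUnion_fintype (μ := P) hdb (fun i => hB _ (hb i))
    rw [hub] at this
    simpa [Measure.real] using this.symm
  have h3 : ∑ i, ∑ j, (P (a i ∩ b j)).toReal = 1 := by
    rw [← h1]
    refine Finset.sum_congr rfl fun i _ => ?_
    have := measureReal_iUnion_fintype (μ := P) (f := fun j => a i ∩ b j)
      (fun j j' hj => (hdb hj).mono Set.inter_subset_right Set.inter_subset_right)
      (fun j => (hA _ (ha i)).inter (hB _ (hb j)))
    rw [← Set.inter_iUnion, hub, Set.inter_univ] at this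
    simpa [Measure.real] using this.symm
  have h4 : ∑ i, ∑ j, (P (a i)).toReal * (P (b j)).toReal = 1 := by
    rw [← Finset.sum_mul_sum, h1, h2, one_mul]
  have : ∑ i, ∑ j, |(P (a i ∩ b j)).toReal - (P (a i)).toReal * (P (b j)).toReal| ≤ 1 + 1 := by
    nth_rewrite 1 [← h3]
    rw [← h4, ← Finset.sum_add_distrib]
    refine Finset.sum_le_sum fun i _ => ?_
    rw [← Finset.sum_add_distrib]
    refine Finset.sum_le_sum fun j _ => ?_
    refine (abs_sub _ _).trans ?_
    rw [abs_of_nonneg ENNReal.toReal_nonneg, abs_of_nonneg (by positivity)]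
  linarith

lemma betaDep_le_one {Ω : Type*} {A B : MeasurableSpace Ω} [mΩ : MeasurableSpace Ω] (P : Measure Ω) [IsProbabilityMeasure P]
    (hA : A ≤ mΩ) (hB : B ≤ mΩ) : betaDep P A B ≤ 1 :=
  Real.sSup_le (betaDep_set_bdd P hA hB) zero_le_one

/-- The set-wise total variation bound on grid sets. -/
lemma beta_grid {Ω 𝒰 𝒱 : Type*} {A B : MeasurableSpace Ω} [mΩ : MeasurableSpace Ω] [MeasurableSpace 𝒰] [MeasurableSpace 𝒱]
    (P : Measure Ω) [IsProbabilityMeasure P]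
    (hA : A ≤ mΩ) (hB : B ≤ mΩ) {U : Ω → 𝒰} {V : Ω → 𝒱}
    (hU : Measurable[A] U) (hV : Measurable[B] V) {E : Set (𝒰 × 𝒱)} (hE : E ∈ gridAlg 𝒰 𝒱) :
    |(P.map (fun ω => (U ω, V ω))).real E - ((P.map U).prod (P.map V)).real E|
      ≤ 2 * betaDep P A B := by
  classical
  obtain ⟨I, J, f, g, S, hf, hg, rfl⟩ := hE
  have hU' : Measurable U := hU.mono hA le_rfl
  have hV' : Measurable V := hV.mono hB le_rfl
  have hUV := hU'.prodMk hV'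
  have : IsProbabilityMeasure (P.map U) := Measure.isProbabilityMeasure_map hU'.aemeasurable
  have : IsProbabilityMeasure (P.map V) := Measure.isProbabilityMeasure_map hV'.aemeasurable
  have : IsProbabilityMeasure (P.map (fun ω => (U ω, V ω))) :=
    Measure.isProbabilityMeasure_map hUV.aemeasurable
  have hfg : Measurable (fun p : 𝒰 × 𝒱 => (f p.1, g p.2)) :=
    (hf.comp measurable_fst).prodMk (hg.comp measurable_snd)
  have hS : ∀ (Q : Measure (𝒰 × 𝒱)) [IsProbabilityMeasure Q],
      Q.real ((fun p : 𝒰 × 𝒱 => (f p.1, g p.2)) ⁻¹' S)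
      = ∑ s ∈ S.toFinset, Q.real ((f ⁻¹' {s.1}) ×ˢ (g ⁻¹' {s.2})) := by
    intro Q _
    rw [← measureReal_biUnion_finset]
    · congr 1
      ext p
      simp only [Set.mem_preimage, Set.mem_toFinset, Set.mem_iUnion, Set.mem_prod,
        Set.mem_singleton_iff, exists_prop, Prod.exists]
      constructor
      · intro h; exact ⟨_, _, h, rfl, rfl⟩
      · rintro ⟨a, b, h, rfl, rfl⟩; exact h
    · intro s _ s' _ hss'
      refine Set.disjoint_left.2 fun p hp hp' => hss' ?_
      simp only [Set.mem_prod, Set.mem_preimage, Set.mem_singleton_iff] at hp hp'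
      exact Prod.ext (hp.1.symm.trans hp'.1) (hp.2.symm.trans hp'.2)
    · intro s _
      exact (hf (measurableSet_singleton _)).prod (hg (measurableSet_singleton _))
  rw [hS, hS, ← Finset.sum_sub_distrib]
  have hterm : ∀ s : Fin I × Fin J,
      (P.map (fun ω => (U ω, V ω))).real ((f ⁻¹' {s.1}) ×ˢ (g ⁻¹' {s.2})) -
        ((P.map U).prod (P.map V)).real ((f ⁻¹' {s.1}) ×ˢ (g ⁻¹' {s.2})) =
      (P ((U ⁻¹' (f ⁻¹' {s.1})) ∩ (V ⁻¹' (g ⁻¹' {s.2})))).toReal -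
        (P (U ⁻¹' (f ⁻¹' {s.1}))).toReal * (P (V ⁻¹' (g ⁻¹' {s.2}))).toReal := by
    intro s
    have m1 := hf (measurableSet_singleton s.1)
    have m2 := hg (measurableSet_singleton s.2)
    rw [measureReal_prod_prod, map_measureReal_apply hUV (m1.prod m2),
      map_measureReal_apply hU' m1, map_measureReal_apply hV' m2]
    rfl
  have hle : (1 / 2 : ℝ) * ∑ i, ∑ j,
      |(P ((U ⁻¹' (f ⁻¹' {i})) ∩ (V ⁻¹' (g ⁻¹' {j})))).toReal -
        (P (U ⁻¹' (f ⁻¹' {i}))).toReal * (P (V ⁻¹' (g ⁻¹' {j}))).toReal| ≤ betaDep P A B := by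
    refine le_csSup ⟨1, betaDep_set_bdd P hA hB⟩ ⟨I, J, fun i => U ⁻¹' (f ⁻¹' {i}),
      fun j => V ⁻¹' (g ⁻¹' {j}), fun i => hU (hf (measurableSet_singleton i)),
      fun j => hV (hg (measurableSet_singleton j)), ?_, ?_, ?_, ?_, rfl⟩
    · intro i j hij
      refine Set.disjoint_left.2 fun p hp hp' => hij ?_
      simp only [Set.mem_preimage, Set.mem_singleton_iff] at hp hp'
      exact hp.symm.trans hp'
    · intro i j hij
      refine Set.disjoint_left.2 fun p hp hp' => hij ?_
      simp only [Set.mem_preimage, Set.mem_singleton_iff] at hp hp'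
      exact hp.symm.trans hp'
    · ext x; simp
    · ext x; simp
  calc _ ≤ ∑ s ∈ S.toFinset, |(P ((U ⁻¹' (f ⁻¹' {s.1})) ∩ (V ⁻¹' (g ⁻¹' {s.2})))).toReal -
        (P (U ⁻¹' (f ⁻¹' {s.1}))).toReal * (P (V ⁻¹' (g ⁻¹' {s.2}))).toReal| := by
        refine (Finset.abs_sum_le_sum_abs _ _).trans (le_of_eq ?_)
        exact Finset.sum_congr rfl fun s _ => by rw [hterm]
    _ ≤ ∑ s : Fin I × Fin J, |(P ((U ⁻¹' (f ⁻¹' {s.1})) ∩ (V ⁻¹' (g ⁻¹' {s.2})))).toReal -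
        (P (U ⁻¹' (f ⁻¹' {s.1}))).toReal * (P (V ⁻¹' (g ⁻¹' {s.2}))).toReal| :=
        Finset.sum_le_sum_of_subset_of_nonneg (Finset.subset_univ _) fun _ _ _ => abs_nonneg _
    _ = _ := Fintype.sum_prod_type _
    _ ≤ _ := by linarith

lemma beta_sets {Ω 𝒰 𝒱 : Type*} {A B : MeasurableSpace Ω} [mΩ : MeasurableSpace Ω] [MeasurableSpace 𝒰] [MeasurableSpace 𝒱]
    (P : Measure Ω) [IsProbabilityMeasure P]
    (hA : A ≤ mΩ) (hB : B ≤ mΩ) {U : Ω → 𝒰} {V : Ω → 𝒱}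
    (hU : Measurable[A] U) (hV : Measurable[B] V) {E : Set (𝒰 × 𝒱)} (hE : MeasurableSet E) :
    |(P.map (fun ω => (U ω, V ω))).real E - ((P.map U).prod (P.map V)).real E|
      ≤ 2 * betaDep P A B := by
  have hU' : Measurable U := hU.mono hA le_rfl
  have hV' : Measurable V := hV.mono hB le_rfl
  have hUV := hU'.prodMk hV'
  have : IsProbabilityMeasure (P.map U) := Measure.isProbabilityMeasure_map hU'.aemeasurable
  have : IsProbabilityMeasure (P.map V) := Measure.isProbabilityMeasure_map hV'.aemeasurable
  have : IsProbabilityMeasure (P.map (fun ω => (U ω, V ω))) :=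
    Measure.isProbabilityMeasure_map hUV.aemeasurable
  set Q := P.map (fun ω => (U ω, V ω))
  set Q0 := (P.map U).prod (P.map V)
  have hd := Measure.MeasureDense.of_generateFrom_isSetAlgebra_finite (Q + Q0)
    (gridAlg_isSetAlgebra 𝒰 𝒱) (gridAlg_generate 𝒰 𝒱)
  refine le_of_forall_pos_le_add fun η hη => ?_
  obtain ⟨t, ht, hlt⟩ := hd.approx E hE (measure_ne_top _ _) (η / 2) (by positivity)
  have htm := hd.measurable t ht
  have h1 : ∀ (R : Measure (𝒰 × 𝒱)) [IsProbabilityMeasure R], R ≤ Q + Q0 →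
      |R.real E - R.real t| ≤ η / 2 := by
    intro R _ hR
    refine (abs_measureReal_sub_le_measureReal_symmDiff hE.nullMeasurableSet
      htm.nullMeasurableSet).trans ?_
    exact ENNReal.toReal_le_of_le_ofReal (by positivity) ((hR _).trans hlt.le)
  have hq := h1 Q (Measure.le_add_right le_rfl)
  have hq0 := h1 Q0 (Measure.le_add_left le_rfl)
  have hg := beta_grid P hA hB hU hV ht
  rw [abs_le] at *
  constructor <;> linarith [hq.1, hq.2, hq0.1, hq0.2, hg.1, hg.2]

/-- Integral bound from set-wise bound. -/
lemma int_diff_le {𝒲 : Type*} [MeasurableSpace 𝒲] (Q Q0 : Measure 𝒲) [IsProbabilityMeasure Q]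
    [IsProbabilityMeasure Q0] {c : ℝ}
    (hc : ∀ E, MeasurableSet E → |Q.real E - Q0.real E| ≤ c) {h : 𝒲 → ℝ} (hm : Measurable h)
    {T : ℝ} (hT : 0 ≤ T) (hb : ∀ w, |h w| ≤ T) :
    |∫ w, h w ∂Q - ∫ w, h w ∂Q0| ≤ 2 * T * c := by
  have hInte : ∀ (R : Measure 𝒲) [IsProbabilityMeasure R], Integrable h R := fun R _ =>
    Integrable.of_bound hm.aestronglyMeasurable T (Eventually.of_forall fun w => hb w)
  have hkey : ∀ (R : Measure 𝒲) [IsProbabilityMeasure R],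
      ∫ w, h w ∂(R) = (∫ t in Set.Ioc 0 (2 * T), R.real {a | t ≤ h a + T}) - T := by
    intro R _
    have := Integrable.integral_eq_integral_Ioc_meas_le (μ := R) (f := fun w => h w + T)
      (M := 2 * T) ((hInte R).add (integrable_const T))
      (Eventually.of_forall fun w => by have := (abs_le.1 (hb w)).1; simp; linarith)
      (Eventually.of_forall fun w => by have := (abs_le.1 (hb w)).2; simp; linarith)
    rw [← this, integral_add (hInte R) (integrable_const T)]
    simp
  have hIon : ∀ (R : Measure 𝒲) [IsProbabilityMeasure R],
      IntegrableOn (fun t => R.real {a | t ≤ h a + T}) (Set.Ioc 0 (2 * T)) := by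
    intro R _
    have hanti : Antitone (fun t => R.real {a | t ≤ h a + T}) := fun s t hst =>
      measureReal_mono (fun a ha => le_trans hst ha)
    exact (hanti.antitoneOn _).integrableOn_isCompact isCompact_Icc |>.mono_set
      Set.Ioc_subset_Icc_self
  rw [hkey Q, hkey Q0, sub_sub_sub_cancel_right, ← integral_sub (hIon Q) (hIon Q0)]
  have := norm_setIntegral_le_of_norm_le_const (μ := (volume : Measure ℝ))
    (s := Set.Ioc 0 (2 * T)) (C := c)
    (f := fun t => Q.real {a | t ≤ h a + T} - Q0.real {a | t ≤ h a + T}) measure_Ioc_lt_top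
    (fun t _ => hc _ (measurableSet_le measurable_const (hm.add_const T)))
  simp only [Real.norm_eq_abs, Real.volume_real_Ioc, sub_zero] at this
  rw [max_eq_left (by positivity)] at this
  linarith

lemma sigmaUpTo_le {Ω 𝒵 : Type*} [mΩ : MeasurableSpace Ω] [MeasurableSpace 𝒵] {Z : ℕ → Ω → 𝒵}
    (hZ : ∀ i, Measurable (Z i)) (l : ℕ) : sigmaUpTo Z l ≤ mΩ :=
  iSup₂_le fun i _ => (hZ i).comap_le

lemma sigmaFrom_le {Ω 𝒵 : Type*} [mΩ : MeasurableSpace Ω] [MeasurableSpace 𝒵] {Z : ℕ → Ω → 𝒵}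
    (hZ : ∀ i, Measurable (Z i)) (l : ℕ) : sigmaFrom Z l ≤ mΩ :=
  iSup₂_le fun i _ => (hZ i).comap_le

lemma measurable_sigmaUpTo {Ω 𝒵 : Type*} [m𝒵 : MeasurableSpace 𝒵] (Z : ℕ → Ω → 𝒵) {i l : ℕ}
    (h : i < l) : Measurable[sigmaUpTo Z l] (Z i) := by
  rw [measurable_iff_comap_le]
  exact le_iSup₂_of_le (f := fun i (_ : i ∈ Finset.range l) => MeasurableSpace.comap (Z i) m𝒵)
    i (Finset.mem_range.2 h) le_rfl

lemma measurable_sigmaFrom {Ω 𝒵 : Type*} [m𝒵 : MeasurableSpace 𝒵] (Z : ℕ → Ω → 𝒵) {i l : ℕ}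
    (h : l ≤ i) : Measurable[sigmaFrom Z l] (Z i) := by
  rw [measurable_iff_comap_le]
  exact le_iSup₂_of_le (f := fun i (_ : i ∈ {i : ℕ | l ≤ i}) => MeasurableSpace.comap (Z i) m𝒵)
    i h le_rfl

lemma betaDep_le_betaProc {Ω 𝒵 : Type*} [mΩ : MeasurableSpace Ω] [MeasurableSpace 𝒵]
    (P : Measure Ω) [IsProbabilityMeasure P] {Z : ℕ → Ω → 𝒵} (hZ : ∀ i, Measurable (Z i))
    (l n : ℕ) : betaDep P (sigmaUpTo Z (l + 1)) (sigmaFrom Z (l + n)) ≤ betaProc P Z n := by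
  refine le_csSup ⟨1, ?_⟩ ⟨l, rfl⟩
  rintro s ⟨l, rfl⟩
  exact betaDep_le_one P (sigmaUpTo_le hZ _) (sigmaFrom_le hZ _)

/-- Main consequence of absolute regularity. -/
theorem beta_bound {Ω 𝒵 𝒰 𝒱 : Type*} [mΩ : MeasurableSpace Ω] [MeasurableSpace 𝒵]
    [MeasurableSpace 𝒰] [MeasurableSpace 𝒱]
    (P : Measure Ω) [IsProbabilityMeasure P] {Z : ℕ → Ω → 𝒵} (hZ : ∀ i, Measurable (Z i))
    (l n : ℕ) {U : Ω → 𝒰} {V : Ω → 𝒱} (hU : Measurable[sigmaUpTo Z (l + 1)] U)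
    (hV : Measurable[sigmaFrom Z (l + n)] V) {h : 𝒰 × 𝒱 → ℝ} (hm : Measurable h) {T : ℝ}
    (hT : 0 ≤ T) (hb : ∀ w, |h w| ≤ T) :
    |∫ ω, h (U ω, V ω) ∂P - ∫ w, h w ∂((P.map U).prod (P.map V))| ≤ 4 * T * betaProc P Z n := by
  have hU' : Measurable U := hU.mono (sigmaUpTo_le hZ _) le_rfl
  have hV' : Measurable V := hV.mono (sigmaFrom_le hZ _) le_rfl
  have hUV := hU'.prodMk hV'
  have : IsProbabilityMeasure (P.map U) := Measure.isProbabilityMeasure_map hU'.aemeasurable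
  have : IsProbabilityMeasure (P.map V) := Measure.isProbabilityMeasure_map hV'.aemeasurable
  have : IsProbabilityMeasure (P.map (fun ω => (U ω, V ω))) :=
    Measure.isProbabilityMeasure_map hUV.aemeasurable
  have h1 := int_diff_le (P.map (fun ω => (U ω, V ω))) ((P.map U).prod (P.map V))
    (fun E hE => beta_sets P (sigmaUpTo_le hZ _) (sigmaFrom_le hZ _) hU hV hE) hm hT hb
  rw [integral_map hUV.aemeasurable hm.aestronglyMeasurable] at h1
  have h2 := betaDep_le_betaProc P hZ l n
  refine h1.trans ?_
  nlinarith

end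

section

/-! ## Part 2: covariance inequalities -/

/-- The standing assumptions on the process. -/
structure MixProc {Ω 𝒵 : Type*} [MeasurableSpace Ω] [MeasurableSpace 𝒵] (P : Measure Ω)
    (Z : ℕ → Ω → 𝒵) (θ : Measure 𝒵) (ε r C : ℝ) : Prop where
  meas : ∀ i, Measurable (Z i)
  stat : MeasurePreserving shift (P.map fun ω i => Z i ω) (P.map fun ω i => Z i ω)
  law0 : θ = P.map (Z 0)
  eps : 0 < ε
  hr : 6 * (1 + 2 / ε) < r
  C0 : 0 ≤ C
  mix : ∀ n : ℕ, 1 ≤ n → betaProc P Z n ≤ C * (n : ℝ) ^ (-r)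

section
variable {Ω 𝒵 : Type*} [MeasurableSpace Ω] [MeasurableSpace 𝒵] {P : Measure Ω}
    [IsProbabilityMeasure P]
    {Z : ℕ → Ω → 𝒵} {θ : Measure 𝒵} {ε r C : ℝ}

lemma shift_iter {𝒵 : Type*} (x : ℕ → 𝒵) (s i : ℕ) : shift^[s] x i = x (i + s) := by
  induction s generalizing x with
  | zero => rfl
  | succ s ih => rw [Function.iterate_succ_apply, ih]; rfl

lemma MixProc.path_law (M : MixProc P Z θ ε r C) (s : ℕ) :
    P.map (fun ω i => Z (i + s) ω) = P.map (fun ω i => Z i ω) := by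
  have hm : Measurable (fun ω i => Z i ω) := measurable_pi_lambda _ M.meas
  have h := (M.stat.iterate s).map_eq
  rw [Measure.map_map (M.stat.iterate s).measurable hm] at h
  rw [← h]
  conv_rhs => rw [h]
  rw [← h]
  congr 1
  funext ω i
  simp [shift_iter]

lemma MixProc.path_int (M : MixProc P Z θ ε r C) {E : Type*} [NormedAddCommGroup E]
    [NormedSpace ℝ E] (s : ℕ) {F : (ℕ → 𝒵) → E} (hF : StronglyMeasurable F) :
    ∫ ω, F (fun i => Z (i + s) ω) ∂P = ∫ ω, F (fun i => Z i ω) ∂P := by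
  have hm : Measurable (fun ω i => Z i ω) := measurable_pi_lambda _ M.meas
  have hm' : Measurable (fun ω i => Z (i + s) ω) := measurable_pi_lambda _ fun i => M.meas _
  rw [← integral_map (φ := fun ω i => Z (i + s) ω) hm'.aemeasurable hF.aestronglyMeasurable,
    M.path_law, integral_map hm.aemeasurable hF.aestronglyMeasurable]

lemma MixProc.law (M : MixProc P Z θ ε r C) (s : ℕ) : P.map (Z s) = θ := by
  have hm : Measurable (fun ω i => Z i ω) := measurable_pi_lambda _ M.meas
  have hm' : Measurable (fun ω i => Z (i + s) ω) := measurable_pi_lambda _ fun i => M.meas _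
  have h := congrArg (Measure.map (fun x : ℕ → 𝒵 => x 0)) (M.path_law s)
  rw [Measure.map_map (measurable_pi_apply 0) hm, Measure.map_map (measurable_pi_apply 0) hm'] at h
  rw [M.law0, ← show ((fun x : ℕ → 𝒵 => x 0) ∘ fun ω i => Z i ω) = Z 0 from rfl, ← h]
  congr 1
  funext ω
  simp

lemma MixProc.mp (M : MixProc P Z θ ε r C) (s : ℕ) : MeasurePreserving (Z s) P θ :=
  ⟨M.meas s, M.law s⟩

lemma MixProc.prob (M : MixProc P Z θ ε r C) : IsProbabilityMeasure θ := by
  rw [M.law0]; exact Measure.isProbabilityMeasure_map (M.meas 0).aemeasurable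

lemma trunc_ineq {s T ε : ℝ} (hT : 0 < T) (hε : 0 < ε) (h : T ≤ s) :
    s ≤ T ^ (-ε) * s ^ (1 + ε) := by
  have hs : 0 < s := hT.trans_le h
  rw [Real.rpow_add hs, Real.rpow_one, Real.rpow_neg hT.le]
  have h1 : T ^ ε ≤ s ^ ε := Real.rpow_le_rpow hT.le h hε.le
  have h2 : 0 < T ^ ε := Real.rpow_pos_of_pos hT _
  rw [inv_mul_eq_div, le_div_iff₀ h2]
  exact mul_le_mul_of_nonneg_left h1 hs.le

lemma prod_rpow_ineq {a b ε : ℝ} (ha : 0 ≤ a) (hb : 0 ≤ b) :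
    (a * b) ^ (1 + ε) ≤ (a ^ (2 + 2 * ε) + b ^ (2 + 2 * ε)) / 2 := by
  rw [Real.mul_rpow ha hb, show 2 + 2 * ε = (1 + ε) * 2 by ring, Real.rpow_mul ha,
    Real.rpow_mul hb]
  norm_cast
  have := two_mul_le_add_sq (a ^ (1 + ε)) (b ^ (1 + ε))
  linarith

lemma tail_est {W 𝒵 : Type*} [MeasurableSpace W] [MeasurableSpace 𝒵] {Q : Measure W}
    {θ : Measure 𝒵} {U V : W → 𝒵} {h2 : 𝒵 × 𝒵 → ℝ} (hm2 : Measurable h2) {a : 𝒵 → ℝ} {e K L : ℝ}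
    (hai : Integrable (fun z => a z ^ e) θ)
    (hb2 : ∀ p : 𝒵 × 𝒵, |h2 p| ≤ K * ((a p.1 ^ e + a p.2 ^ e) / 2))
    (hL : K * ∫ z, a z ^ e ∂θ ≤ L)
    (hU : MeasurePreserving U Q θ) (hV : MeasurePreserving V Q θ) :
    Integrable (fun w => h2 (U w, V w)) Q ∧ |∫ w, h2 (U w, V w) ∂Q| ≤ L := by
  have iU : Integrable (fun w => a (U w) ^ e) Q := hU.integrable_comp_of_integrable hai
  have iV : Integrable (fun w => a (V w) ^ e) Q := hV.integrable_comp_of_integrable hai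
  have eU : ∫ w, a (U w) ^ e ∂Q = ∫ z, a z ^ e ∂θ := by
    rw [← hU.map_eq, integral_map hU.measurable.aemeasurable]
    rw [hU.map_eq]; exact hai.aestronglyMeasurable
  have eV : ∫ w, a (V w) ^ e ∂Q = ∫ z, a z ^ e ∂θ := by
    rw [← hV.map_eq, integral_map hV.measurable.aemeasurable]
    rw [hV.map_eq]; exact hai.aestronglyMeasurable
  have ib : Integrable (fun w => K * ((a (U w) ^ e + a (V w) ^ e) / 2)) Q :=
    ((iU.add iV).div_const 2).const_mul K
  have hmeas : Measurable (fun w => h2 (U w, V w)) :=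
    hm2.comp (hU.measurable.prodMk hV.measurable)
  refine ⟨ib.mono' hmeas.aestronglyMeasurable (Eventually.of_forall fun w => hb2 (U w, V w)), ?_⟩
  refine (norm_integral_le_of_norm_le (f := fun w => h2 (U w, V w)) ib
    (Eventually.of_forall fun w => hb2 (U w, V w))).trans ?_
  rw [integral_const_mul, integral_div, integral_add iU iV, eU, eV]
  linarith

/-- The constant in the covariance inequality. -/
def cc (C : ℝ) : ℝ := 4 * (4 * C + 2)

theorem MixProc.cov_bound_pos (M : MixProc P Z θ ε r C) {h : 𝒵 × 𝒵 → ℝ} (hm : Measurable h)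
    {a : 𝒵 → ℝ} (ha0 : ∀ z, 0 ≤ a z)
    (hab : ∀ z z', |h (z, z')| ≤ a z * a z')
    (hai : Integrable (fun z => a z ^ (2 + 2 * ε)) θ) {lam : ℝ} (hlam : 0 < lam)
    (hal : ∫ z, a z ^ (2 + 2 * ε) ∂θ ≤ lam ^ (1 + ε))
    (h0 : ∫ p, h p ∂(θ.prod θ) = 0) (t m : ℕ) (hm1 : 1 ≤ m) :
    |∫ ω, h (Z t ω, Z (t + m) ω) ∂P| ≤ (4 * C + 2) * lam / (m : ℝ) ^ 2 := by
  have := M.prob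
  have hε := M.eps
  have hmpos : (0 : ℝ) < m := by exact_mod_cast hm1
  set T : ℝ := lam * (m : ℝ) ^ (2 / ε) with hTdef
  have hT : 0 < T := by positivity
  have hTe : T ^ (-ε) * lam ^ (1 + ε) = lam / (m : ℝ) ^ 2 := by
    rw [hTdef, Real.mul_rpow hlam.le (by positivity), ← Real.rpow_mul hmpos.le,
      mul_right_comm, ← Real.rpow_add hlam]
    rw [show -ε + (1 + ε) = 1 by ring, show 2 / ε * -ε = -((2 : ℕ) : ℝ) by
      field_simp; norm_num, Real.rpow_neg hmpos.le, Real.rpow_natCast, Real.rpow_one]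
    rfl
  let S : Set (𝒵 × 𝒵) := {p | |h p| ≤ T}
  have hS : MeasurableSet S := measurableSet_le hm.abs measurable_const
  let h1 : 𝒵 × 𝒵 → ℝ := S.indicator h
  let h2 : 𝒵 × 𝒵 → ℝ := Sᶜ.indicator h
  have hm1' : Measurable h1 := hm.indicator hS
  have hm2' : Measurable h2 := hm.indicator hS.compl
  have h12 : ∀ p, h p = h1 p + h2 p := fun p => (Set.indicator_self_add_compl_apply S h p).symm
  have hb1 : ∀ p, |h1 p| ≤ T := by
    intro p
    by_cases hp : p ∈ S
    · simp only [h1, Set.indicator_of_mem hp]; exact hp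
    · simp only [h1, Set.indicator_of_notMem hp]; simpa using hT.le
  have hb2 : ∀ p : 𝒵 × 𝒵, |h2 p| ≤
      T ^ (-ε) * ((a p.1 ^ (2 + 2 * ε) + a p.2 ^ (2 + 2 * ε)) / 2) := by
    intro p
    have hnn : 0 ≤ (a p.1 ^ (2 + 2 * ε) + a p.2 ^ (2 + 2 * ε)) / 2 := by
      have := Real.rpow_nonneg (ha0 p.1) (2 + 2 * ε)
      have := Real.rpow_nonneg (ha0 p.2) (2 + 2 * ε)
      positivity
    by_cases hp : p ∈ S
    · have : h2 p = 0 := Set.indicator_of_notMem (by simpa using hp) _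
      rw [this, abs_zero]
      positivity
    · have : h2 p = h p := Set.indicator_of_mem (by simpa using hp) _
      rw [this]
      have hlt : T ≤ |h p| := (not_le.1 hp).le
      refine (trunc_ineq hT hε hlt).trans ?_
      gcongr
      refine le_trans ?_ (prod_rpow_ineq (ha0 _) (ha0 _))
      exact Real.rpow_le_rpow (abs_nonneg _) (hab p.1 p.2) (by linarith)
  have hal' : T ^ (-ε) * ∫ z, a z ^ (2 + 2 * ε) ∂θ ≤ lam / (m : ℝ) ^ 2 := by
    rw [← hTe]
    gcongr
  have tP := tail_est hm2' hai hb2 hal' (M.mp t) (M.mp (t + m))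
  have tθ := tail_est hm2' hai hb2 hal' (measurePreserving_fst (μ := θ) (ν := θ))
    (measurePreserving_snd (μ := θ) (ν := θ))
  have i1P : Integrable (fun ω => h1 (Z t ω, Z (t + m) ω)) P :=
    Integrable.of_bound (hm1'.comp ((M.meas _).prodMk (M.meas _))).aestronglyMeasurable T
      (Eventually.of_forall fun w => hb1 _)
  have i1θ : Integrable h1 (θ.prod θ) :=
    Integrable.of_bound hm1'.aestronglyMeasurable T (Eventually.of_forall fun w => hb1 _)
  have e1 : ∫ ω, h (Z t ω, Z (t + m) ω) ∂P = ∫ ω, h1 (Z t ω, Z (t + m) ω) ∂P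
      + ∫ ω, h2 (Z t ω, Z (t + m) ω) ∂P := by
    rw [← integral_add i1P tP.1]
    exact integral_congr_ae (Eventually.of_forall fun ω => h12 _)
  have e2 : (0 : ℝ) = ∫ p, h1 p ∂(θ.prod θ) + ∫ p, h2 p ∂(θ.prod θ) := by
    rw [← h0, ← integral_add i1θ tθ.1]
    exact integral_congr_ae (Eventually.of_forall fun ω => h12 _)
  have hbeta := beta_bound P M.meas t m (measurable_sigmaUpTo Z (Nat.lt_succ_self t))
    (measurable_sigmaFrom Z (le_refl (t + m))) hm1' hT.le hb1
  rw [M.law, M.law] at hbeta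
  have hb3 : 4 * T * betaProc P Z m ≤ 4 * C * lam / (m : ℝ) ^ 2 := by
    have h3 := M.mix m hm1
    calc 4 * T * betaProc P Z m ≤ 4 * T * (C * (m : ℝ) ^ (-r)) := by gcongr
      _ = 4 * C * lam * (m : ℝ) ^ (2 / ε - r) := by
        rw [hTdef, Real.rpow_sub hmpos, Real.rpow_neg hmpos.le]; ring
      _ ≤ 4 * C * lam * (m : ℝ) ^ (-((2 : ℕ) : ℝ)) := by
        have := M.C0
        have h4 := M.hr
        have h5 : 0 < 2 / ε := by positivity
        gcongr
        · exact_mod_cast hm1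
        · push_cast; linarith
      _ = _ := by rw [Real.rpow_neg hmpos.le, Real.rpow_natCast]; rfl
  have h6 := tP.2
  have h7 := tθ.2
  simp only [Prod.mk.eta] at h7
  have h8 : (4 * C + 2) * lam / (m : ℝ) ^ 2 =
    4 * C * lam / (m : ℝ) ^ 2 + lam / (m : ℝ) ^ 2 + lam / (m : ℝ) ^ 2 := by ring
  rw [e1, h8]
  rw [abs_le] at *
  constructor <;> linarith [hbeta.1, hbeta.2, h6.1, h6.2, h7.1, h7.2]

/-- Second moment bound. -/
lemma sq_moment_bound {ε : ℝ} (hε : 0 < ε) [IsProbabilityMeasure θ] {a : 𝒵 → ℝ}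
    (hm : Measurable a) (ha0 : ∀ z, 0 ≤ a z)
    (hai : Integrable (fun z => a z ^ (2 + 2 * ε)) θ) {lam : ℝ} (hlam : 0 < lam)
    (hal : ∫ z, a z ^ (2 + 2 * ε) ∂θ ≤ lam ^ (1 + ε)) :
    Integrable (fun z => a z ^ 2) θ ∧ ∫ z, a z ^ 2 ∂θ ≤ 2 * lam := by
  have hb : ∀ z, a z ^ 2 ≤ lam + lam ^ (-ε) * a z ^ (2 + 2 * ε) := by
    intro z
    have hnn := Real.rpow_nonneg (ha0 z) (2 + 2 * ε)
    rcases le_total (a z ^ 2) lam with h | h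
    · have : 0 < lam ^ (-ε) := by positivity
      nlinarith
    · have := trunc_ineq hlam hε h
      rw [← Real.rpow_natCast, ← Real.rpow_mul (ha0 z)] at this
      push_cast at this
      rw [show (2 : ℝ) * (1 + ε) = 2 + 2 * ε by ring] at this
      simp only [Real.rpow_ofNat] at this
      linarith
  have ib : Integrable (fun z => lam + lam ^ (-ε) * a z ^ (2 + 2 * ε)) θ :=
    (integrable_const _).add (hai.const_mul _)
  have ii : Integrable (fun z => a z ^ 2) θ :=
    ib.mono' (hm.pow_const 2).aestronglyMeasurable (Eventually.of_forall fun z => by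
      rw [Real.norm_of_nonneg (by positivity)]; exact hb z)
  refine ⟨ii, (integral_mono ii ib hb).trans ?_⟩
  rw [integral_add (integrable_const _) (hai.const_mul _), integral_const_mul]
  have h1 : lam ^ (-ε) * lam ^ (1 + ε) = lam := by
    rw [← Real.rpow_add hlam]; simp
  have : lam ^ (-ε) * ∫ z, a z ^ (2 + 2 * ε) ∂θ ≤ lam := by
    exact (mul_le_mul_of_nonneg_left hal (by positivity)).trans h1.le
  simp
  linarith

theorem MixProc.cov_bound (M : MixProc P Z θ ε r C) {h : 𝒵 × 𝒵 → ℝ} (hm : Measurable h)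
    {a : 𝒵 → ℝ} (ham : Measurable a) (ha0 : ∀ z, 0 ≤ a z)
    (hab : ∀ z z', |h (z, z')| ≤ a z * a z')
    (hai : Integrable (fun z => a z ^ (2 + 2 * ε)) θ) {lam : ℝ} (hlam : 0 < lam)
    (hal : ∫ z, a z ^ (2 + 2 * ε) ∂θ ≤ lam ^ (1 + ε))
    (h0 : ∫ p, h p ∂(θ.prod θ) = 0) (t u : ℕ) :
    |∫ ω, h (Z t ω, Z u ω) ∂P| ≤ cc C * lam * (1 / (((t - u : ℕ) + (u - t : ℕ) : ℕ) + 1 : ℝ) ^ 2) := by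
  have := M.prob
  have hC := M.C0
  have key : ∀ m : ℕ, 1 ≤ m → (4 * C + 2) * lam / (m : ℝ) ^ 2 ≤ cc C * lam * (1 / (m + 1 : ℝ) ^ 2) := by
    intro m hm
    have hm' : (1 : ℝ) ≤ m := by exact_mod_cast hm
    rw [div_eq_mul_one_div]
    have : 1 / (m : ℝ) ^ 2 ≤ 4 * (1 / (m + 1 : ℝ) ^ 2) := by
      rw [mul_one_div, div_le_div_iff₀ (by positivity) (by positivity)]
      nlinarith
    calc (4 * C + 2) * lam * (1 / (m : ℝ) ^ 2) ≤ (4 * C + 2) * lam * (4 * (1 / (m + 1 : ℝ) ^ 2)) := by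
          gcongr
      _ = _ := by unfold cc; ring
  rcases lt_trichotomy t u with htu | rfl | htu
  · obtain ⟨m, rfl⟩ := Nat.exists_eq_add_of_lt htu
    have h1 := M.cov_bound_pos hm ha0 hab hai hlam hal h0 t (m + 1) (by omega)
    have : (t - (t + m + 1)) + (t + m + 1 - t) = m + 1 := by omega
    rw [this]
    exact h1.trans (key _ (by omega))
  · simp only [tsub_self, add_zero, Nat.cast_zero, zero_add, one_pow, div_one, mul_one]
    have hs := sq_moment_bound M.eps ham ha0 hai hlam hal
    have h1 : |∫ ω, h (Z t ω, Z t ω) ∂P| ≤ ∫ ω, a (Z t ω) ^ 2 ∂P := by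
      refine norm_integral_le_of_norm_le (f := fun ω => h (Z t ω, Z t ω)) ((M.mp t).integrable_comp_of_integrable hs.1)
        (Eventually.of_forall fun ω => ?_)
      have := hab (Z t ω) (Z t ω)
      rw [Real.norm_eq_abs, sq]; exact this
    have h2 : ∫ ω, a (Z t ω) ^ 2 ∂P = ∫ z, a z ^ 2 ∂θ := by
      rw [← M.law t, integral_map (M.meas t).aemeasurable]
      exact (ham.pow_const 2).aestronglyMeasurable
    refine h1.trans (h2.le.trans (hs.2.trans ?_))
    unfold cc
    nlinarith [mul_nonneg hC hlam.le]
  · obtain ⟨m, rfl⟩ := Nat.exists_eq_add_of_lt htu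
    have h0' : ∫ p, (fun p : 𝒵 × 𝒵 => h p.swap) p ∂(θ.prod θ) = 0 := by
      rw [← h0]; exact integral_prod_swap h
    have h1 := M.cov_bound_pos (h := fun p => h p.swap) (hm.comp measurable_swap) ha0
      (fun z z' => by rw [mul_comm]; exact hab z' z) hai hlam hal h0' u (m + 1) (by omega)
    have : (u + m + 1 - u) + (u - (u + m + 1)) = m + 1 := by omega
    rw [this]
    exact h1.trans (key _ (by omega))

lemma sum_inv_sq_le (n : ℕ) : ∑ m ∈ Finset.range n, 1 / ((m : ℝ) + 1) ^ 2 ≤ 2 := by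
  have : ∀ n : ℕ, ∑ m ∈ Finset.range n, 1 / ((m : ℝ) + 1) ^ 2 ≤ 2 - 1 / (n : ℝ) := by
    intro n
    induction n with
    | zero => norm_num
    | succ n ih =>
      rw [Finset.sum_range_succ]
      rcases Nat.eq_zero_or_pos n with rfl | hn
      · norm_num
      · have hn' : (0 : ℝ) < n := by exact_mod_cast hn
        have h1 : 1 / ((n : ℝ) + 1) ^ 2 ≤ 1 / (n : ℝ) - 1 / ((n + 1 : ℕ) : ℝ) := by
          push_cast
          rw [div_sub_div _ _ hn'.ne' (by positivity), div_le_div_iff₀ (by positivity) (by positivity)]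
          nlinarith
        linarith
  refine (this n).trans ?_
  have : (0 : ℝ) ≤ 1 / (n : ℝ) := by positivity
  linarith

lemma row_sum_le (I : Finset ℕ) (t : ℕ) :
    ∑ u ∈ I, (1 / (((t - u : ℕ) + (u - t : ℕ) : ℕ) + 1 : ℝ) ^ 2) ≤ 4 := by
  classical
  have hsplit : ∀ J : Finset ℕ, ∀ f : ℕ → ℕ, Set.InjOn f J →
      ∑ u ∈ J, (1 / ((f u : ℝ) + 1) ^ 2) ≤ 2 := by
    intro J f hf
    have h1 : ∑ u ∈ J, (1 / ((f u : ℝ) + 1) ^ 2) = ∑ m ∈ J.image f, 1 / ((m : ℝ) + 1) ^ 2 :=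
      (Finset.sum_image (f := fun m : ℕ => 1 / ((m : ℝ) + 1) ^ 2) hf).symm
    rw [h1]
    refine le_trans ?_ (sum_inv_sq_le ((J.image f).sup id + 1))
    refine Finset.sum_le_sum_of_subset_of_nonneg (fun x hx => ?_) fun _ _ _ => by positivity
    rw [Finset.mem_range, Nat.lt_succ_iff]
    exact Finset.le_sup (f := id) hx
  rw [← Finset.sum_filter_add_sum_filter_not I (fun u => u ≤ t)]
  have h1 := hsplit (I.filter (fun u => u ≤ t)) (fun u => (t - u) + (u - t)) (by
    intro x hx y hy hxy
    simp at hx hy hxy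
    omega)
  have h2 := hsplit (I.filter (fun u => ¬ u ≤ t)) (fun u => (t - u) + (u - t)) (by
    intro x hx y hy hxy
    simp at hx hy hxy
    omega)
  linarith

theorem MixProc.cov_sum (M : MixProc P Z θ ε r C) {h : 𝒵 × 𝒵 → ℝ} (hm : Measurable h)
    {a : 𝒵 → ℝ} (ham : Measurable a) (ha0 : ∀ z, 0 ≤ a z)
    (hab : ∀ z z', |h (z, z')| ≤ a z * a z')
    (hai : Integrable (fun z => a z ^ (2 + 2 * ε)) θ) {lam : ℝ} (hlam : 0 < lam)
    (hal : ∫ z, a z ^ (2 + 2 * ε) ∂θ ≤ lam ^ (1 + ε))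
    (h0 : ∫ p, h p ∂(θ.prod θ) = 0) (I : Finset ℕ) :
    ∑ t ∈ I, ∑ u ∈ I, |∫ ω, h (Z t ω, Z u ω) ∂P| ≤ 4 * cc C * lam * I.card := by
  have hC := M.C0
  have hcc : 0 ≤ cc C := by unfold cc; positivity
  calc _ ≤ ∑ t ∈ I, ∑ u ∈ I, cc C * lam * (1 / (((t - u : ℕ) + (u - t : ℕ) : ℕ) + 1 : ℝ) ^ 2) :=
        Finset.sum_le_sum fun t _ => Finset.sum_le_sum fun u _ =>
          M.cov_bound hm ham ha0 hab hai hlam hal h0 t u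
    _ ≤ ∑ t ∈ I, cc C * lam * 4 := by
        refine Finset.sum_le_sum fun t _ => ?_
        rw [← Finset.mul_sum]
        have := row_sum_le I t
        gcongr
    _ = _ := by rw [Finset.sum_const, nsmul_eq_mul]; ring

end

end

section

/-! ## Part 3: Hilbert space valued bounds and limiting covariances -/

/-- The exponent `2 + 2ε`. -/
def qe (ε : ℝ) : ℝ≥0∞ := ENNReal.ofReal (2 + 2 * ε)

section
variable {Ω 𝒵 : Type*} [MeasurableSpace Ω] [MeasurableSpace 𝒵] {P : Measure Ω}
    [IsProbabilityMeasure P]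
    {Z : ℕ → Ω → 𝒵} {θ : Measure 𝒵} {ε r C : ℝ}
    {E : Type*} [NormedAddCommGroup E] 

lemma qe_ge_two (hε : 0 < ε) : 2 ≤ qe ε := by
  unfold qe
  rw [show (2 : ℝ≥0∞) = ENNReal.ofReal 2 by simp]
  exact ENNReal.ofReal_le_ofReal (by linarith)

lemma qe_ge_one (hε : 0 < ε) : 1 ≤ qe ε := le_trans (by norm_num) (qe_ge_two hε)

lemma qe_ne_zero (hε : 0 < ε) : qe ε ≠ 0 := (zero_lt_one.trans_le (qe_ge_one hε)).ne'
lemma qe_ne_top : qe ε ≠ ∞ := ENNReal.ofReal_ne_top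
lemma qe_toReal (hε : 0 < ε) : (qe ε).toReal = 2 + 2 * ε := ENNReal.toReal_ofReal (by linarith)

/-- the `L^{2+2ε}` norm -/
def Nq (ε : ℝ) (θ : Measure 𝒵) (ξ : 𝒵 → E) : ℝ := (eLpNorm ξ (qe ε) θ).toReal

lemma Nq_nonneg (ξ : 𝒵 → E) : 0 ≤ Nq ε θ ξ := ENNReal.toReal_nonneg

lemma moment_int (hε : 0 < ε) {ξ : 𝒵 → E} (hξ : MemLp ξ (qe ε) θ) :
    Integrable (fun z => ‖ξ z‖ ^ (2 + 2 * ε)) θ := by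
  have := hξ.integrable_norm_rpow (qe_ne_zero hε) qe_ne_top
  rwa [qe_toReal hε] at this

lemma moment_le (hε : 0 < ε) {ξ : 𝒵 → E} (hξ : MemLp ξ (qe ε) θ) {lam : ℝ}
    (hl : Nq ε θ ξ ^ 2 ≤ lam) : ∫ z, ‖ξ z‖ ^ (2 + 2 * ε) ∂θ ≤ lam ^ (1 + ε) := by
  have hnn : 0 ≤ ∫ z, ‖ξ z‖ ^ (2 + 2 * ε) ∂θ := integral_nonneg fun z => by positivity
  have h1 : Nq ε θ ξ = (∫ z, ‖ξ z‖ ^ (2 + 2 * ε) ∂θ) ^ (2 + 2 * ε)⁻¹ := by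
    unfold Nq
    rw [hξ.eLpNorm_eq_integral_rpow_norm (qe_ne_zero hε) qe_ne_top, qe_toReal hε,
      ENNReal.toReal_ofReal (by positivity)]
  calc ∫ z, ‖ξ z‖ ^ (2 + 2 * ε) ∂θ = (Nq ε θ ξ ^ 2) ^ (1 + ε) := by
        rw [h1, ← Real.rpow_natCast, ← Real.rpow_mul hnn, ← Real.rpow_mul hnn]
        have : (2 + 2 * ε)⁻¹ * ((2 : ℕ) : ℝ) * (1 + ε) = 1 := by
          push_cast
          have : 2 + 2 * ε ≠ 0 := by positivity
          field_simp
        rw [this, Real.rpow_one]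
    _ ≤ _ := Real.rpow_le_rpow (by positivity) hl (by linarith)

lemma MixProc.memLp_comp (M : MixProc P Z θ ε r C) {ξ : 𝒵 → E} {q : ℝ≥0∞} (hξ : MemLp ξ q θ)
    (t : ℕ) : MemLp (fun ω => ξ (Z t ω)) q P :=
  hξ.comp_measurePreserving (M.mp t)

lemma MixProc.int_comp (M : MixProc P Z θ ε r C) [NormedSpace ℝ E] {ξ : 𝒵 → E}
    (hm : AEStronglyMeasurable ξ θ) (t : ℕ) : ∫ ω, ξ (Z t ω) ∂P = ∫ z, ξ z ∂θ := by
  rw [← M.law t] at hm ⊢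
  rw [integral_map (M.meas t).aemeasurable hm]

end
section
variable {Ω 𝒵 : Type*} [MeasurableSpace Ω] [MeasurableSpace 𝒵] {P : Measure Ω}
    [IsProbabilityMeasure P]
    {Z : ℕ → Ω → 𝒵} {θ : Measure 𝒵} {ε r C : ℝ}
    {E : Type*} [NormedAddCommGroup E] [InnerProductSpace ℝ E] [CompleteSpace E]

lemma memLp_inner {f g : Ω → E} (hf : MemLp f 2 P) (hg : MemLp g 2 P) :
    Integrable (fun ω => inner ℝ (f ω) (g ω)) P :=
  (hf.norm.integrable_mul hg.norm).mono'
    (hf.aestronglyMeasurable.inner hg.aestronglyMeasurable)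
    (Eventually.of_forall fun _ => norm_inner_le_norm _ _)

theorem MixProc.L2_bound (M : MixProc P Z θ ε r C) {ξ : 𝒵 → E} (hm : StronglyMeasurable ξ)
    (hξ : MemLp ξ (qe ε) θ) (h0 : ∫ z, ξ z ∂θ = 0) (I : Finset ℕ) :
    ∫ ω, ‖∑ t ∈ I, ξ (Z t ω)‖ ^ 2 ∂P ≤ 4 * cc C * Nq ε θ ξ ^ 2 * I.card := by
  have := M.prob
  have hε := M.eps
  have hC := M.C0
  have hcc : 0 ≤ cc C := by unfold cc; positivity
  have hξ2 : MemLp ξ 2 θ := hξ.mono_exponent (qe_ge_two hε)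
  have hξ1 : Integrable ξ θ := hξ.integrable (qe_ge_one hε)
  let h : 𝒵 × 𝒵 → ℝ := fun p => inner ℝ (ξ p.1) (ξ p.2)
  have hhm : Measurable h :=
    ((hm.comp_measurable measurable_fst).inner (hm.comp_measurable measurable_snd)).measurable
  have hh0 : ∫ p, h p ∂(θ.prod θ) = 0 := by
    have hi : Integrable h (θ.prod θ) := by
      refine (hξ1.norm.mul_prod hξ1.norm).mono' hhm.aestronglyMeasurable
        (Eventually.of_forall fun p => ?_)
      exact norm_inner_le_norm _ _
    rw [integral_prod _ hi]
    simp only [h]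
    have : ∀ x, ∫ y, inner ℝ (ξ x) (ξ y) ∂θ = 0 := by
      intro x
      rw [integral_inner hξ1, h0, inner_zero_right]
    simp [this]
  have key : ∀ η : ℝ, 0 < η →
      ∫ ω, ‖∑ t ∈ I, ξ (Z t ω)‖ ^ 2 ∂P ≤ 4 * cc C * (Nq ε θ ξ ^ 2 + η) * I.card := by
    intro η hη
    have hs := M.cov_sum hhm (a := fun z => ‖ξ z‖) hm.norm.measurable (fun z => norm_nonneg _)
      (fun z z' => abs_real_inner_le_norm _ _) (moment_int hε hξ)
      (lam := Nq ε θ ξ ^ 2 + η) (by positivity) (moment_le hε hξ (by linarith)) hh0 I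
    refine le_trans ?_ hs
    have e1 : ∀ ω, ‖∑ t ∈ I, ξ (Z t ω)‖ ^ 2 = ∑ t ∈ I, ∑ u ∈ I, h (Z t ω, Z u ω) := by
      intro ω
      rw [← real_inner_self_eq_norm_sq, sum_inner]
      simp only [inner_sum, h]
    simp only [e1]
    rw [integral_finsetSum]
    · refine Finset.sum_le_sum fun t _ => ?_
      rw [integral_finsetSum]
      · exact Finset.sum_le_sum fun u _ => le_abs_self _
      · intro u _
        exact memLp_inner (M.memLp_comp hξ2 t) (M.memLp_comp hξ2 u)
    · intro t _
      exact integrable_finsetSum _ fun u _ =>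
        memLp_inner (M.memLp_comp hξ2 t) (M.memLp_comp hξ2 u)
  refine le_of_forall_pos_le_add fun η hη => ?_
  have hd : 0 < 4 * cc C * I.card + 1 := by positivity
  have := key (η / (4 * cc C * I.card + 1)) (by positivity)
  refine this.trans ?_
  have h3 : 4 * cc C * I.card * (η / (4 * cc C * I.card + 1)) ≤ η := by
    rw [mul_div_assoc', div_le_iff₀ hd]; nlinarith
  linarith

/-- covariance at lag -/
lemma MixProc.cov_scalar (M : MixProc P Z θ ε r C) {g₁ g₂ : 𝒵 → ℝ} (hm₁ : Measurable g₁)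
    (hm₂ : Measurable g₂) (h₁ : MemLp g₁ (qe ε) θ) (h₂ : MemLp g₂ (qe ε) θ)
    (z₁ : ∫ z, g₁ z ∂θ = 0) :
    ∃ K, ∀ t u, |∫ ω, g₁ (Z t ω) * g₂ (Z u ω) ∂P| ≤
      K * (1 / (((t - u : ℕ) + (u - t : ℕ) : ℕ) + 1 : ℝ) ^ 2) := by
  have := M.prob
  have hε := M.eps
  have ha : MemLp (fun z => |g₁ z| + |g₂ z|) (qe ε) θ := h₁.abs.add h₂.abs
  have hh0 : ∫ p : 𝒵 × 𝒵, g₁ p.1 * g₂ p.2 ∂(θ.prod θ) = 0 := by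
    rw [integral_prod_mul, z₁, zero_mul]
  have e : ∀ z, ‖|g₁ z| + |g₂ z|‖ = |g₁ z| + |g₂ z| := fun z =>
    Real.norm_of_nonneg (by positivity)
  have hInte := moment_int hε ha
  have hle := moment_le hε ha (lam := Nq ε θ (fun z => |g₁ z| + |g₂ z|) ^ 2 + 1) (by linarith)
  simp only [e] at hInte hle
  refine ⟨_, fun t u => M.cov_bound (h := fun p => g₁ p.1 * g₂ p.2) (by fun_prop)
    (a := fun z => |g₁ z| + |g₂ z|) (by fun_prop) (fun z => by positivity) (fun z z' => ?_)
    hInte (by positivity) hle hh0 t u⟩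
  simp only
  rw [abs_mul]
  have := abs_nonneg (g₁ z); have := abs_nonneg (g₁ z'); have := abs_nonneg (g₂ z)
  have := abs_nonneg (g₂ z')
  gcongr <;> linarith

lemma MixProc.cov_shift (M : MixProc P Z θ ε r C) {g₁ g₂ : 𝒵 → ℝ} (hm₁ : Measurable g₁)
    (hm₂ : Measurable g₂) (t u s : ℕ) :
    ∫ ω, g₁ (Z (t + s) ω) * g₂ (Z (u + s) ω) ∂P = ∫ ω, g₁ (Z t ω) * g₂ (Z u ω) ∂P :=
  M.path_int s (F := fun x => g₁ (x t) * g₂ (x u))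
    (by apply Measurable.stronglyMeasurable; fun_prop)

/-- Existence of the long-run covariance. -/
theorem MixProc.cov_limit (M : MixProc P Z θ ε r C) {g₁ g₂ : 𝒵 → ℝ} (hm₁ : Measurable g₁)
    (hm₂ : Measurable g₂) (h₁ : MemLp g₁ (qe ε) θ) (h₂ : MemLp g₂ (qe ε) θ)
    (z₁ : ∫ z, g₁ z ∂θ = 0) :
    ∃ G : ℝ, Tendsto (fun n : ℕ => (n : ℝ)⁻¹ * ∑ t ∈ Finset.range n, ∑ u ∈ Finset.range n,
      ∫ ω, g₁ (Z t ω) * g₂ (Z u ω) ∂P) atTop (𝓝 G) := by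
  obtain ⟨K, hK⟩ := M.cov_scalar hm₁ hm₂ h₁ h₂ z₁
  let c : ℕ → ℕ → ℝ := fun t u => ∫ ω, g₁ (Z t ω) * g₂ (Z u ω) ∂P
  have hc : ∀ t u, |c t u| ≤ K * (1 / (((t - u : ℕ) + (u - t : ℕ) : ℕ) + 1 : ℝ) ^ 2) := hK
  have hs : Summable (fun m : ℕ => K * (1 / ((m : ℝ) + 1) ^ 2)) := by
    apply Summable.mul_left
    have := (summable_nat_add_iff (f := fun m : ℕ => 1 / (m : ℝ) ^ 2) 1).2
      (Real.summable_one_div_nat_pow.2 (by norm_num))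
    simpa using this
  have s1 : Summable (fun m : ℕ => c 0 (m + 1)) := by
    refine Summable.of_norm_bounded ((summable_nat_add_iff 1).2 hs) fun m => ?_
    simpa using hc 0 (m + 1)
  have s2 : Summable (fun m : ℕ => c (m + 1) 0) := by
    refine Summable.of_norm_bounded ((summable_nat_add_iff 1).2 hs) fun m => ?_
    simpa using hc (m + 1) 0
  -- the increments
  let b : ℕ → ℝ := fun n => c 0 0 + ∑ m ∈ Finset.range n, c 0 (m + 1) +
    ∑ m ∈ Finset.range n, c (m + 1) 0
  have hb : Tendsto b atTop (𝓝 (c 0 0 + ∑' m, c 0 (m + 1) + ∑' m, c (m + 1) 0)) :=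
    (tendsto_const_nhds.add s1.hasSum.tendsto_sum_nat).add s2.hasSum.tendsto_sum_nat
  refine ⟨_, (hb.cesaro).congr fun n => ?_⟩
  congr 1
  have csh : ∀ t u s, c (t + s) (u + s) = c t u := fun t u s => M.cov_shift hm₁ hm₂ t u s
  show _ = ∑ t ∈ Finset.range n, ∑ u ∈ Finset.range n, c t u
  induction n with
  | zero => simp
  | succ n ih =>
    rw [Finset.sum_range_succ, ih, Finset.sum_range_succ]
    simp only [Finset.sum_range_succ (fun u => c _ u) n, Finset.sum_add_distrib]
    have e1 : ∑ m ∈ Finset.range n, c 0 (m + 1) = ∑ t ∈ Finset.range n, c t n := by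
      rw [← Finset.sum_range_reflect]
      refine Finset.sum_congr rfl fun t ht => ?_
      have := Finset.mem_range.1 ht
      rw [← csh 0 _ t]
      congr 1 <;> omega
    have e2 : ∑ m ∈ Finset.range n, c (m + 1) 0 = ∑ t ∈ Finset.range n, c n t := by
      rw [← Finset.sum_range_reflect]
      refine Finset.sum_congr rfl fun t ht => ?_
      have := Finset.mem_range.1 ht
      rw [← csh _ 0 t]
      congr 1 <;> omega
    have e3 : c n n = c 0 0 := by simpa using csh 0 0 n
    simp only [b, e1, e2, e3]
    ring

end

end

section

/-! ## Part 4: CLT for bounded functions of the process -/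

/-- `exp (i x)`. -/
def ee (x : ℝ) : ℂ := Complex.exp (Complex.I * x)

lemma ee_add (x y : ℝ) : ee (x + y) = ee x * ee y := by
  unfold ee; rw [← Complex.exp_add]; push_cast; ring_nf

lemma norm_ee (x : ℝ) : ‖ee x‖ = 1 := by
  unfold ee; rw [mul_comm]; exact Complex.norm_exp_ofReal_mul_I x

lemma ee_zero : ee 0 = 1 := by simp [ee]

lemma continuous_ee : Continuous ee := by unfold ee; fun_prop

lemma ee_lip (x y : ℝ) : ‖ee x - ee y‖ ≤ |x - y| := by
  have : ee x - ee y = ee y * (ee (x - y) - 1) := by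
    rw [mul_sub, ← ee_add]; simp
  rw [this, norm_mul, norm_ee, one_mul]
  exact Real.norm_exp_I_mul_ofReal_sub_one_le

lemma ee_taylor {x : ℝ} (hx : |x| ≤ 1) : ‖ee x - (1 + Complex.I * x - (x : ℂ) ^ 2 / 2)‖ ≤ |x| ^ 3 := by
  have h := Complex.exp_bound (x := Complex.I * x) (by simpa using hx) (n := 3) (by norm_num)
  have e : ∑ m ∈ Finset.range 3, (Complex.I * (x : ℂ)) ^ m / (m.factorial : ℂ)
      = 1 + Complex.I * x - (x : ℂ) ^ 2 / 2 := by
    simp [Finset.sum_range_succ, mul_pow, Nat.factorial]; ring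
  rw [e] at h
  refine h.trans ?_
  simp only [norm_mul, Complex.norm_I, one_mul, Complex.norm_real, Real.norm_eq_abs]
  have : 0 ≤ |x| ^ 3 := by positivity
  norm_num [Nat.factorial]
  linarith

lemma pow_diff_le {a b : ℂ} (ha : ‖a‖ ≤ 1) (hb : ‖b‖ ≤ 1) (k : ℕ) :
    ‖a ^ k - b ^ k‖ ≤ k * ‖a - b‖ := by
  induction k with
  | zero => simp
  | succ k ih =>
    have e : a ^ (k + 1) - b ^ (k + 1) = a * (a ^ k - b ^ k) + (a - b) * b ^ k := by ring
    rw [e]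
    refine (norm_add_le _ _).trans ?_
    rw [norm_mul, norm_mul, norm_pow]
    have h1 : ‖b‖ ^ k ≤ 1 := pow_le_one₀ (norm_nonneg _) hb
    have h2 : ‖a‖ * ‖a ^ k - b ^ k‖ ≤ 1 * (k * ‖a - b‖) := by gcongr
    have h3 : ‖a - b‖ * ‖b‖ ^ k ≤ ‖a - b‖ * 1 := by gcongr
    push_cast
    linarith

section
variable {Ω 𝒵 : Type*} [MeasurableSpace Ω] [MeasurableSpace 𝒵] {P : Measure Ω}
    [IsProbabilityMeasure P]
    {Z : ℕ → Ω → 𝒵} {θ : Measure 𝒵} {ε r C : ℝ}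

lemma int_abs_le_sqrt {X : Ω → ℝ} (hX : MemLp X 2 P) :
    ∫ ω, |X ω| ∂P ≤ √(∫ ω, X ω ^ 2 ∂P) := by
  apply Real.le_sqrt_of_sq_le
  have h1 := hX.abs
  have h2 := variance_nonneg |X| P
  rw [variance_eq_sub h1] at h2
  simp only [Pi.pow_apply, Pi.abs_apply, sq_abs] at h2
  linarith

lemma ee_integrable {X : Ω → ℝ} (hX : AEMeasurable X P) : Integrable (fun ω => ee (X ω)) P :=
  Integrable.of_bound (continuous_ee.measurable.comp_aemeasurable hX).aestronglyMeasurable 1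
    (Eventually.of_forall fun _ => (norm_ee _).le)

lemma ee_int_diff {X Y : Ω → ℝ} (hX : MemLp X 2 P) (hY : MemLp Y 2 P) :
    ‖∫ ω, ee (X ω) ∂P - ∫ ω, ee (Y ω) ∂P‖ ≤ √(∫ ω, (X ω - Y ω) ^ 2 ∂P) := by
  rw [← integral_sub (ee_integrable hX.aestronglyMeasurable.aemeasurable)
    (ee_integrable hY.aestronglyMeasurable.aemeasurable)]
  refine (norm_integral_le_of_norm_le (((hX.sub hY).integrable (by norm_num)).abs)
    (Eventually.of_forall fun ω => ?_)).trans (int_abs_le_sqrt (hX.sub hY))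
  exact ee_lip _ _

lemma ee_beta (hZ : ∀ i, Measurable (Z i)) (l n : ℕ) {U V : Ω → ℝ}
    (hU : Measurable[sigmaUpTo Z (l + 1)] U) (hV : Measurable[sigmaFrom Z (l + n)] V) :
    ‖∫ ω, ee (U ω + V ω) ∂P - (∫ ω, ee (U ω) ∂P) * ∫ ω, ee (V ω) ∂P‖ ≤ 8 * betaProc P Z n := by
  have hU' : Measurable U := hU.mono (sigmaUpTo_le hZ _) le_rfl
  have hV' : Measurable V := hV.mono (sigmaFrom_le hZ _) le_rfl
  have : IsProbabilityMeasure (P.map U) := Measure.isProbabilityMeasure_map hU'.aemeasurable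
  have : IsProbabilityMeasure (P.map V) := Measure.isProbabilityMeasure_map hV'.aemeasurable
  have e1 : (∫ ω, ee (U ω) ∂P) * ∫ ω, ee (V ω) ∂P =
      ∫ w : ℝ × ℝ, ee (w.1 + w.2) ∂((P.map U).prod (P.map V)) := by
    simp only [ee_add]
    rw [integral_prod_mul, integral_map hU'.aemeasurable
      continuous_ee.aestronglyMeasurable, integral_map hV'.aemeasurable
      continuous_ee.aestronglyMeasurable]
  rw [e1]
  have hc : Measurable (fun w : ℝ × ℝ => ee (w.1 + w.2)) :=
    continuous_ee.measurable.comp (by fun_prop)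
  have i1 : Integrable (fun ω => ee (U ω + V ω)) P := ee_integrable (hU'.add hV').aemeasurable
  have i2 : Integrable (fun w : ℝ × ℝ => ee (w.1 + w.2)) ((P.map U).prod (P.map V)) :=
    ee_integrable (by fun_prop)
  have b1 := beta_bound P hZ l n hU hV (h := fun w : ℝ × ℝ => (ee (w.1 + w.2)).re)
    (Complex.measurable_re.comp hc) zero_le_one
    (fun w => (Complex.abs_re_le_norm _).trans (norm_ee _).le)
  have b2 := beta_bound P hZ l n hU hV (h := fun w : ℝ × ℝ => (ee (w.1 + w.2)).im)
    (Complex.measurable_im.comp hc) zero_le_one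
    (fun w => (Complex.abs_im_le_norm _).trans (norm_ee _).le)
  refine (Complex.norm_le_abs_re_add_abs_im _).trans ?_
  rw [Complex.sub_re, Complex.sub_im]
  have r1 := integral_re i1
  have r2 := integral_re i2
  have m1 := integral_im i1
  have m2 := integral_im i2
  simp only [RCLike.re_to_complex, RCLike.im_to_complex] at r1 r2 m1 m2
  rw [← r1, ← r2, ← m1, ← m2]
  linarith

/-- sum over a block -/
def blk (g : 𝒵 → ℝ) (Z : ℕ → Ω → 𝒵) (s p : ℕ) (ω : Ω) : ℝ := ∑ i ∈ Finset.range p, g (Z (s + i) ω)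

/-- factorisation of the characteristic function over separated blocks. -/
lemma MixProc.blocks (M : MixProc P Z θ ε r C) {g : 𝒵 → ℝ} (hg : Measurable g) (c : ℝ)
    (p q : ℕ) (hp : 1 ≤ p) (k : ℕ) :
    ‖∫ ω, ee (∑ j ∈ Finset.range k, c * blk g Z (j * (p + q)) p ω) ∂P
      - (∫ ω, ee (c * blk g Z 0 p ω) ∂P) ^ k‖ ≤ k * (8 * betaProc P Z (q + 1)) := by
  have hst : ∀ s, ∫ ω, ee (c * blk g Z s p ω) ∂P = ∫ ω, ee (c * blk g Z 0 p ω) ∂P := by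
    intro s
    have := M.path_int s (F := fun x => ee (c * ∑ i ∈ Finset.range p, g (x i))) (by
      apply Measurable.stronglyMeasurable
      refine continuous_ee.measurable.comp ?_
      fun_prop)
    simp only [blk, zero_add]
    simp only [add_comm s]
    exact this
  have hm1 : ∀ s l, s + p ≤ l → Measurable[sigmaUpTo Z l] (blk g Z s p) := by
    intro s l h
    refine @Finset.measurable_fun_sum _ _ _ _ _ _ (_) _ _ fun i hi => ?_
    exact hg.comp (measurable_sigmaUpTo Z (by have := Finset.mem_range.1 hi; omega))
  have hm2 : ∀ s l, l ≤ s → Measurable[sigmaFrom Z l] (blk g Z s p) := by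
    intro s l h
    refine @Finset.measurable_fun_sum _ _ _ _ _ _ (_) _ _ fun i hi => ?_
    exact hg.comp (measurable_sigmaFrom Z (by omega))
  have hn1 : ‖∫ ω, ee (c * blk g Z 0 p ω) ∂P‖ ≤ 1 := by
    refine (norm_integral_le_of_norm_le (integrable_const (1 : ℝ))
      (Eventually.of_forall fun ω => (norm_ee _).le)).trans (by simp)
  induction k with
  | zero => simp [ee_zero]
  | succ k ih =>
    set D := ∫ ω, ee (c * blk g Z 0 p ω) ∂P with hD
    have step : ‖∫ ω, ee (∑ j ∈ Finset.range (k + 1), c * blk g Z (j * (p + q)) p ω) ∂P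
        - (∫ ω, ee (∑ j ∈ Finset.range k, c * blk g Z (j * (p + q)) p ω) ∂P) * D‖
        ≤ 8 * betaProc P Z (q + 1) := by
      rcases Nat.eq_zero_or_pos k with rfl | hk
      · simp only [zero_add, Finset.range_one, Finset.sum_singleton, zero_mul, Finset.range_zero,
          Finset.sum_empty, ee_zero]
        rw [← hD]
        have hb : 0 ≤ betaProc P Z (q + 1) := by
          have := ee_beta (P := P) (Z := Z) M.meas 0 (q + 1) (U := fun _ => 0) (V := fun _ => 0)
            (@measurable_const _ _ _ (_) _) (@measurable_const _ _ _ (_) _)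
          have := (norm_nonneg _).trans this
          linarith
        simpa using hb
      · simp only [Finset.sum_range_succ]
        rw [← hst (k * (p + q))]
        obtain ⟨k, rfl⟩ := Nat.exists_eq_succ_of_ne_zero hk.ne'
        obtain ⟨p', rfl⟩ := Nat.exists_eq_succ_of_ne_zero (by omega : p ≠ 0)
        refine ee_beta (P := P) M.meas (k * (p' + 1 + q) + p') (q + 1)
          (U := fun ω => ∑ j ∈ Finset.range (k + 1), c * blk g Z (j * (p' + 1 + q)) (p' + 1) ω) ?_ ?_
        · refine @Finset.measurable_fun_sum _ _ _ _ _ _ (_) _ _ fun j hj => ?_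
          refine @Measurable.const_mul _ _ _ _ _ (_) _ (hm1 _ _ ?_) _
          have : j ≤ k := by have := Finset.mem_range.1 hj; omega
          have := Nat.mul_le_mul_right (p' + 1 + q) this
          simp only [Nat.succ_eq_add_one]
          omega
        · refine @Measurable.const_mul _ _ _ _ _ (_) _ (hm2 _ _ ?_) _
          simp only [Nat.succ_eq_add_one]
          ring_nf
          omega
    have e : ∀ A B : ℂ, A - D ^ (k + 1) = (A - B * D) + (B - D ^ k) * D := by intro A B; ring
    rw [e _ (∫ ω, ee (∑ j ∈ Finset.range k, c * blk g Z (j * (p + q)) p ω) ∂P)]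
    refine (norm_add_le _ _).trans ?_
    rw [norm_mul]
    have h3 := mul_le_mul ih hn1 (norm_nonneg _) ((norm_nonneg _).trans ih)
    push_cast
    linarith

end

end

section

/-- eighth root -/
def rt8 (n : ℕ) : ℕ := Nat.sqrt (Nat.sqrt (Nat.sqrt n))

lemma rt8_le (n : ℕ) : rt8 n ^ 8 ≤ n := by
  have h1 := Nat.sqrt_le' n
  have h2 := Nat.sqrt_le' (Nat.sqrt n)
  have h3 := Nat.sqrt_le' (Nat.sqrt (Nat.sqrt n))
  calc rt8 n ^ 8 = ((rt8 n ^ 2) ^ 2) ^ 2 := by ring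
    _ ≤ ((Nat.sqrt (Nat.sqrt n)) ^ 2) ^ 2 := by gcongr; exact h3
    _ ≤ (Nat.sqrt n) ^ 2 := by gcongr
    _ ≤ n := h1

lemma lt_rt8 (n : ℕ) : n < (rt8 n + 1) ^ 8 := by
  have h1 := Nat.lt_succ_sqrt' n
  have h2 := Nat.lt_succ_sqrt' (Nat.sqrt n)
  have h3 := Nat.lt_succ_sqrt' (Nat.sqrt (Nat.sqrt n))
  calc n < (Nat.sqrt n + 1) ^ 2 := h1
    _ ≤ ((Nat.sqrt (Nat.sqrt n) + 1) ^ 2) ^ 2 := by gcongr; exact h2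
    _ ≤ (((rt8 n + 1) ^ 2) ^ 2) ^ 2 := by gcongr; exact h3
    _ = _ := by ring

lemma rt8_tendsto : Tendsto rt8 atTop atTop := by
  refine tendsto_atTop.2 fun b => ?_
  filter_upwards [eventually_ge_atTop ((b + 1) ^ 8)] with n hn
  by_contra h
  push Not at h
  have := lt_rt8 n
  have h2 : (rt8 n + 1) ^ 8 ≤ (b + 1) ^ 8 := by gcongr
  omega

section
variable {Ω 𝒵 : Type*} [MeasurableSpace Ω] [MeasurableSpace 𝒵] {P : Measure Ω}
    [IsProbabilityMeasure P]
    {Z : ℕ → Ω → 𝒵} {θ : Measure 𝒵} {ε r C : ℝ}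

lemma ee_moment {X : Ω → ℝ} (hm : Measurable X) {b : ℝ} (hb : ∀ ω, |X ω| ≤ b) (hb1 : b ≤ 1)
    (h0 : ∫ ω, X ω ∂P = 0) :
    ‖∫ ω, ee (X ω) ∂P - (Real.exp (-(∫ ω, X ω ^ 2 ∂P) / 2) : ℂ)‖ ≤
      b * (∫ ω, X ω ^ 2 ∂P) + (∫ ω, X ω ^ 2 ∂P) ^ 2 := by
  have hb0 : 0 ≤ b := by
    obtain ⟨ω⟩ : Nonempty Ω := nonempty_of_isProbabilityMeasure P
    exact (abs_nonneg _).trans (hb ω)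
  have i1 : Integrable X P := Integrable.of_bound hm.aestronglyMeasurable b
    (Eventually.of_forall hb)
  have i2 : Integrable (fun ω => X ω ^ 2) P := by
    refine Integrable.of_bound (hm.pow_const 2).aestronglyMeasurable (b ^ 2)
      (Eventually.of_forall fun ω => ?_)
    rw [norm_pow]; exact pow_le_pow_left₀ (norm_nonneg _) (hb ω) 2
  set V := ∫ ω, X ω ^ 2 ∂P with hV
  have hV0 : 0 ≤ V := integral_nonneg fun ω => by positivity
  have hV1 : V ≤ 1 := by
    have : V ≤ ∫ ω, (1 : ℝ) ∂P := by
      refine integral_mono i2 (integrable_const _) fun ω => ?_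
      have := (hb ω).trans hb1
      simp only
      rw [← sq_abs]
      exact pow_le_one₀ (abs_nonneg _) this
    simpa using this
  have e1 : ∫ ω, (1 + Complex.I * (X ω : ℂ) - (X ω : ℂ) ^ 2 / 2) ∂P = 1 - (V : ℂ) / 2 := by
    have j1 : Integrable (fun ω => Complex.I * (X ω : ℂ)) P := i1.ofReal.const_mul _
    have j2 : Integrable (fun ω => (X ω : ℂ) ^ 2 / 2) P := by
      have := i2.ofReal (𝕜 := ℂ)
      simp only [RCLike.ofReal_pow] at this
      exact this.div_const 2
    have j0 : Integrable (fun ω => (1 : ℂ) + Complex.I * (X ω : ℂ)) P := (integrable_const _).add j1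
    rw [integral_sub j0 j2, integral_add (integrable_const _) j1,
      integral_const_mul, integral_div, integral_complex_ofReal, h0]
    have : ∫ ω, (X ω : ℂ) ^ 2 ∂P = (V : ℂ) := by
      rw [hV, ← integral_complex_ofReal]; simp
    rw [this]; simp
  have j3 : Integrable (fun ω => 1 + Complex.I * (X ω : ℂ) - (X ω : ℂ) ^ 2 / 2) P := by
    have := i2.ofReal (𝕜 := ℂ)
    simp only [RCLike.ofReal_pow] at this
    exact ((integrable_const _).add (i1.ofReal.const_mul _)).sub (this.div_const 2)
  have h1 : ‖∫ ω, ee (X ω) ∂P - (1 - (V : ℂ) / 2)‖ ≤ b * V := by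
    rw [← e1, ← integral_sub (ee_integrable hm.aemeasurable) j3]
    refine (norm_integral_le_of_norm_le (i2.const_mul b)
      (Eventually.of_forall fun ω => ?_)).trans (by rw [integral_const_mul])
    refine (ee_taylor ((hb ω).trans hb1)).trans ?_
    rw [pow_succ', sq_abs]
    exact mul_le_mul_of_nonneg_right (hb ω) (by positivity)
  have h2 : ‖(1 - (V : ℂ) / 2) - (Real.exp (-V / 2) : ℂ)‖ ≤ V ^ 2 := by
    have := Real.abs_exp_sub_one_sub_id_le (x := -V / 2) (by rw [abs_le]; constructor <;> linarith)
    have e : (1 - (V : ℂ) / 2) - (Real.exp (-V / 2) : ℂ) =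
        ((-(Real.exp (-V / 2) - 1 - (-V / 2)) : ℝ) : ℂ) := by push_cast; ring
    rw [e, Complex.norm_real, norm_neg]
    refine this.trans ?_
    nlinarith
  calc _ = ‖(∫ ω, ee (X ω) ∂P - (1 - (V : ℂ) / 2)) + ((1 - (V : ℂ) / 2) - (Real.exp (-V / 2) : ℂ))‖ := by
        congr 1; ring
    _ ≤ _ := (norm_add_le _ _).trans (add_le_add h1 h2)

lemma blk_cov (k p q n : ℕ) (hn : k * (p + q) ≤ n) : ∃ A : Finset ℕ,
    A ⊆ Finset.range n ∧ A.card = k * p ∧ ∀ (f : ℕ → ℝ),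
      ∑ t ∈ A, f t = ∑ j ∈ Finset.range k, ∑ i ∈ Finset.range p, f (j * (p + q) + i) := by
  classical
  have hinj : Set.InjOn (fun x : ℕ × ℕ => x.1 * (p + q) + x.2)
      (Finset.range k ×ˢ Finset.range p : Finset (ℕ × ℕ)) := by
    rintro ⟨j, i⟩ h ⟨j', i'⟩ h' he
    simp only [Finset.coe_product, Set.mem_prod, Finset.mem_coe, Finset.mem_range] at h h' he
    have hj : j = j' := by
      rcases lt_trichotomy j j' with hl | hl | hl
      · have := Nat.mul_le_mul_right (p + q) (show j + 1 ≤ j' from hl)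
        rw [add_mul] at this
        omega
      · exact hl
      · have := Nat.mul_le_mul_right (p + q) (show j' + 1 ≤ j from hl)
        rw [add_mul] at this
        omega
    subst hj
    have : i = i' := by omega
    rw [this]
  refine ⟨(Finset.range k ×ˢ Finset.range p).image (fun x => x.1 * (p + q) + x.2), ?_, ?_, ?_⟩
  · intro t ht
    simp only [Finset.mem_image, Finset.mem_product, Finset.mem_range, Prod.exists] at ht ⊢
    obtain ⟨j, i, ⟨hj, hi⟩, rfl⟩ := ht
    have := Nat.mul_le_mul_right (p + q) (show j + 1 ≤ k from hj)
    rw [add_mul] at this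
    omega
  · rw [Finset.card_image_of_injOn hinj]; simp
  · intro f
    rw [Finset.sum_image hinj, Finset.sum_product]

/-- The non-asymptotic Bernstein block estimate. -/
lemma MixProc.bernstein (M : MixProc P Z θ ε r C) {g : 𝒵 → ℝ} (hg : Measurable g) {b : ℝ}
    (hb : ∀ z, |g z| ≤ b) (h0 : ∫ z, g z ∂θ = 0) (n k p q : ℕ) (hp : 1 ≤ p)
    (hk : k * (p + q) ≤ n) (hn : 1 ≤ n) (hsm : p * b * (√n)⁻¹ ≤ 1) :
    ‖∫ ω, ee ((√n)⁻¹ * ∑ t ∈ Finset.range n, g (Z t ω)) ∂P -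
      (Real.exp (-(k * p / n * ((p : ℝ)⁻¹ * ∫ ω, (∑ t ∈ Finset.range p, g (Z t ω)) ^ 2 ∂P)) / 2) : ℂ)‖
      ≤ √(4 * cc C * Nq ε θ g ^ 2 * (1 - k * p / n)) + k * (8 * betaProc P Z (q + 1)) +
        (k * p / n * ((p : ℝ)⁻¹ * ∫ ω, (∑ t ∈ Finset.range p, g (Z t ω)) ^ 2 ∂P)) *
        (p * b * (√n)⁻¹ + p / n * ((p : ℝ)⁻¹ * ∫ ω, (∑ t ∈ Finset.range p, g (Z t ω)) ^ 2 ∂P)) := by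
  have hpr := M.prob
  have hn0 : (0 : ℝ) < n := by exact_mod_cast hn
  have hp0 : (0 : ℝ) < p := by exact_mod_cast hp
  set c : ℝ := (√n)⁻¹ with hc
  have hcp : 0 < c := by positivity
  have hc2 : c ^ 2 = (n : ℝ)⁻¹ := by rw [hc, inv_pow, Real.sq_sqrt hn0.le]
  have hgq : ∀ q, MemLp g q θ := fun q => MemLp.of_bound hg.aestronglyMeasurable b
    (Eventually.of_forall hb)
  have hgm := fun t => hg.comp (M.meas t)
  obtain ⟨A, hA, hAc, hAs⟩ := blk_cov k p q n hk
  -- step 1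
  have m1 : ∀ I : Finset ℕ, MemLp (fun ω => c * ∑ t ∈ I, g (Z t ω)) 2 P := fun I =>
    (memLp_finsetSum (f := fun t ω => g (Z t ω)) I fun t _ =>
      M.memLp_comp (hgq 2) t).const_mul c
  have s1 := ee_int_diff (m1 (Finset.range n)) (m1 A)
  have s1' : √(∫ ω, (c * ∑ t ∈ Finset.range n, g (Z t ω) - c * ∑ t ∈ A, g (Z t ω)) ^ 2 ∂P) ≤
      √(4 * cc C * Nq ε θ g ^ 2 * (1 - k * p / n)) := by
    apply Real.sqrt_le_sqrt
    have e : ∀ ω, (c * ∑ t ∈ Finset.range n, g (Z t ω) - c * ∑ t ∈ A, g (Z t ω)) ^ 2 =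
        c ^ 2 * ‖∑ t ∈ Finset.range n \ A, g (Z t ω)‖ ^ 2 := by
      intro ω
      rw [← Finset.sum_sdiff hA, Real.norm_eq_abs, sq_abs]; ring
    simp only [e]
    rw [integral_const_mul]
    have hl2 := M.L2_bound hg.stronglyMeasurable (hgq _) h0 (Finset.range n \ A)
    have hcard : ((Finset.range n \ A).card : ℝ) = n - k * p := by
      rw [Finset.cast_card_sdiff hA, hAc]; simp
    rw [hcard] at hl2
    calc _ ≤ c ^ 2 * (4 * cc C * Nq ε θ g ^ 2 * (n - k * p)) := by gcongr
      _ = _ := by rw [hc2]; field_simp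
  -- step 2
  have s2 := M.blocks hg c p q hp k
  have e2 : ∀ ω, ∑ j ∈ Finset.range k, c * blk g Z (j * (p + q)) p ω = c * ∑ t ∈ A, g (Z t ω) := by
    intro ω; rw [hAs (fun t => g (Z t ω)), Finset.mul_sum]; rfl
  simp only [e2] at s2
  -- step 3
  have e3 : ∀ ω, blk g Z 0 p ω = ∑ t ∈ Finset.range p, g (Z t ω) := by
    intro ω; simp [blk]
  simp only [e3] at s2
  set V : ℝ := ∫ ω, (∑ t ∈ Finset.range p, g (Z t ω)) ^ 2 ∂P with hV
  have hV0 : 0 ≤ V := integral_nonneg fun ω => by positivity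
  have s3 := ee_moment (P := P) (X := fun ω => c * ∑ t ∈ Finset.range p, g (Z t ω))
    (b := p * b * c) ((Finset.measurable_fun_sum _ fun t _ => hgm t).const_mul c) (by
      intro ω
      rw [abs_mul, abs_of_pos hcp, mul_comm]
      gcongr
      refine (Finset.abs_sum_le_sum_abs _ _).trans ?_
      refine (Finset.sum_le_sum fun t _ => hb _).trans ?_
      simp) hsm (by
      rw [integral_const_mul, integral_finsetSum _ fun t _ => (M.memLp_comp (hgq 1) t).integrable le_rfl]
      simp only [M.int_comp hg.aestronglyMeasurable, h0]; simp)
  simp only [mul_pow] at s3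
  rw [integral_const_mul, hc2, ← hV] at s3
  set D := ∫ ω, ee (c * ∑ t ∈ Finset.range p, g (Z t ω)) ∂P with hD
  have hD1 : ‖D‖ ≤ 1 := by
    refine (norm_integral_le_of_norm_le (integrable_const (1 : ℝ))
      (Eventually.of_forall fun ω => (norm_ee _).le)).trans (by simp)
  have s4 := pow_diff_le (b := (Real.exp (-((n : ℝ)⁻¹ * V) / 2) : ℂ)) hD1 (by
    rw [Complex.norm_real, Real.norm_eq_abs, Real.abs_exp]
    apply Real.exp_le_one_iff.2
    have : 0 ≤ (n : ℝ)⁻¹ * V := by positivity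
    linarith) k
  have e4 : (Real.exp (-((n : ℝ)⁻¹ * V) / 2) : ℂ) ^ k =
      (Real.exp (-(k * p / n * ((p : ℝ)⁻¹ * V)) / 2) : ℂ) := by
    rw [← Complex.ofReal_pow, ← Real.exp_nat_mul]
    congr 2
    field_simp
  rw [e4] at s4
  have s5 : (k : ℝ) * ‖D - (Real.exp (-((n : ℝ)⁻¹ * V) / 2) : ℂ)‖ ≤
      (k * p / n * ((p : ℝ)⁻¹ * V)) * (p * b * c + p / n * ((p : ℝ)⁻¹ * V)) := by
    calc _ ≤ (k : ℝ) * (p * b * c * ((n : ℝ)⁻¹ * V) + ((n : ℝ)⁻¹ * V) ^ 2) := by gcongr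
      _ = _ := by field_simp
  set a1 := ∫ ω, ee (c * ∑ t ∈ Finset.range n, g (Z t ω)) ∂P
  set a2 := ∫ ω, ee (c * ∑ t ∈ A, g (Z t ω)) ∂P
  set a4 := (Real.exp (-(k * p / n * ((p : ℝ)⁻¹ * V)) / 2) : ℂ)
  have : a1 - a4 = (a1 - a2) + (a2 - D ^ k) + (D ^ k - a4) := by ring
  rw [this]
  refine (norm_add₃_le).trans ?_
  exact add_le_add (add_le_add (s1.trans s1') s2) (s4.trans s5)

end

end

section

/-- block length -/
def bp (n : ℕ) : ℕ := rt8 n ^ 3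
/-- gap length -/
def bq (n : ℕ) : ℕ := rt8 n ^ 2
/-- number of blocks -/
def bk (n : ℕ) : ℕ := n / (bp n + bq n)

lemma bk_le (n : ℕ) : bk n * (bp n + bq n) ≤ n := Nat.div_mul_le_self _ _

lemma bp_tendsto : Tendsto bp atTop atTop :=
  (tendsto_pow_atTop (by norm_num : (3 : ℕ) ≠ 0)).comp rt8_tendsto

lemma rt8_inv_tendsto : Tendsto (fun n => ((rt8 n : ℝ))⁻¹) atTop (𝓝 0) :=
  tendsto_inv_atTop_zero.comp (tendsto_natCast_atTop_atTop.comp rt8_tendsto)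

lemma rt8_pos : ∀ᶠ n in atTop, 1 ≤ rt8 n := rt8_tendsto.eventually_ge_atTop 1

lemma bp_sqrt (n : ℕ) (h : 1 ≤ rt8 n) : (bp n : ℝ) * (√n)⁻¹ ≤ (rt8 n : ℝ)⁻¹ := by
  have hs : (0 : ℝ) < rt8 n := by exact_mod_cast h
  have h1 : (rt8 n : ℝ) ^ 4 ≤ √n := by
    apply Real.le_sqrt_of_sq_le
    have := rt8_le n
    have : ((rt8 n : ℝ)) ^ 8 ≤ n := by exact_mod_cast this
    calc ((rt8 n : ℝ) ^ 4) ^ 2 = (rt8 n : ℝ) ^ 8 := by ring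
      _ ≤ (n : ℝ) := this
  have h2 : (√n)⁻¹ ≤ ((rt8 n : ℝ) ^ 4)⁻¹ := inv_anti₀ (by positivity) h1
  calc (bp n : ℝ) * (√n)⁻¹ ≤ (rt8 n : ℝ) ^ 3 * ((rt8 n : ℝ) ^ 4)⁻¹ := by
        unfold bp; push_cast; gcongr
    _ = _ := by field_simp

lemma bkp_bounds (n : ℕ) (h : 1 ≤ rt8 n) :
    1 - 2 * (rt8 n : ℝ)⁻¹ ≤ bk n * bp n / n ∧ (bk n * bp n / n : ℝ) ≤ 1 := by
  have hs : (1 : ℝ) ≤ rt8 n := by exact_mod_cast h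
  have hs0 : (0 : ℝ) < rt8 n := by linarith
  have h8 : ((rt8 n : ℝ)) ^ 8 ≤ n := by exact_mod_cast rt8_le n
  have hn : (0 : ℝ) < n := lt_of_lt_of_le (by positivity) h8
  set s : ℝ := (rt8 n : ℝ) with hsdef
  have hL : (0 : ℝ) < s ^ 3 + s ^ 2 := by positivity
  have hLc : ((bp n + bq n : ℕ) : ℝ) = s ^ 3 + s ^ 2 := by simp [bp, bq, hsdef]
  have hpc : (bp n : ℝ) = s ^ 3 := by simp [bp, hsdef]
  constructor
  · have h1 : n < (bk n + 1) * (bp n + bq n) := by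
      have hpos : 0 < bp n + bq n := by
        have : (0 : ℝ) < ((bp n + bq n : ℕ) : ℝ) := by rw [hLc]; exact hL
        exact_mod_cast this
      have := Nat.lt_div_mul_add (a := n) hpos
      unfold bk
      rw [add_mul, one_mul]; exact this
    have h2 : (n : ℝ) ≤ (bk n + 1) * (s ^ 3 + s ^ 2) := by
      rw [← hLc]; exact_mod_cast h1.le
    have h3 : (n : ℝ) / (s ^ 3 + s ^ 2) - 1 ≤ bk n := by
      rw [sub_le_iff_le_add, div_le_iff₀ hL]; exact h2
    have h4 : s ^ 3 / (s ^ 3 + s ^ 2) - s ^ 3 / n ≤ bk n * bp n / n := by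
      rw [hpc]
      calc s ^ 3 / (s ^ 3 + s ^ 2) - s ^ 3 / n = ((n : ℝ) / (s ^ 3 + s ^ 2) - 1) * s ^ 3 / n := by
            field_simp
        _ ≤ _ := by gcongr
    refine le_trans ?_ h4
    have h5 : 1 - s⁻¹ ≤ s ^ 3 / (s ^ 3 + s ^ 2) := by
      rw [le_div_iff₀ hL]
      have : (1 - s⁻¹) * (s ^ 3 + s ^ 2) = s ^ 3 - s := by field_simp; ring
      rw [this]; linarith
    have h6 : s ^ 3 / n ≤ s⁻¹ := by
      rw [div_le_iff₀ hn]
      calc s ^ 3 ≤ s ^ 7 := pow_le_pow_right₀ hs (by norm_num)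
        _ = s⁻¹ * s ^ 8 := by field_simp
        _ ≤ s⁻¹ * n := by gcongr
    linarith
  · rw [div_le_one hn]
    have : bk n * bp n ≤ n := (Nat.mul_le_mul_left _ (Nat.le_add_right _ _)).trans (bk_le n)
    exact_mod_cast this

lemma bkp_tendsto : Tendsto (fun n : ℕ => (bk n * bp n / n : ℝ)) atTop (𝓝 1) := by
  refine tendsto_of_tendsto_of_tendsto_of_le_of_le' (g := fun n => 1 - 2 * (rt8 n : ℝ)⁻¹)
    (h := fun _ => (1 : ℝ)) ?_ tendsto_const_nhds ?_ ?_
  · simpa using (rt8_inv_tendsto.const_mul 2).const_sub 1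
  · filter_upwards [rt8_pos] with n hn using (bkp_bounds n hn).1
  · filter_upwards [rt8_pos] with n hn using (bkp_bounds n hn).2

section
variable {Ω 𝒵 : Type*} [MeasurableSpace Ω] [MeasurableSpace 𝒵] {P : Measure Ω}
    [IsProbabilityMeasure P]
    {Z : ℕ → Ω → 𝒵} {θ : Measure 𝒵} {ε r C : ℝ}

lemma MixProc.bkbeta (M : MixProc P Z θ ε r C) (n : ℕ) (h : 1 ≤ rt8 n) :
    (bk n : ℝ) * (8 * betaProc P Z (bq n + 1)) ≤ 2048 * C * (rt8 n : ℝ)⁻¹ := by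
  have hs : (1 : ℝ) ≤ rt8 n := by exact_mod_cast h
  have hs0 : (0 : ℝ) < rt8 n := by linarith
  have h8 : (n : ℝ) ≤ (rt8 n + 1 : ℝ) ^ 8 := by exact_mod_cast (lt_rt8 n).le
  have hC := M.C0
  have hβ := M.mix (bq n + 1) (by omega)
  set s : ℝ := (rt8 n : ℝ) with hsdef
  have hb2 : C * ((bq n + 1 : ℕ) : ℝ) ^ (-r) ≤ C * (s ^ 12)⁻¹ := by
    gcongr
    have h6 : 6 ≤ r := by have := M.hr; have := M.eps; have : 0 < 2 / ε := by positivity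
                          linarith
    have e : (s ^ 12)⁻¹ = (s ^ 2) ^ (-((6 : ℕ) : ℝ)) := by
      rw [Real.rpow_neg (by positivity), Real.rpow_natCast]; ring
    rw [e]
    have hle : s ^ 2 ≤ ((bq n + 1 : ℕ) : ℝ) := by simp [bq, hsdef]
    calc ((bq n + 1 : ℕ) : ℝ) ^ (-r) ≤ (s ^ 2) ^ (-r) :=
          Real.rpow_le_rpow_of_nonpos (by positivity) hle (by linarith)
      _ ≤ _ := Real.rpow_le_rpow_of_exponent_le (one_le_pow₀ hs) (by push_cast; linarith)
  have hk : (bk n : ℝ) ≤ 256 * s ^ 5 := by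
    have h1 : (bk n : ℝ) * s ^ 3 ≤ n := by
      have : bk n * bp n ≤ n := (Nat.mul_le_mul_left _ (Nat.le_add_right _ _)).trans (bk_le n)
      have : ((bk n * bp n : ℕ) : ℝ) ≤ n := by exact_mod_cast this
      simpa [bp, hsdef] using this
    have h2 : (s + 1) ^ 8 ≤ (2 * s) ^ 8 := by gcongr; linarith
    have h3 : (bk n : ℝ) * s ^ 3 ≤ (256 * s ^ 5) * s ^ 3 := by
      calc _ ≤ (2 * s) ^ 8 := h1.trans (h8.trans h2)
        _ = _ := by ring
    exact le_of_mul_le_mul_right h3 (by positivity)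
  calc (bk n : ℝ) * (8 * betaProc P Z (bq n + 1)) ≤ (bk n : ℝ) * (8 * (C * (s ^ 12)⁻¹)) := by
        gcongr; exact hβ.trans hb2
    _ ≤ (256 * s ^ 5) * (8 * (C * (s ^ 12)⁻¹)) := by gcongr
    _ = 2048 * C * (s⁻¹) * (s ^ 6)⁻¹ := by field_simp; ring
    _ ≤ 2048 * C * s⁻¹ * 1 := by
        gcongr
        exact inv_le_one_of_one_le₀ (one_le_pow₀ hs)
    _ = _ := by ring

/-- CLT for bounded centred functions. -/
theorem MixProc.clt_bounded (M : MixProc P Z θ ε r C) {g : 𝒵 → ℝ} (hg : Measurable g) {b : ℝ}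
    (hb : ∀ z, |g z| ≤ b) (h0 : ∫ z, g z ∂θ = 0) {σ : ℝ}
    (hσ : Tendsto (fun n : ℕ => (n : ℝ)⁻¹ * ∫ ω, (∑ t ∈ Finset.range n, g (Z t ω)) ^ 2 ∂P)
      atTop (𝓝 σ)) :
    Tendsto (fun n : ℕ => ∫ ω, ee ((√n)⁻¹ * ∑ t ∈ Finset.range n, g (Z t ω)) ∂P) atTop
      (𝓝 (Real.exp (-σ / 2) : ℂ)) := by
  have hb0 : 0 ≤ b := by
    obtain ⟨ω⟩ : Nonempty Ω := nonempty_of_isProbabilityMeasure P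
    exact (abs_nonneg _).trans (hb (Z 0 ω))
  let v : ℕ → ℝ := fun n => (n : ℝ)⁻¹ * ∫ ω, (∑ t ∈ Finset.range n, g (Z t ω)) ^ 2 ∂P
  have hv : Tendsto (fun n => v (bp n)) atTop (𝓝 σ) := hσ.comp bp_tendsto
  have hkv : Tendsto (fun n : ℕ => (bk n * bp n / n : ℝ) * v (bp n)) atTop (𝓝 σ) := by
    simpa using bkp_tendsto.mul hv
  have hlim : Tendsto (fun n : ℕ => (Real.exp (-((bk n * bp n / n : ℝ) * v (bp n)) / 2) : ℂ)) atTop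
      (𝓝 (Real.exp (-σ / 2) : ℂ)) := by
    have hcont : Continuous (fun x : ℝ => (Real.exp (-x / 2) : ℂ)) := by fun_prop
    exact (hcont.tendsto σ).comp hkv
  have hps : Tendsto (fun n : ℕ => (bp n : ℝ) * (√n)⁻¹) atTop (𝓝 0) := by
    refine squeeze_zero' (Eventually.of_forall fun n => by positivity) ?_ rt8_inv_tendsto
    filter_upwards [rt8_pos] with n hn using bp_sqrt n hn
  have hps' : Tendsto (fun n : ℕ => (bp n : ℝ) * b * (√n)⁻¹) atTop (𝓝 0) := by
    have := hps.mul_const b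
    simp only [zero_mul] at this
    exact this.congr fun n => by ring
  have hpn : Tendsto (fun n : ℕ => (bp n : ℝ) / n) atTop (𝓝 0) := by
    refine squeeze_zero' (Eventually.of_forall fun n => by positivity) ?_ hps
    filter_upwards [eventually_ge_atTop 1] with n hn
    have hn1 : (1 : ℝ) ≤ n := by exact_mod_cast hn
    rw [div_eq_mul_inv]
    gcongr
    rw [Real.sqrt_le_left (by positivity)]
    nlinarith
  have herr : Tendsto (fun n : ℕ => √(4 * cc C * Nq ε θ g ^ 2 * (1 - bk n * bp n / n)) +
      bk n * (8 * betaProc P Z (bq n + 1)) +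
        ((bk n * bp n / n : ℝ) * v (bp n)) * (bp n * b * (√n)⁻¹ + bp n / n * v (bp n)))
      atTop (𝓝 0) := by
    have t1 : Tendsto (fun n : ℕ => √(4 * cc C * Nq ε θ g ^ 2 * (1 - bk n * bp n / n))) atTop (𝓝 0) := by
      have := ((bkp_tendsto.const_sub 1).const_mul (4 * cc C * Nq ε θ g ^ 2)).sqrt
      simpa using this
    have t2 : Tendsto (fun n : ℕ => (bk n : ℝ) * (8 * betaProc P Z (bq n + 1))) atTop (𝓝 0) := by
      have hub : Tendsto (fun n => 2048 * C * (rt8 n : ℝ)⁻¹) atTop (𝓝 0) := by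
        simpa using rt8_inv_tendsto.const_mul (2048 * C)
      refine squeeze_zero' (Eventually.of_forall fun n => ?_) ?_ hub
      · have := ee_beta (P := P) (Z := Z) M.meas 0 (bq n + 1) (U := fun _ => 0) (V := fun _ => 0)
            (@measurable_const _ _ _ (_) _) (@measurable_const _ _ _ (_) _)
        have := (norm_nonneg _).trans this
        positivity
      · filter_upwards [rt8_pos] with n hn using M.bkbeta n hn
    have t3 := hkv.mul (hps'.add (hpn.mul hv))
    simpa using (t1.add t2).add t3
  rw [tendsto_iff_norm_sub_tendsto_zero] at hlim ⊢
  refine squeeze_zero' (Eventually.of_forall fun n => norm_nonneg _) ?_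
    (by have := herr.add hlim; rwa [add_zero] at this)
  filter_upwards [rt8_pos, eventually_ge_atTop 1, hps'.eventually_le_const zero_lt_one]
    with n h1 h2 h3
  have hB := M.bernstein hg hb h0 n (bk n) (bp n) (bq n) (Nat.one_le_pow _ _ h1) (bk_le n) h2 h3
  refine (norm_sub_le_norm_sub_add_norm_sub _
    (Real.exp (-((bk n * bp n / n : ℝ) * v (bp n)) / 2) : ℂ) _).trans ?_
  exact add_le_add_left hB _

end

end

section

section
variable {Ω 𝒵 : Type*} [MeasurableSpace Ω] [MeasurableSpace 𝒵] {P : Measure Ω}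
    [IsProbabilityMeasure P]
    {Z : ℕ → Ω → 𝒵} {θ : Measure 𝒵} {ε r C : ℝ}

lemma l2_eq {X : Ω → ℝ} (hX : MemLp X 2 P) :
    √(∫ ω, X ω ^ 2 ∂P) = (eLpNorm X 2 P).toReal := by
  rw [hX.eLpNorm_eq_integral_rpow_norm (by norm_num) (by norm_num),
    ENNReal.toReal_ofReal (by positivity)]
  simp [Real.sqrt_eq_rpow]

lemma l2_tri {X Y : Ω → ℝ} (hX : MemLp X 2 P) (hY : MemLp Y 2 P) :
    |√(∫ ω, X ω ^ 2 ∂P) - √(∫ ω, Y ω ^ 2 ∂P)| ≤ √(∫ ω, (X ω - Y ω) ^ 2 ∂P) := by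
  have hD := hX.sub hY
  have hD' := hY.sub hX
  have h1 := l2_eq hD
  have h2 := l2_eq hD'
  simp only [Pi.sub_apply] at h1 h2
  rw [l2_eq hX, l2_eq hY, h1]
  have e : (eLpNorm (Y - X) 2 P) = eLpNorm (X - Y) 2 P := eLpNorm_sub_comm _ _ _ _
  have t1 : eLpNorm X 2 P ≤ eLpNorm (X - Y) 2 P + eLpNorm Y 2 P := by
    have := eLpNorm_add_le hD.1 hY.1 (p := 2) (by norm_num)
    simpa using this
  have t2 : eLpNorm Y 2 P ≤ eLpNorm (X - Y) 2 P + eLpNorm X 2 P := by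
    have := eLpNorm_add_le hD'.1 hX.1 (p := 2) (by norm_num)
    rw [e] at this
    simpa using this
  have f1 := ENNReal.toReal_mono (ENNReal.add_ne_top.2 ⟨hD.2.ne, hY.2.ne⟩) t1
  have f2 := ENNReal.toReal_mono (ENNReal.add_ne_top.2 ⟨hD.2.ne, hX.2.ne⟩) t2
  rw [ENNReal.toReal_add hD.2.ne hY.2.ne] at f1
  rw [ENNReal.toReal_add hD.2.ne hX.2.ne] at f2
  rw [abs_le]; constructor <;> linarith

lemma trunc_exists (hε : 0 < ε) [IsProbabilityMeasure θ] {g : 𝒵 → ℝ} (hg : Measurable g)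
    (hq : MemLp g (qe ε) θ) (h0 : ∫ z, g z ∂θ = 0) {δ : ℝ} (hδ : 0 < δ) :
    ∃ (g' : 𝒵 → ℝ) (b : ℝ), Measurable g' ∧ (∀ z, |g' z| ≤ b) ∧ ∫ z, g' z ∂θ = 0 ∧
      Nq ε θ (fun z => g z - g' z) ≤ δ := by
  obtain ⟨K, hK⟩ := hq.eLpNorm_indicator_norm_ge_le hg.stronglyMeasurable (half_pos hδ)
  set S : Set 𝒵 := {x | K ≤ (‖g x‖₊ : ℝ)} with hS
  have hSm : MeasurableSet S := measurableSet_le measurable_const hg.norm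
  let w : 𝒵 → ℝ := S.indicator g
  let t : 𝒵 → ℝ := Sᶜ.indicator g
  have hwm : Measurable w := hg.indicator hSm
  have htm : Measurable t := hg.indicator hSm.compl
  have htb : ∀ z, |t z| ≤ |K| := by
    intro z
    by_cases hz : z ∈ S
    · have : t z = 0 := Set.indicator_of_notMem (by simpa using hz) _
      rw [this]; simp
    · have : t z = g z := Set.indicator_of_mem (by simpa using hz) _
      rw [this]
      have : ‖g z‖ < K := not_le.1 hz
      exact this.le.trans (le_abs_self K)
  have hwq : MemLp w (qe ε) θ := hq.indicator hSm
  have ht1 : Integrable t θ := Integrable.of_bound htm.aestronglyMeasurable _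
    (Eventually.of_forall htb)
  have hw1 : Integrable w θ := hwq.integrable (qe_ge_one hε)
  have hsum : ∀ z, g z = w z + t z := fun z => (Set.indicator_self_add_compl_apply S g z).symm
  have hInte : ∫ z, t z ∂θ = - ∫ z, w z ∂θ := by
    have : ∫ z, g z ∂θ = ∫ z, w z ∂θ + ∫ z, t z ∂θ := by
      rw [← integral_add hw1 ht1]; exact integral_congr_ae (Eventually.of_forall hsum)
    linarith
  refine ⟨fun z => t z - ∫ z, t z ∂θ, |K| + |∫ z, t z ∂θ|, htm.sub_const _, fun z => ?_, ?_, ?_⟩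
  · exact (abs_sub _ _).trans (add_le_add_left (htb z) _)
  · rw [integral_sub ht1 (integrable_const _)]; simp
  · have e : (fun z => g z - (t z - ∫ z, t z ∂θ)) = w + fun _ => (- ∫ z, w z ∂θ) := by
      funext z; simp only [Pi.add_apply]; rw [hsum z, hInte]; ring
    rw [e]
    have hwN : (eLpNorm w (qe ε) θ).toReal ≤ δ / 2 :=
      ENNReal.toReal_le_of_le_ofReal (by positivity) hK
    have hc : (eLpNorm (fun _ : 𝒵 => (- ∫ z, w z ∂θ)) (qe ε) θ).toReal ≤ δ / 2 := by
      rw [eLpNorm_const _ (qe_ne_zero hε) (NeZero.ne _)]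
      simp only [measure_univ, ENNReal.one_rpow, mul_one, toReal_enorm, norm_neg]
      refine (norm_integral_le_integral_norm _).trans ?_
      rw [integral_norm_eq_lintegral_enorm hw1.1, ← eLpNorm_one_eq_lintegral_enorm]
      refine le_trans (ENNReal.toReal_mono hwq.2.ne ?_) hwN
      exact eLpNorm_le_eLpNorm_of_exponent_le (qe_ge_one hε) hwm.aestronglyMeasurable
    have hcm : MemLp (fun _ : 𝒵 => (- ∫ z, w z ∂θ)) (qe ε) θ := memLp_const _
    have htri := eLpNorm_add_le hwq.1 hcm.1 (qe_ge_one hε)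
    have := ENNReal.toReal_mono (ENNReal.add_ne_top.2 ⟨hwq.2.ne, hcm.2.ne⟩) htri
    rw [ENNReal.toReal_add hwq.2.ne hcm.2.ne] at this
    unfold Nq
    linarith

lemma MixProc.sum_memLp (M : MixProc P Z θ ε r C) {g : 𝒵 → ℝ} (hq : MemLp g 2 θ) (n : ℕ) (c : ℝ) :
    MemLp (fun ω => c * ∑ t ∈ Finset.range n, g (Z t ω)) 2 P :=
  (memLp_finsetSum (f := fun t ω => g (Z t ω)) _ fun t _ => M.memLp_comp hq t).const_mul c

lemma MixProc.sum_l2 (M : MixProc P Z θ ε r C) {g g' : 𝒵 → ℝ} (hg : Measurable g)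
    (hg' : Measurable g') (hq : MemLp g (qe ε) θ) (hq' : MemLp g' (qe ε) θ)
    (h0 : ∫ z, g z ∂θ = 0) (h0' : ∫ z, g' z ∂θ = 0) (n : ℕ) :
    √(∫ ω, ((√n)⁻¹ * ∑ t ∈ Finset.range n, g (Z t ω) -
      (√n)⁻¹ * ∑ t ∈ Finset.range n, g' (Z t ω)) ^ 2 ∂P) ≤
      √(4 * cc C) * Nq ε θ (fun z => g z - g' z) := by
  have := M.prob
  have hC := M.C0
  have hcc : 0 ≤ cc C := by unfold cc; positivity
  have hi := hq.integrable (qe_ge_one M.eps)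
  have hi' := hq'.integrable (qe_ge_one M.eps)
  rw [← Real.sqrt_sq (Nq_nonneg (ε := ε) (θ := θ) (fun z => g z - g' z)),
    ← Real.sqrt_mul (by positivity)]
  apply Real.sqrt_le_sqrt
  have e : ∀ ω, ((√n)⁻¹ * ∑ t ∈ Finset.range n, g (Z t ω) -
      (√n)⁻¹ * ∑ t ∈ Finset.range n, g' (Z t ω)) ^ 2 =
      (n : ℝ)⁻¹ * ‖∑ t ∈ Finset.range n, (g (Z t ω) - g' (Z t ω))‖ ^ 2 := by
    intro ω
    rw [← mul_sub, ← Finset.sum_sub_distrib, mul_pow, inv_pow, Real.sq_sqrt (by positivity),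
      Real.norm_eq_abs, sq_abs]
  simp only [e]
  rw [integral_const_mul]
  have h1 := M.L2_bound (ξ := fun z => g z - g' z) (hg.sub hg').stronglyMeasurable (hq.sub hq')
    (by rw [integral_sub hi hi', h0, h0', sub_zero]) (Finset.range n)
  rw [Finset.card_range] at h1
  rcases Nat.eq_zero_or_pos n with rfl | hn
  · simp; positivity
  · have hn' : (0 : ℝ) < n := by exact_mod_cast hn
    calc _ ≤ (n : ℝ)⁻¹ * (4 * cc C * Nq ε θ (fun z => g z - g' z) ^ 2 * n) := by gcongr
      _ = _ := by field_simp

/-- existence of long-run variance, in the quadratic form -/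
lemma MixProc.var_eq (M : MixProc P Z θ ε r C) {g₁ g₂ : 𝒵 → ℝ} (hq : MemLp g₁ 2 θ)
    (hq' : MemLp g₂ 2 θ) (n : ℕ) :
    ∫ ω, (∑ t ∈ Finset.range n, g₁ (Z t ω)) * (∑ t ∈ Finset.range n, g₂ (Z t ω)) ∂P =
    ∑ t ∈ Finset.range n, ∑ u ∈ Finset.range n, ∫ ω, g₁ (Z t ω) * g₂ (Z u ω) ∂P := by
  simp only [Finset.sum_mul_sum]
  rw [integral_finsetSum]
  · refine Finset.sum_congr rfl fun t _ => ?_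
    rw [integral_finsetSum]
    exact fun u _ => (M.memLp_comp hq t).integrable_mul (M.memLp_comp hq' u)
  · exact fun t _ => integrable_finsetSum _ fun u _ =>
      (M.memLp_comp hq t).integrable_mul (M.memLp_comp hq' u)

/-- CLT for centred functions with `2+2ε` moments. -/
theorem MixProc.clt (M : MixProc P Z θ ε r C) {g : 𝒵 → ℝ} (hg : Measurable g)
    (hq : MemLp g (qe ε) θ) (h0 : ∫ z, g z ∂θ = 0) {σ : ℝ}
    (hσ : Tendsto (fun n : ℕ => (n : ℝ)⁻¹ * ∫ ω, (∑ t ∈ Finset.range n, g (Z t ω)) ^ 2 ∂P)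
      atTop (𝓝 σ)) :
    Tendsto (fun n : ℕ => ∫ ω, ee ((√n)⁻¹ * ∑ t ∈ Finset.range n, g (Z t ω)) ∂P) atTop
      (𝓝 (Real.exp (-σ / 2) : ℂ)) := by
  have := M.prob
  have hε := M.eps
  have hscale : ∀ (f : 𝒵 → ℝ) (n : ℕ), ∫ ω, ((√n)⁻¹ * ∑ t ∈ Finset.range n, f (Z t ω)) ^ 2 ∂P =
      (n : ℝ)⁻¹ * ∫ ω, (∑ t ∈ Finset.range n, f (Z t ω)) ^ 2 ∂P := by
    intro f n
    simp only [mul_pow]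
    rw [integral_const_mul, inv_pow, Real.sq_sqrt (by positivity)]
  have hσ0 : 0 ≤ σ := ge_of_tendsto' hσ fun n =>
    mul_nonneg (by positivity) (integral_nonneg fun ω => by positivity)
  set K := √(4 * cc C) with hKdef
  have hK0 : 0 ≤ K := Real.sqrt_nonneg _
  rw [Metric.tendsto_atTop]
  intro δ hδ
  -- continuity of x ↦ exp(-x²/2)
  have hcont : Continuous (fun x : ℝ => (Real.exp (-x ^ 2 / 2) : ℂ)) := by fun_prop
  obtain ⟨η, hη, hηc⟩ := Metric.continuousAt_iff.1 (hcont.continuousAt (x := √σ)) (δ / 3)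
    (by positivity)
  obtain ⟨g', b, hg', hb, h0', hN⟩ := trunc_exists hε hg hq h0
    (δ := min (δ / 3) (η / 2) / (K + 1)) (by positivity)
  have hKN : K * Nq ε θ (fun z => g z - g' z) ≤ min (δ / 3) (η / 2) := by
    calc K * Nq ε θ (fun z => g z - g' z) ≤ (K + 1) * (min (δ / 3) (η / 2) / (K + 1)) := by
          gcongr
          · exact Nq_nonneg _
          · linarith
      _ = _ := by field_simp
  have hq' : MemLp g' (qe ε) θ := MemLp.of_bound hg'.aestronglyMeasurable b (Eventually.of_forall hb)
  obtain ⟨σ', hσ'⟩ := M.cov_limit hg' hg' hq' hq' h0'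
  have h2 : MemLp g 2 θ := hq.mono_exponent (qe_ge_two hε)
  have h2' : MemLp g' 2 θ := hq'.mono_exponent (qe_ge_two hε)
  have hσ'' : Tendsto (fun n : ℕ => (n : ℝ)⁻¹ * ∫ ω, (∑ t ∈ Finset.range n, g' (Z t ω)) ^ 2 ∂P)
      atTop (𝓝 σ') := by
    refine hσ'.congr fun n => ?_
    rw [← M.var_eq h2' h2']; simp only [sq]
  have hσ'0 : 0 ≤ σ' := ge_of_tendsto' hσ'' fun n =>
    mul_nonneg (by positivity) (integral_nonneg fun ω => by positivity)
  have hsq : |√σ - √σ'| ≤ η / 2 := by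
    refine le_of_tendsto' ((hσ.sqrt.sub hσ''.sqrt).abs) fun n => ?_
    rw [← hscale, ← hscale]
    exact (l2_tri (M.sum_memLp h2 n _) (M.sum_memLp h2' n _)).trans
      ((M.sum_l2 hg hg' hq hq' h0 h0' n).trans (hKN.trans (min_le_right _ _)))
  have hexp := hηc (x := √σ') (by rw [Real.dist_eq, abs_sub_comm]; linarith)
  rw [Real.sq_sqrt hσ0, Real.sq_sqrt hσ'0] at hexp
  obtain ⟨N, hNn⟩ := Metric.tendsto_atTop.1 (M.clt_bounded hg' hb h0' hσ'') (δ / 3) (by positivity)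
  refine ⟨N, fun n hn => ?_⟩
  have d1 := hNn n hn
  have d2 : dist (∫ ω, ee ((√n)⁻¹ * ∑ t ∈ Finset.range n, g (Z t ω)) ∂P)
      (∫ ω, ee ((√n)⁻¹ * ∑ t ∈ Finset.range n, g' (Z t ω)) ∂P) ≤ δ / 3 := by
    rw [dist_eq_norm]
    exact (ee_int_diff (M.sum_memLp h2 n _) (M.sum_memLp h2' n _)).trans
      ((M.sum_l2 hg hg' hq hq' h0 h0' n).trans (hKN.trans (min_le_left _ _)))
  have t1 := dist_triangle4 (∫ ω, ee ((√n)⁻¹ * ∑ t ∈ Finset.range n, g (Z t ω)) ∂P)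
    (∫ ω, ee ((√n)⁻¹ * ∑ t ∈ Finset.range n, g' (Z t ω)) ∂P)
    ((Real.exp (-σ' / 2) : ℂ)) ((Real.exp (-σ / 2) : ℂ))
  linarith

end

end

section

section

/-- The standard Gaussian product measure on sequences. -/
def gam : Measure (ℕ → ℝ) := Measure.infinitePi (fun _ : ℕ => gaussianReal 0 1)

instance : IsProbabilityMeasure gam := by unfold gam; infer_instance

/-- Linear statistic of the coordinates. -/
def lin (N : ℕ) (a : ℕ → ℝ) (η : ℕ → ℝ) : ℝ := ∑ j ∈ Finset.range N, a j * η j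

lemma lin_meas (N : ℕ) (a : ℕ → ℝ) : Measurable (lin N a) := by
  unfold lin; fun_prop

lemma lin_law (N : ℕ) (a : ℕ → ℝ) :
    gam.map (lin N a) = gaussianReal 0 (∑ j ∈ Finset.range N, Real.toNNReal (a j ^ 2)) := by
  induction N with
  | zero =>
    have : lin 0 a = fun _ => 0 := by funext η; simp [lin]
    rw [this, Measure.map_const]; simp
  | succ n ih =>
    have e : lin (n+1) a = lin n a + fun η => a n * η n := by
      funext η; simp [lin, Finset.sum_range_succ]
    have hind : iIndepFun (fun i (η : ℕ → ℝ) => a i * η i) gam :=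
      iIndepFun_infinitePi (X := fun i x => a i * x) (fun i => by fun_prop)
    have hi : IndepFun (lin n a) (fun η : ℕ → ℝ => a n * η n) gam := by
      have := hind.indepFun_finsetSum_of_notMem (s := Finset.range n) (i := n)
        (fun i => by fun_prop) (by simp)
      convert this using 1
      funext η; simp [lin]
    have hl : gam.map (fun η : ℕ → ℝ => a n * η n) =
        gaussianReal 0 (Real.toNNReal (a n ^ 2)) := by
      have h1 : gam.map (fun η : ℕ → ℝ => η n) = gaussianReal 0 1 :=
        Measure.infinitePi_map_eval _ n
      have := gaussianReal_map_const_mul (μ := 0) (v := 1) (a n)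
      rw [← h1, Measure.map_map (by fun_prop) (by fun_prop)] at this
      simp only [mul_zero, mul_one] at this
      rw [Function.comp_def] at this
      rw [this]
      congr 1
      exact (Real.toNNReal_of_nonneg (sq_nonneg _)).symm
    rw [e, gaussianReal_add_gaussianReal_of_indepFun hi ih hl, Finset.sum_range_succ]
    simp

lemma lin_memLp (N : ℕ) (a : ℕ → ℝ) : MemLp (lin N a) 2 gam := by
  have h : MemLp id 2 (gam.map (lin N a)) := by
    rw [lin_law]; exact memLp_id_gaussianReal' 2 (by simp)
  exact (memLp_map_measure_iff (by fun_prop) (lin_meas N a).aemeasurable).1 h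

lemma lin_mean (N : ℕ) (a : ℕ → ℝ) : ∫ η, lin N a η ∂gam = 0 := by
  have := integral_map (μ := gam) (lin_meas N a).aemeasurable (f := id) (by fun_prop)
  simp only [id] at this
  rw [← this, lin_law, integral_id_gaussianReal]

lemma lin_sq (N : ℕ) (a : ℕ → ℝ) : ∫ η, lin N a η ^ 2 ∂gam = ∑ j ∈ Finset.range N, a j ^ 2 := by
  have h1 := integral_map (μ := gam) (lin_meas N a).aemeasurable (f := fun x : ℝ => x ^ 2)
    (by fun_prop)
  rw [← h1, lin_law]
  have h2 := variance_fun_id_gaussianReal (μ := 0)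
    (v := ∑ j ∈ Finset.range N, Real.toNNReal (a j ^ 2))
  rw [variance_of_integral_eq_zero (by fun_prop) (by simp)] at h2
  rw [h2, NNReal.coe_sum]
  exact Finset.sum_congr rfl fun j _ => Real.coe_toNNReal _ (sq_nonneg _)

lemma lin_mul (N : ℕ) (a b : ℕ → ℝ) :
    ∫ η, lin N a η * lin N b η ∂gam = ∑ j ∈ Finset.range N, a j * b j := by
  have e : ∀ η, lin N a η * lin N b η =
      4⁻¹ * (lin N (fun j => a j + b j) η ^ 2 - lin N (fun j => a j - b j) η ^ 2) := by
    intro η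
    have h1 : lin N (fun j => a j + b j) η = lin N a η + lin N b η := by
      simp [lin, add_mul, Finset.sum_add_distrib]
    have h2 : lin N (fun j => a j - b j) η = lin N a η - lin N b η := by
      simp [lin, sub_mul, Finset.sum_sub_distrib]
    rw [h1, h2]; ring
  simp only [e]
  rw [integral_const_mul, integral_sub (lin_memLp _ _).integrable_sq (lin_memLp _ _).integrable_sq,
    lin_sq, lin_sq, ← Finset.sum_sub_distrib, Finset.mul_sum]
  exact Finset.sum_congr rfl fun j _ => by ring

lemma lin_char (N : ℕ) (a : ℕ → ℝ) :
    ∫ η, ee (lin N a η) ∂gam = (Real.exp (-(∑ j ∈ Finset.range N, a j ^ 2) / 2) : ℂ) := by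
  have h1 := integral_map (μ := gam) (lin_meas N a).aemeasurable (f := ee)
    continuous_ee.aestronglyMeasurable
  rw [← h1, lin_law]
  have h2 := charFun_gaussianReal (μ := 0)
    (v := ∑ j ∈ Finset.range N, Real.toNNReal (a j ^ 2)) 1
  rw [charFun_apply_real] at h2
  have : ∀ x : ℝ, ee x = Complex.exp ((1:ℝ) * x * Complex.I) := by
    intro x; unfold ee; congr 1; push_cast; ring
  simp only [this, h2]
  have h3 : ((∑ j ∈ Finset.range N, Real.toNNReal (a j ^ 2) : ℝ≥0) : ℝ) =
      ∑ j ∈ Finset.range N, a j ^ 2 := by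
    rw [NNReal.coe_sum]
    exact Finset.sum_congr rfl fun j _ => Real.coe_toNNReal _ (sq_nonneg _)
  rw [← h3]
  push_cast
  congr 1
  ring

/-- Gram vectors. -/
lemma gram_exists (Γ : ℕ → ℕ → ℝ) (hs : ∀ i j, Γ i j = Γ j i)
    (hp : ∀ (s : Finset ℕ) (c : ℕ → ℝ), 0 ≤ ∑ i ∈ s, ∑ j ∈ s, c i * c j * Γ i j) :
    ∃ (L : ℕ → ℕ → ℝ), (∀ i j, i < j → L i j = 0) ∧
      ∀ i j N, i < N → ∑ k ∈ Finset.range N, L i k * L j k = Γ i j := by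
  let K : Matrix ℕ ℕ (ℝ →L[ℝ] ℝ) := Matrix.of fun i j => Γ i j • ContinuousLinearMap.id ℝ ℝ
  have hK : K.PosSemidef := by
    refine ((RKHS.posSemidef_tfae (K := K)).out 0 2 rfl rfl).2 (And.intro ?_ fun vv => ?_)
    · ext i j
      have h1 : star (ContinuousLinearMap.id ℝ ℝ) = ContinuousLinearMap.id ℝ ℝ :=
        star_one (ℝ →L[ℝ] ℝ)
      simp [K, Matrix.conjTranspose_apply, hs i j, h1]
    · have := hp vv.support vv
      simp only [Finsupp.sum, K, Matrix.of_apply]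
      simp
      refine this.trans_eq ?_
      refine Finset.sum_congr rfl fun i _ => Finset.sum_congr rfl fun j _ => ?_
      rw [hs i j]; ring
  have : Fact K.PosSemidef := ⟨hK⟩
  let v : ℕ → RKHS.OfKernel K := fun i => RKHS.kerFun (RKHS.OfKernel K) i (1:ℝ)
  have hv : ∀ i j, inner ℝ (v i) (v j) = Γ i j := by
    intro i j
    have := RKHS.kernel_inner (H := RKHS.OfKernel K) (𝕜 := ℝ) j i (1:ℝ) (1:ℝ)
    rw [RKHS.OfKernel.kernel_ofKernel] at this
    rw [← this, hs]
    simp [K, -RKHS.kernel_inner]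
  let b := InnerProductSpace.gramSchmidtNormed ℝ v
  have hbb : ∀ k m, k ≠ m → inner ℝ (b k) (b m) = 0 := by
    intro k m hkm
    simp only [b, InnerProductSpace.gramSchmidtNormed, inner_smul_left, inner_smul_right]
    rw [InnerProductSpace.gramSchmidt_orthogonal ℝ v hkm]; simp
  have hb1 : ∀ m, (inner ℝ (b m) (b m)) • b m = b m := by
    intro m
    by_cases h : b m = 0
    · rw [h]; simp
    · rw [real_inner_self_eq_norm_sq, InnerProductSpace.gramSchmidtNormed_unit_length' h]; simp
  have hexp : ∀ i N, i < N → ∑ k ∈ Finset.range N, (inner ℝ (b k) (v i)) • b k = v i := by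
    intro i N hiN
    have hmem : v i ∈ Submodule.span ℝ (b '' Set.Iic i) := by
      rw [InnerProductSpace.span_gramSchmidtNormed]
      exact InnerProductSpace.mem_span_gramSchmidt ℝ v le_rfl
    refine Submodule.span_induction (p := fun w _ =>
      ∑ k ∈ Finset.range N, (inner ℝ (b k) w) • b k = w) ?_ ?_ ?_ ?_ hmem
    · rintro _ ⟨m, hm, rfl⟩
      rw [Finset.sum_eq_single m]
      · exact hb1 m
      · intro k _ hk; rw [hbb k m hk, zero_smul]
      · intro h; exact absurd (Finset.mem_range.2 (lt_of_le_of_lt hm hiN)) h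
    · simp
    · intro x y _ _ hx hy
      simp only [inner_add_right, add_smul, Finset.sum_add_distrib, hx, hy]
    · intro c x _ hx
      simp only [inner_smul_right, mul_smul, ← Finset.smul_sum, hx]
  refine ⟨fun i k => inner ℝ (b k) (v i), fun i j hij => ?_, fun i j N hi => ?_⟩
  · simp only [b, InnerProductSpace.gramSchmidtNormed, inner_smul_left]
    rw [InnerProductSpace.gramSchmidt_inv_triangular ℝ v hij]; simp
  · rw [← hv i j]
    conv_rhs => rw [← hexp i N hi]
    rw [sum_inner]
    simp only [inner_smul_left]; rfl

theorem gauss_exists (Γ : ℕ → ℕ → ℝ) (hs : ∀ i j, Γ i j = Γ j i)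
    (hp : ∀ (s : Finset ℕ) (c : ℕ → ℝ), 0 ≤ ∑ i ∈ s, ∑ j ∈ s, c i * c j * Γ i j) :
    ∃ ζ : ℕ → (ℕ → ℝ) → ℝ, (∀ k, Measurable (ζ k)) ∧
      (∀ k, ∃ v : ℝ≥0, gam.map (ζ k) = gaussianReal 0 v) ∧
      (∀ k, MemLp (ζ k) 2 gam) ∧
      (∀ k, ∫ η, ζ k η ∂gam = 0) ∧ (∀ i j, ∫ η, ζ i η * ζ j η ∂gam = Γ i j) ∧
      (∀ K (t : ℕ → ℝ), ∫ η, ee (∑ k ∈ Finset.range K, t k * ζ k η) ∂gam =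
        (Real.exp (-(∑ i ∈ Finset.range K, ∑ j ∈ Finset.range K, t i * t j * Γ i j) / 2) : ℂ)) := by
  obtain ⟨L, hL0, hL⟩ := gram_exists Γ hs hp
  have hext : ∀ i N η, i < N → lin (i+1) (L i) η = lin N (L i) η := by
    intro i N η hi
    unfold lin
    refine Finset.sum_subset (by simpa using hi) fun k _ hk => ?_
    rw [hL0 i k (by simpa using hk)]; simp
  refine ⟨fun i => lin (i+1) (L i), fun k => lin_meas _ _, fun k => ⟨_, lin_law _ _⟩,
    fun k => lin_memLp _ _, fun k => lin_mean _ _, fun i j => ?_, fun K t => ?_⟩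
  · simp only [hext i (i + j + 1) _ (by omega), hext j (i + j + 1) _ (by omega)]
    rw [lin_mul, hL i j _ (by omega)]
  · have e : ∀ η, ∑ k ∈ Finset.range K, t k * lin (k+1) (L k) η =
        lin K (fun j => ∑ k ∈ Finset.range K, t k * L k j) η := by
      intro η
      rw [Finset.sum_congr rfl fun k hk => by rw [hext k K η (Finset.mem_range.1 hk)]]
      simp only [lin, Finset.mul_sum, Finset.sum_mul]
      rw [Finset.sum_comm]
      simp only [mul_assoc]
    simp only [e]
    rw [lin_char]
    congr 4
    simp only [sq, Finset.sum_mul_sum]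
    rw [Finset.sum_comm]
    refine Finset.sum_congr rfl fun i hi => ?_
    rw [Finset.sum_comm]
    refine Finset.sum_congr rfl fun j hj => ?_
    rw [← hL i j K (Finset.mem_range.1 hi), Finset.mul_sum]
    exact Finset.sum_congr rfl fun k _ => by ring

end

end

section

section
universe u
variable {𝒵 : Type*} [MeasurableSpace 𝒵] {θ : Measure 𝒵} [IsProbabilityMeasure θ]
  {H : Type u} [NormedAddCommGroup H] [InnerProductSpace ℝ H] [CompleteSpace H]

lemma rankOne_compact (x : H) : IsCompactOperator (InnerProductSpace.rankOne ℝ x x) := by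
  have h : InnerProductSpace.rankOne ℝ x x =
      (ContinuousLinearMap.toSpanSingleton ℝ x).comp (innerSL ℝ x) := by
    ext z; simp
  rw [h]
  exact (isCompactOperator_id (E := ℝ)).comp_clm (innerSL ℝ x) |>.clm_comp
    (ContinuousLinearMap.toSpanSingleton ℝ x)

lemma family_basis (E : ℝ → Submodule ℝ H) (hcl : ∀ μ, IsClosed (E μ : Set H))
    (hfam : OrthogonalFamily ℝ (fun μ => E μ) fun μ => (E μ).subtypeₗᵢ)
    (hbot : (⨆ μ, E μ)ᗮ = ⊥) :
    ∃ (ι : Type u) (b : HilbertBasis ι ℝ H) (σ : ι → ℝ), ∀ i, b i ∈ E (σ i) := by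
  have hcs : ∀ μ : ℝ, CompleteSpace (E μ) := fun μ => (hcl μ).completeSpace_coe
  have hB : ∀ μ : ℝ, ∃ (w : Set (E μ)) (b : HilbertBasis w ℝ (E μ)),
      ⇑b = ((↑) : w → _) := fun μ => exists_hilbertBasis ℝ _
  choose w b hb using hB
  have hon := hfam.orthonormal_sigma_orthonormal (fun μ => (b μ).orthonormal)
  have hsp : (Submodule.span ℝ (Set.range fun a : Σ μ : ℝ, w μ =>
      (E a.1).subtypeₗᵢ (b a.1 a.2)))ᗮ = ⊥ := by
    rw [eq_bot_iff, ← hbot]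
    intro h hh
    rw [← Submodule.iInf_orthogonal, Submodule.mem_iInf]
    intro μ
    rw [Submodule.mem_orthogonal]
    intro u hu
    have hs := (b μ).hasSum_repr ⟨u, hu⟩
    have hs2 := (hs.mapL (E μ).subtypeL).mapL (innerSL ℝ h)
    have hz : ∀ i, innerSL ℝ h ((E μ).subtypeL ((b μ).repr ⟨u, hu⟩ i • b μ i)) = 0 := by
      intro i
      rw [map_smul, map_smul]
      have := (Submodule.mem_orthogonal' _ _).1 hh _ (Submodule.subset_span ⟨⟨μ, i⟩, rfl⟩)
      simp only [Submodule.subtypeL_apply, innerSL_apply_apply]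
      simp only [Submodule.coe_subtypeₗᵢ, Submodule.subtype_apply] at this
      rw [this, smul_zero]
    simp only [hz] at hs2
    have := hs2.unique hasSum_zero
    rw [real_inner_comm]
    simpa using this
  refine ⟨_, HilbertBasis.mkOfOrthogonalEqBot hon hsp, fun a => a.1, fun a => ?_⟩
  rw [HilbertBasis.coe_mkOfOrthogonalEqBot]
  exact (b a.1 a.2).2

lemma compact_basis (T : H →L[ℝ] H) (hT : IsCompactOperator T)
    (hT' : (T : H →ₗ[ℝ] H).IsSymmetric) :
    ∃ (ι : Type u) (b : HilbertBasis ι ℝ H) (σ : ι → ℝ), ∀ i, T (b i) = σ i • b i := by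
  have hbot := ContinuousLinearMap.orthogonalComplement_iSup_eigenspaces_eq_bot hT hT'
  have hfam := hT'.orthogonalFamily_eigenspaces
  have hcl : ∀ μ : ℝ, IsClosed ((Module.End.eigenspace (T : H →ₗ[ℝ] H) μ : Submodule ℝ H) : Set H) := by
    intro μ
    have : ((Module.End.eigenspace (T : H →ₗ[ℝ] H) μ : Submodule ℝ H) : Set H) =
        {x | T x = μ • x} := by
      ext x
      exact Module.End.mem_eigenspace_iff
    rw [this]
    exact isClosed_eq T.continuous (by fun_prop)
  obtain ⟨ι, b, σ, hb⟩ := family_basis _ hcl hfam hbot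
  exact ⟨ι, b, σ, fun i => Module.End.mem_eigenspace_iff.1 (hb i)⟩

theorem eig_exists {ξ : 𝒵 → H} (hm : StronglyMeasurable ξ) (h2 : MemLp ξ 2 θ) :
    ∃ (e : ℕ → H) (σ : ℕ → ℝ), (∀ i j, i ≠ j → inner ℝ (e i) (e j) = 0) ∧
      (∀ k, (e k = 0 ∧ σ k = 0) ∨ (‖e k‖ = 1 ∧ 0 < σ k)) ∧
      (∀ k h, ∫ z, inner ℝ (ξ z) (e k) * inner ℝ (ξ z) h ∂θ = σ k * inner ℝ (e k) h) ∧
      ∀ᵐ z ∂θ, Tendsto (fun K => ∑ k ∈ Finset.range K, inner ℝ (e k) (ξ z) • e k) atTop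
        (𝓝 (ξ z)) := by
  have hR : Integrable (fun z => InnerProductSpace.rankOne ℝ (ξ z) (ξ z)) θ := by
    have hsm : StronglyMeasurable (fun z => InnerProductSpace.rankOne ℝ (ξ z) (ξ z)) := by
      have hc : Continuous (fun x : H => InnerProductSpace.rankOne ℝ x x) :=
        (InnerProductSpace.rankOne ℝ (E := H) (F := H)).continuous₂.comp
          (continuous_id.prodMk continuous_id)
      exact hc.comp_stronglyMeasurable hm
    refine (integrable_norm_iff hsm.aestronglyMeasurable).1 ?_
    have := h2.integrable_norm_pow (by norm_num)
    simpa [sq] using this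
  set T : H →L[ℝ] H := ∫ z, InnerProductSpace.rankOne ℝ (ξ z) (ξ z) ∂θ with hTdef
  have hTi : ∀ h k, inner ℝ (T h) k = ∫ z, inner ℝ (ξ z) h * inner ℝ (ξ z) k ∂θ := by
    intro h k
    have h1 : T h = ∫ z, inner ℝ (ξ z) h • ξ z ∂θ := by
      rw [hTdef, ContinuousLinearMap.integral_apply hR]; simp
    have hi : Integrable (fun z => inner ℝ (ξ z) h • ξ z) θ := by
      have := hR.apply_continuousLinearMap h
      simpa using this
    rw [h1, real_inner_comm, ← integral_inner hi]
    refine integral_congr_ae (Eventually.of_forall fun z => ?_)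
    simp only [inner_smul_right, real_inner_comm]
  have hTs : (T : H →ₗ[ℝ] H).IsSymmetric := by
    intro h k
    simp only [ContinuousLinearMap.coe_coe]
    rw [hTi, real_inner_comm, hTi]
    simp only [mul_comm]
  have hTc : IsCompactOperator T := by
    have hconv : Convex ℝ ((compactOperator (RingHom.id ℝ) H H : Submodule ℝ (H →L[ℝ] H)) :
        Set (H →L[ℝ] H)) := Submodule.convex _
    exact hconv.integral_mem isClosed_setOfPred_isCompactOperator
      (Eventually.of_forall fun z => rankOne_compact (ξ z)) hR
  obtain ⟨ι, b, σ, hb⟩ := compact_basis T hTc hTs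
  have hsq : ∀ h, MemLp (fun z => inner ℝ (ξ z) h) 2 θ := fun h => by
    exact h2.inner_const h
  have hσ : ∀ i, ∫ z, inner ℝ (ξ z) (b i) ^ 2 ∂θ = σ i := by
    intro i
    have := hTi (b i) (b i)
    rw [hb, inner_smul_left, real_inner_self_eq_norm_sq, b.orthonormal.1 i] at this
    simp only [sq]; rw [← this]; simp
  have hσ0 : ∀ i, 0 ≤ σ i := fun i => by rw [← hσ]; exact integral_nonneg fun z => sq_nonneg _
  have hsumm : Summable σ := by
    refine summable_of_sum_le (c := ∫ z, ‖ξ z‖ ^ 2 ∂θ) hσ0 fun F => ?_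
    simp only [← hσ]
    rw [← integral_finsetSum _ fun i _ => (hsq _).integrable_sq]
    refine integral_mono (integrable_finsetSum _ fun i _ => (hsq _).integrable_sq)
      (by simpa using h2.integrable_norm_pow (by norm_num)) fun z => ?_
    have := b.orthonormal.sum_inner_products_le (ξ z) (s := F)
    refine le_trans (le_of_eq ?_) this
    refine Finset.sum_congr rfl fun i _ => ?_
    rw [real_inner_comm]; simp
  let S : Set ι := Function.support σ
  have hS : S.Countable := hsumm.countable_support
  have : Countable S := hS.to_subtype
  have : Encodable S := Encodable.ofCountable S
  -- the orthogonal complement part vanishes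
  let V : Submodule ℝ H := (Submodule.span ℝ (b '' S)).topologicalClosure
  have hVc : IsClosed (V : Set H) := Submodule.isClosed_topologicalClosure _
  have : CompleteSpace V := hVc.completeSpace_coe
  have hV0 : ∀ h ∈ Vᗮ, T h = 0 := by
    intro h hh
    have hz : ∀ i, inner ℝ (b i) (T h) = 0 := by
      intro i
      have h1 := hTs (b i) h
      simp only [ContinuousLinearMap.coe_coe] at h1
      rw [← h1, hb, inner_smul_left]
      by_cases hi : i ∈ S
      · have : inner ℝ (b i) h = 0 := (Submodule.mem_orthogonal _ _).1 hh _
          (Submodule.le_topologicalClosure _ (Submodule.subset_span ⟨i, hi, rfl⟩))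
        rw [this, mul_zero]
      · have : σ i = 0 := by simpa [S] using hi
        simp [this]
    have hs := b.hasSum_repr (T h)
    simp only [b.repr_apply_apply, hz, zero_smul] at hs
    exact hs.unique hasSum_zero
  have hQ : ∀ᵐ z ∂θ, Vᗮ.starProjection (ξ z) = 0 := by
    have hQm : StronglyMeasurable fun z => Vᗮ.starProjection (ξ z) :=
      (Vᗮ.starProjection).continuous.comp_stronglyMeasurable hm
    refine ae_eq_zero_of_forall_dual_of_isSeparable ℝ hQm.isSeparable_range (fun c => ?_)
      (Eventually.of_forall fun z => Set.mem_range_self z)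
    obtain ⟨h, rfl⟩ := (InnerProductSpace.toDual ℝ H).surjective c
    have h1 : ∀ z, InnerProductSpace.toDual ℝ H h (Vᗮ.starProjection (ξ z)) =
        inner ℝ (ξ z) (Vᗮ.starProjection h) := by
      intro z
      rw [InnerProductSpace.toDual_apply_apply, real_inner_comm]
      exact Submodule.inner_starProjection_left_eq_right _ _ _
    have h3 : ∫ z, inner ℝ (ξ z) (Vᗮ.starProjection h) ^ 2 ∂θ = 0 := by
      simp only [sq]
      rw [← hTi, hV0 _ (Submodule.starProjection_apply_mem _ _), inner_zero_left]
    rw [integral_eq_zero_iff_of_nonneg (fun z => sq_nonneg _) (hsq _).integrable_sq] at h3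
    filter_upwards [h3] with z hz
    rw [h1]
    simpa using hz
  let e : ℕ → H := Function.extend (Encodable.encode : S → ℕ) (fun i => b i) 0
  let τ : ℕ → ℝ := Function.extend (Encodable.encode : S → ℕ) (fun i => σ i) 0
  have hinj : Function.Injective (Encodable.encode : S → ℕ) := Encodable.encode_injective
  have he1 : ∀ i : S, e (Encodable.encode i) = b i := fun i => hinj.extend_apply _ _ _
  have ht1 : ∀ i : S, τ (Encodable.encode i) = σ i := fun i => hinj.extend_apply _ _ _
  have he0 : ∀ k, (¬ ∃ i : S, Encodable.encode i = k) → e k = 0 := fun k hk =>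
    Function.extend_apply' _ _ _ hk
  have ht0 : ∀ k, (¬ ∃ i : S, Encodable.encode i = k) → τ k = 0 := fun k hk =>
    Function.extend_apply' _ _ _ hk
  refine ⟨e, τ, ?_, ?_, ?_, ?_⟩
  · intro i j hij
    by_cases hi : ∃ a : S, Encodable.encode a = i
    · obtain ⟨a, rfl⟩ := hi
      by_cases hj : ∃ a : S, Encodable.encode a = j
      · obtain ⟨c, rfl⟩ := hj
        rw [he1, he1]
        exact b.orthonormal.2 fun h => hij (by rw [Subtype.ext h])
      · rw [he0 j hj, inner_zero_right]
    · rw [he0 i hi, inner_zero_left]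
  · intro k
    by_cases hk : ∃ a : S, Encodable.encode a = k
    · obtain ⟨a, rfl⟩ := hk
      right
      rw [he1, ht1]
      exact ⟨b.orthonormal.1 _, lt_of_le_of_ne (hσ0 _) (Ne.symm a.2)⟩
    · left; exact ⟨he0 k hk, ht0 k hk⟩
  · intro k h
    rw [← hTi]
    by_cases hk : ∃ a : S, Encodable.encode a = k
    · obtain ⟨a, rfl⟩ := hk
      rw [he1, ht1, hb, inner_smul_left]; rfl
    · rw [he0 k hk]; simp
  · filter_upwards [hQ] with z hz
    have hzV : ∀ i ∉ S, inner ℝ (b i) (ξ z) = 0 := by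
      intro i hi
      have h1 : b i ∈ Vᗮ := by
        rw [Submodule.orthogonal_closure, Submodule.mem_orthogonal]
        intro u hu
        refine Submodule.span_induction (p := fun u _ => inner ℝ u (b i) = 0) ?_ ?_ ?_ ?_ hu
        · rintro _ ⟨j, hj, rfl⟩
          exact b.orthonormal.2 fun h => hi (h ▸ hj)
        · simp
        · intro x y _ _ hx hy; rw [inner_add_left, hx, hy, add_zero]
        · intro c x _ hx; rw [inner_smul_left, hx, mul_zero]
      have h2 := Submodule.inner_starProjection_left_eq_right Vᗮ (b i) (ξ z)
      rw [hz, inner_zero_right, Submodule.starProjection_eq_self_iff.2 h1] at h2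
      exact h2
    have hs := b.hasSum_repr (ξ z)
    simp only [b.repr_apply_apply] at hs
    have hs1 : HasSum (fun i : S => inner ℝ (b i) (ξ z) • b i) (ξ z) := by
      refine (hasSum_subtype_iff_of_support_subset (f := fun i => inner ℝ (b i) (ξ z) • b i)
        (s := S) ?_).2 hs
      intro i hi
      by_contra hiS
      exact hi (by simp [hzV i hiS])
    have hs2 : HasSum (fun k => inner ℝ (e k) (ξ z) • e k) (ξ z) := by
      rw [← hinj.hasSum_iff]
      · convert hs1 using 1
        funext i; simp only [Function.comp]; rw [he1]
      · intro k hk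
        rw [he0 k hk, smul_zero]
    exact hs2.tendsto_sum_nat
end

end

section

section
variable {Ω 𝒵 : Type*} [MeasurableSpace Ω] [MeasurableSpace 𝒵] {P : Measure Ω}
  [IsProbabilityMeasure P] {Z : ℕ → Ω → 𝒵} {θ : Measure 𝒵} {ε r C : ℝ}

lemma MixProc.quad_limit (M : MixProc P Z θ ε r C) {φ : ℕ → 𝒵 → ℝ}
    (hq : ∀ k, MemLp (φ k) 2 θ) {Γ : ℕ → ℕ → ℝ}
    (hΓ : ∀ i j, Tendsto (fun n : ℕ => (n : ℝ)⁻¹ * ∑ t ∈ Finset.range n, ∑ u ∈ Finset.range n,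
      ∫ ω, φ i (Z t ω) * φ j (Z u ω) ∂P) atTop (𝓝 (Γ i j))) (s : Finset ℕ) (c : ℕ → ℝ) :
    Tendsto (fun n : ℕ => (n : ℝ)⁻¹ * ∫ ω, (∑ t ∈ Finset.range n,
      ∑ i ∈ s, c i * φ i (Z t ω)) ^ 2 ∂P) atTop
      (𝓝 (∑ i ∈ s, ∑ j ∈ s, c i * c j * Γ i j)) := by
  have key : ∀ n : ℕ, (n : ℝ)⁻¹ * ∫ ω, (∑ t ∈ Finset.range n,
      ∑ i ∈ s, c i * φ i (Z t ω)) ^ 2 ∂P = ∑ i ∈ s, ∑ j ∈ s, c i * c j * ((n : ℝ)⁻¹ *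
        ∑ t ∈ Finset.range n, ∑ u ∈ Finset.range n, ∫ ω, φ i (Z t ω) * φ j (Z u ω) ∂P) := by
    intro n
    have hS : ∀ i, MemLp (fun ω => ∑ t ∈ Finset.range n, φ i (Z t ω)) 2 P := fun i => by
      simpa using M.sum_memLp (hq i) n 1
    have e1 : ∀ ω, (∑ t ∈ Finset.range n, ∑ i ∈ s, c i * φ i (Z t ω)) ^ 2 =
        ∑ i ∈ s, ∑ j ∈ s, c i * c j * ((∑ t ∈ Finset.range n, φ i (Z t ω)) *
          (∑ t ∈ Finset.range n, φ j (Z t ω))) := by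
      intro ω
      rw [Finset.sum_comm, sq, Finset.sum_mul_sum]
      refine Finset.sum_congr rfl fun i _ => Finset.sum_congr rfl fun j _ => ?_
      rw [← Finset.mul_sum, ← Finset.mul_sum]; ring
    have hI : ∀ i j, Integrable (fun ω => c i * c j * ((∑ t ∈ Finset.range n, φ i (Z t ω)) *
          (∑ t ∈ Finset.range n, φ j (Z t ω)))) P := fun i j =>
      ((hS i).integrable_mul (hS j)).const_mul _
    simp_rw [e1]
    rw [integral_finsetSum _ fun i _ => integrable_finsetSum _ fun j _ => hI i j, Finset.mul_sum]
    refine Finset.sum_congr rfl fun i _ => ?_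
    rw [integral_finsetSum _ fun j _ => hI i j, Finset.mul_sum]
    refine Finset.sum_congr rfl fun j _ => ?_
    rw [integral_const_mul, M.var_eq (hq i) (hq j)]; ring
  simp_rw [key]
  exact tendsto_finsetSum _ fun i _ => tendsto_finsetSum _ fun j _ => (hΓ i j).const_mul _

lemma MixProc.gauss_limit (M : MixProc P Z θ ε r C) {φ : ℕ → 𝒵 → ℝ}
    (hm : ∀ k, Measurable (φ k)) (hq : ∀ k, MemLp (φ k) (qe ε) θ) (h0 : ∀ k, ∫ z, φ k z ∂θ = 0) :
    ∃ ζ : ℕ → (ℕ → ℝ) → ℝ, (∀ k, Measurable (ζ k)) ∧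
      (∀ k, ∃ v : ℝ≥0, gam.map (ζ k) = gaussianReal 0 v) ∧
      (∀ k, MemLp (ζ k) 2 gam) ∧
      (∀ k, ∫ η, ζ k η ∂gam = 0) ∧
      (∀ i j, Tendsto (fun n : ℕ => (n : ℝ)⁻¹ * ∑ t ∈ Finset.range n, ∑ u ∈ Finset.range n,
        ∫ ω, φ i (Z t ω) * φ j (Z u ω) ∂P) atTop (𝓝 (∫ η, ζ i η * ζ j η ∂gam))) ∧
      (∀ K (c : ℕ → ℝ), Tendsto (fun n : ℕ => ∫ ω, ee (∑ k ∈ Finset.range K,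
          c k * ((√n)⁻¹ * ∑ t ∈ Finset.range n, φ k (Z t ω))) ∂P) atTop
        (𝓝 (∫ η, ee (∑ k ∈ Finset.range K, c k * ζ k η) ∂gam))) := by
  have := M.prob
  have hq2 : ∀ k, MemLp (φ k) 2 θ := fun k => (hq k).mono_exponent (qe_ge_two M.eps)
  choose Γ hΓ using fun i j => M.cov_limit (hm i) (hm j) (hq i) (hq j) (h0 i)
  have hs : ∀ i j, Γ i j = Γ j i := by
    intro i j
    refine tendsto_nhds_unique (hΓ i j) ?_
    convert hΓ j i using 3
    rw [Finset.sum_comm]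
    refine Finset.sum_congr rfl fun t _ => Finset.sum_congr rfl fun u _ => ?_
    simp_rw [mul_comm]
  have hp : ∀ (s : Finset ℕ) (c : ℕ → ℝ), 0 ≤ ∑ i ∈ s, ∑ j ∈ s, c i * c j * Γ i j := fun s c =>
    ge_of_tendsto' (M.quad_limit hq2 hΓ s c) fun n => by positivity
  obtain ⟨ζ, z1, z2, z3, z4, z5, z6⟩ := gauss_exists Γ hs hp
  refine ⟨ζ, z1, z2, z3, z4, fun i j => by rw [z5]; exact hΓ i j, fun K c => ?_⟩
  rw [z6]
  have hgm : Measurable fun z => ∑ i ∈ Finset.range K, c i * φ i z :=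
    Finset.measurable_sum _ fun i _ => (hm i).const_mul _
  have hgq : MemLp (fun z => ∑ i ∈ Finset.range K, c i * φ i z) (qe ε) θ :=
    memLp_finsetSum (f := fun i z => c i * φ i z) _ fun i _ => (hq i).const_mul _
  have hg0 : ∫ z, ∑ i ∈ Finset.range K, c i * φ i z ∂θ = 0 := by
    rw [integral_finsetSum _ fun i _ => (((hq i).integrable (qe_ge_one M.eps)).const_mul _)]
    simp [integral_const_mul, h0]
  have := M.clt hgm hgq hg0 (M.quad_limit hq2 hΓ (Finset.range K) c)
  refine this.congr fun n => ?_
  refine integral_congr_ae (Eventually.of_forall fun ω => ?_)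
  simp only
  congr 1
  rw [Finset.sum_comm, Finset.mul_sum]
  refine Finset.sum_congr rfl fun i _ => ?_
  rw [← Finset.mul_sum]; ring

lemma weak_of_char {Ω' V : Type*} [MeasurableSpace Ω'] {P' : Measure Ω'} [IsProbabilityMeasure P']
    [NormedAddCommGroup V] [InnerProductSpace ℝ V] [FiniteDimensional ℝ V] [MeasurableSpace V]
    [BorelSpace V] {f : ℕ → Ω → V} {g : Ω' → V} (hf : ∀ n, Measurable (f n)) (hg : Measurable g)
    (h : ∀ c : V, Tendsto (fun n : ℕ => ∫ ω, Complex.exp (inner ℝ (f n ω) c * Complex.I) ∂P)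
      atTop (𝓝 (∫ η, Complex.exp (inner ℝ (g η) c * Complex.I) ∂P')))
    (F : BoundedContinuousFunction V ℝ) :
    Tendsto (fun n : ℕ => ∫ ω, F (f n ω) ∂P) atTop (𝓝 (∫ η, F (g η) ∂P')) := by
  let μ : ℕ → ProbabilityMeasure V := fun n =>
    ⟨P.map (f n), Measure.isProbabilityMeasure_map (hf n).aemeasurable⟩
  let μ' : ProbabilityMeasure V := ⟨P'.map g, Measure.isProbabilityMeasure_map hg.aemeasurable⟩
  have conv : Tendsto μ atTop (𝓝 μ') := by
    apply ProbabilityMeasure.tendsto_of_tendsto_charFun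
    intro c
    have e1 : ∀ n, charFun (μ n : Measure V) c =
        ∫ ω, Complex.exp (inner ℝ (f n ω) c * Complex.I) ∂P := by
      intro n
      rw [charFun_apply]
      change ∫ x, _ ∂(P.map (f n)) = _
      have hc : Continuous fun x : V => Complex.exp (inner ℝ x c * Complex.I) := by fun_prop
      rw [integral_map (hf n).aemeasurable hc.aestronglyMeasurable]
    have e2 : charFun (μ' : Measure V) c = ∫ η, Complex.exp (inner ℝ (g η) c * Complex.I) ∂P' := by
      rw [charFun_apply]
      change ∫ x, _ ∂(P'.map g) = _
      have hc : Continuous fun x : V => Complex.exp (inner ℝ x c * Complex.I) := by fun_prop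
      rw [integral_map hg.aemeasurable hc.aestronglyMeasurable]
    rw [e2]
    simp_rw [e1]
    exact h c
  have := (ProbabilityMeasure.tendsto_iff_forall_integral_tendsto.1 conv) F
  have a1 : ∀ n, ∫ x, F x ∂(μ n : Measure V) = ∫ ω, F (f n ω) ∂P := fun n =>
    integral_map (hf n).aemeasurable F.continuous.aestronglyMeasurable
  have a2 : ∫ x, F x ∂(μ' : Measure V) = ∫ η, F (g η) ∂P' :=
    integral_map hg.aemeasurable F.continuous.aestronglyMeasurable
  simp_rw [a1, a2] at this
  exact this

/-- Multidimensional weak convergence from linear characteristic functions. -/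
lemma weak_of_ee {Ω' : Type*} [MeasurableSpace Ω'] {P' : Measure Ω'} [IsProbabilityMeasure P']
    (K : ℕ) {S : ℕ → ℕ → Ω → ℝ} {ζ : ℕ → Ω' → ℝ} (hS : ∀ n k, Measurable (S n k))
    (hζ : ∀ k, Measurable (ζ k))
    (h : ∀ (c : ℕ → ℝ), Tendsto (fun n : ℕ => ∫ ω, ee (∑ k ∈ Finset.range K, c k * S n k ω) ∂P)
      atTop (𝓝 (∫ η, ee (∑ k ∈ Finset.range K, c k * ζ k η) ∂P')))
    (F : BoundedContinuousFunction (EuclideanSpace ℝ (Fin K)) ℝ) :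
    Tendsto (fun n : ℕ => ∫ ω, F (WithLp.toLp 2 fun k : Fin K => S n k ω) ∂P) atTop
      (𝓝 (∫ η, F (WithLp.toLp 2 fun k : Fin K => ζ k η) ∂P')) := by
  refine weak_of_char (f := fun n ω => (WithLp.toLp 2 fun k : Fin K => S n k ω))
    (g := fun η => (WithLp.toLp 2 fun k : Fin K => ζ k η)) (fun n => ?_) ?_ (fun c => ?_) F
  · exact (PiLp.continuous_toLp 2 _).measurable.comp (measurable_pi_lambda _ fun k => hS n k)
  · exact (PiLp.continuous_toLp 2 _).measurable.comp (measurable_pi_lambda _ fun k => hζ k)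
  · have e : ∀ x : ℕ → ℝ, ee (∑ k ∈ Finset.range K, (if hk : k < K then c ⟨k, hk⟩ else 0) * x k) =
        Complex.exp (inner ℝ (WithLp.toLp 2 fun k : Fin K => x k : EuclideanSpace ℝ (Fin K)) c * Complex.I) := by
      intro x
      rw [Finset.sum_range]
      simp [ee, PiLp.inner_apply, mul_comm]
    have hc := h (fun k => if hk : k < K then c ⟨k, hk⟩ else 0)
    simp_rw [fun n ω => e fun k => S n k ω, fun η => e fun k => ζ k η] at hc
    exact hc
end

end

section

section
variable {H : Type*} [NormedAddCommGroup H] [InnerProductSpace ℝ H]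

/-- Projection onto the span of the first `K` vectors of an orthogonal family. -/
def pj (e : ℕ → H) (K : ℕ) : H →L[ℝ] H :=
  ∑ k ∈ Finset.range K, (innerSL ℝ (e k)).smulRight (e k)

lemma pj_apply (e : ℕ → H) (K : ℕ) (x : H) :
    pj e K x = ∑ k ∈ Finset.range K, inner ℝ (e k) x • e k := by
  simp [pj]

/-- orthogonal family of vectors of norm zero or one -/
def OrthF (e : ℕ → H) : Prop :=
  (∀ i j, i ≠ j → inner ℝ (e i) (e j) = 0) ∧ ∀ k, e k = 0 ∨ ‖e k‖ = 1

lemma pj_inner {e : ℕ → H} (he : OrthF e) (K : ℕ) (x : H) :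
    inner ℝ (pj e K x) x = ∑ k ∈ Finset.range K, inner ℝ (e k) x ^ 2 := by
  rw [pj_apply, sum_inner]
  refine Finset.sum_congr rfl fun k _ => ?_
  rw [real_inner_smul_left, sq]

lemma pj_norm {e : ℕ → H} (he : OrthF e) (K : ℕ) (x : H) :
    ‖pj e K x‖ ^ 2 = ∑ k ∈ Finset.range K, inner ℝ (e k) x ^ 2 := by
  rw [← real_inner_self_eq_norm_sq]
  nth_rw 1 [pj_apply]
  rw [sum_inner]
  refine Finset.sum_congr rfl fun k hk => ?_
  rw [real_inner_smul_left, pj_apply, inner_sum, Finset.sum_eq_single k]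
  · rw [real_inner_smul_right]
    rcases he.2 k with h | h
    · simp [h]
    · rw [real_inner_self_eq_norm_sq, h]; ring
  · intro j _ hj
    rw [real_inner_smul_right, he.1 k j hj.symm, mul_zero]
  · exact fun h => absurd hk h

lemma pj_sub_norm {e : ℕ → H} (he : OrthF e) (K : ℕ) (x : H) :
    ‖x - pj e K x‖ ^ 2 = ‖x‖ ^ 2 - ‖pj e K x‖ ^ 2 := by
  rw [norm_sub_sq_real, real_inner_comm, pj_inner he, pj_norm he]; ring

lemma pj_norm_le {e : ℕ → H} (he : OrthF e) (K : ℕ) (x : H) : ‖pj e K x‖ ≤ ‖x‖ := by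
  have := pj_sub_norm he K x
  refine abs_le_of_sq_le_sq' ?_ (norm_nonneg _) |>.2
  nlinarith [sq_nonneg ‖x - pj e K x‖]
  
lemma pj_sub_norm_le {e : ℕ → H} (he : OrthF e) (K : ℕ) (x : H) : ‖x - pj e K x‖ ≤ ‖x‖ := by
  have := pj_sub_norm he K x
  refine abs_le_of_sq_le_sq' ?_ (norm_nonneg _) |>.2
  nlinarith [sq_nonneg ‖pj e K x‖]

variable {𝒵 : Type*} [MeasurableSpace 𝒵] {θ : Measure 𝒵} {ε : ℝ}

lemma Nq_tail (hε : 0 < ε) {e : ℕ → H} (he : OrthF e) {ξ : 𝒵 → H} (hξ : MemLp ξ (qe ε) θ)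
    (hT : ∀ᵐ z ∂θ, Tendsto (fun K => pj e K (ξ z)) atTop (𝓝 (ξ z))) :
    Tendsto (fun K => Nq ε θ fun z => ξ z - pj e K (ξ z)) atTop (𝓝 0) := by
  have hq : 0 < (qe ε).toReal := by rw [qe_toReal hε]; linarith
  have h1 : Tendsto (fun K => ∫⁻ z, ‖ξ z - pj e K (ξ z)‖ₑ ^ (qe ε).toReal ∂θ) atTop
      (𝓝 (∫⁻ _, 0 ∂θ)) := by
    refine tendsto_lintegral_of_dominated_convergence' (fun z => ‖ξ z‖ₑ ^ (qe ε).toReal) ?_ ?_ ?_ ?_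
    · intro K
      exact ((hξ.1.sub ((pj e K).continuous.comp_aestronglyMeasurable hξ.1)).enorm).pow_const _
    · intro K
      refine Eventually.of_forall fun z => ?_
      refine ENNReal.rpow_le_rpow ?_ hq.le
      rw [enorm_le_iff_norm_le]
      exact pj_sub_norm_le he K _
    · exact (lintegral_rpow_enorm_lt_top_of_eLpNorm_lt_top (qe_ne_zero hε) qe_ne_top hξ.2).ne
    · filter_upwards [hT] with z hz
      have : Tendsto (fun K => ‖ξ z - pj e K (ξ z)‖ₑ) atTop (𝓝 0) := by
        have := ((tendsto_const_nhds (x := ξ z)).sub hz).enorm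
        simpa using this
      have h2 := (ENNReal.continuous_rpow_const (y := (qe ε).toReal)).tendsto 0 |>.comp this
      simpa [ENNReal.zero_rpow_of_pos hq, Function.comp_def] using h2
  have h2 : Tendsto (fun K => eLpNorm (fun z => ξ z - pj e K (ξ z)) (qe ε) θ) atTop (𝓝 0) := by
    simp_rw [eLpNorm_eq_lintegral_rpow_enorm_toReal (qe_ne_zero hε) qe_ne_top]
    have h3 := (ENNReal.continuous_rpow_const (y := 1 / (qe ε).toReal)).tendsto _ |>.comp h1
    have : (0 : ℝ≥0∞) ^ (1 / (qe ε).toReal) = 0 := ENNReal.zero_rpow_of_pos (by positivity)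
    rw [lintegral_zero, this] at h3
    exact h3
  have := (ENNReal.tendsto_toReal ENNReal.zero_ne_top).comp h2
  simpa [Nq, Function.comp_def] using this

lemma double_limit {a c ρ η : ℕ → ℝ} {b : ℕ → ℕ → ℝ} {l L : ℝ} 
    (h1 : ∀ K n, |a n - b K n| ≤ L * (ρ n + η K)) (hρ : Tendsto ρ atTop (𝓝 0))
    (hη : Tendsto η atTop (𝓝 0)) (hb : ∀ K, Tendsto (b K) atTop (𝓝 (c K)))
    (hc : Tendsto c atTop (𝓝 l)) : Tendsto a atTop (𝓝 l) := by
  rw [Metric.tendsto_atTop]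
  intro δ hδ
  have e1 : Tendsto (fun K => L * η K) atTop (𝓝 0) := by simpa using hη.const_mul L
  have e2 : Tendsto (fun n => L * ρ n) atTop (𝓝 0) := by simpa using hρ.const_mul L
  obtain ⟨K, hK1, hK2⟩ := ((e1.eventually (gt_mem_nhds (show 0 < δ / 4 by linarith))).and
    (hc.eventually (Metric.ball_mem_nhds l (show 0 < δ / 4 by linarith)))).exists
  obtain ⟨N, hN⟩ := eventually_atTop.1 ((e2.eventually (gt_mem_nhds (show 0 < δ / 4 by linarith))).and
    ((hb K).eventually (Metric.ball_mem_nhds (c K) (show 0 < δ / 4 by linarith))))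
  refine ⟨N, fun n hn => ?_⟩
  obtain ⟨h3, h4⟩ := hN n hn
  have h5 := h1 K n
  simp only [Metric.mem_ball, Real.dist_eq] at hK2 h4 ⊢
  rw [abs_lt] at *
  rw [abs_le] at h5
  constructor <;> nlinarith

end

end

section

section

lemma ae_summable_of_bound {Ω' : Type*} [MeasurableSpace Ω'] {Q : Measure Ω'}
    {g : ℕ → Ω' → ℝ} (hm : ∀ k, Measurable (g k)) (h0 : ∀ k η, 0 ≤ g k η)
    (hi : ∀ k, Integrable (g k) Q) {B : ℝ} (hB : ∀ K, ∑ k ∈ Finset.range K, ∫ η, g k η ∂Q ≤ B) :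
    ∀ᵐ η ∂Q, Summable fun k => g k η := by
  have h1 : ∫⁻ η, ∑' k, ENNReal.ofReal (g k η) ∂Q ≠ ∞ := by
    rw [lintegral_tsum fun k => (hm k).ennreal_ofReal.aemeasurable]
    have : ∀ k, ∫⁻ η, ENNReal.ofReal (g k η) ∂Q = ENNReal.ofReal (∫ η, g k η ∂Q) := fun k =>
      (ofReal_integral_eq_lintegral_ofReal (hi k) (Eventually.of_forall (h0 k))).symm
    simp_rw [this]
    have hs : Summable fun k => ∫ η, g k η ∂Q :=
      summable_of_sum_range_le (fun k => integral_nonneg (h0 k)) hB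
    exact hs.tsum_ofReal_ne_top
  filter_upwards [ae_lt_top (Measurable.tsum fun k => (hm k).ennreal_ofReal) h1] with η hη
  have := ENNReal.summable_toReal hη.ne
  simpa [ENNReal.toReal_ofReal (h0 _ η)] using this

variable {Ω : Type*} [MeasurableSpace Ω] {P : Measure Ω} [IsProbabilityMeasure P]

/-- weak convergence from Lipschitz test functions, transferred through the square map -/
lemma weak_sq {Ω' : Type*} [MeasurableSpace Ω'] {Q : Measure Ω'} [IsProbabilityMeasure Q]
    {T : ℕ → Ω → ℝ} {b : Ω' → ℝ} (hT : ∀ n, Measurable (T n)) (hb : Measurable b)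
    (h : ∀ G : ℝ → ℝ, (∃ B : ℝ, ∀ x, |G x| ≤ B) → (∃ L, LipschitzWith L G) →
      Tendsto (fun n => ∫ ω, G (T n ω) ∂P) atTop (𝓝 (∫ η, G (b η) ∂Q)))
    (f : BoundedContinuousFunction ℝ ℝ) :
    Tendsto (fun n => ∫ ω, f (T n ω ^ 2) ∂P) atTop (𝓝 (∫ η, f (b η ^ 2) ∂Q)) := by
  let μ : ℕ → ProbabilityMeasure ℝ := fun n =>
    ⟨P.map (T n), Measure.isProbabilityMeasure_map (hT n).aemeasurable⟩
  let μ' : ProbabilityMeasure ℝ := ⟨Q.map b, Measure.isProbabilityMeasure_map hb.aemeasurable⟩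
  have conv : Tendsto μ atTop (𝓝 μ') := by
    rw [tendsto_iff_forall_lipschitz_integral_tendsto]
    rintro G ⟨B, hB⟩ ⟨L, hL⟩
    have := h G ⟨|G 0| + B, fun x => ?_⟩ ⟨L, hL⟩
    · have a1 : ∀ n, ∫ x, G x ∂(μ n : Measure ℝ) = ∫ ω, G (T n ω) ∂P := fun n =>
        integral_map (hT n).aemeasurable hL.continuous.aestronglyMeasurable
      have a2 : ∫ x, G x ∂(μ' : Measure ℝ) = ∫ η, G (b η) ∂Q :=
        integral_map hb.aemeasurable hL.continuous.aestronglyMeasurable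
      simp_rw [a1, a2]
      exact this
    · have h1 := hB x 0
      rw [Real.dist_eq] at h1
      have := abs_sub_abs_le_abs_sub (G x) (G 0)
      linarith
  have := (ProbabilityMeasure.tendsto_iff_forall_integral_tendsto.1 conv)
    (f.compContinuous ⟨fun x : ℝ => x ^ 2, by fun_prop⟩)
  have a1 : ∀ n, ∫ x, f.compContinuous ⟨fun x : ℝ => x ^ 2, by fun_prop⟩ x ∂(μ n : Measure ℝ) =
      ∫ ω, f (T n ω ^ 2) ∂P := fun n =>
    integral_map (hT n).aemeasurable (BoundedContinuousFunction.continuous _).aestronglyMeasurable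
  have a2 : ∫ x, f.compContinuous ⟨fun x : ℝ => x ^ 2, by fun_prop⟩ x ∂(μ' : Measure ℝ) =
      ∫ η, f (b η ^ 2) ∂Q :=
    integral_map hb.aemeasurable (BoundedContinuousFunction.continuous _).aestronglyMeasurable
  simp_rw [a1, a2] at this
  exact this

variable {𝒵 : Type*} [MeasurableSpace 𝒵] {Z : ℕ → Ω → 𝒵} {θ : Measure 𝒵} {ε r C : ℝ}
  {H : Type*} [NormedAddCommGroup H] [InnerProductSpace ℝ H] [CompleteSpace H]

/-- scaled L2 bound -/
lemma MixProc.W_bound (M : MixProc P Z θ ε r C) {ξ : 𝒵 → H} (hm : StronglyMeasurable ξ)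
    (hξ : MemLp ξ (qe ε) θ) (h0 : ∫ z, ξ z ∂θ = 0) (n : ℕ) :
    ∫ ω, ‖(√(n : ℝ))⁻¹ • ∑ t ∈ Finset.range n, ξ (Z t ω)‖ ^ 2 ∂P ≤ 4 * cc C * Nq ε θ ξ ^ 2 := by
  have h := M.L2_bound hm hξ h0 (Finset.range n)
  have hcc : 0 ≤ cc C := by unfold cc; linarith [M.C0]
  simp_rw [norm_smul, mul_pow]
  rw [integral_const_mul]
  rcases Nat.eq_zero_or_pos n with rfl | hn
  · simp; positivity
  have hn' : (0 : ℝ) < n := by exact_mod_cast hn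
  have e : ‖(√(n : ℝ))⁻¹‖ ^ 2 = (n : ℝ)⁻¹ := by
    rw [Real.norm_eq_abs, sq_abs, inv_pow, Real.sq_sqrt hn'.le]
  rw [e, inv_mul_le_iff₀ hn']
  rw [Finset.card_range] at h
  linarith

lemma MixProc.W_memLp (M : MixProc P Z θ ε r C) {ξ : 𝒵 → H} {q : ℝ≥0∞}
    (hξ : MemLp ξ q θ) (n : ℕ) :
    MemLp (fun ω => (√(n : ℝ))⁻¹ • ∑ t ∈ Finset.range n, ξ (Z t ω)) q P :=
  (memLp_finsetSum (f := fun t ω => ξ (Z t ω)) _ fun t _ => M.memLp_comp hξ t).const_smul _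

lemma MixProc.W_bound1 (M : MixProc P Z θ ε r C) {ξ : 𝒵 → H} (hm : StronglyMeasurable ξ)
    (hξ : MemLp ξ (qe ε) θ) (h0 : ∫ z, ξ z ∂θ = 0) (n : ℕ) :
    ∫ ω, ‖(√(n : ℝ))⁻¹ • ∑ t ∈ Finset.range n, ξ (Z t ω)‖ ∂P ≤ √(4 * cc C) * Nq ε θ ξ := by
  have hcc : 0 ≤ cc C := by unfold cc; linarith [M.C0]
  have := M.prob
  have h2 := M.W_memLp (hξ.mono_exponent (qe_ge_two M.eps)) n
  have h3 := int_abs_le_sqrt h2.norm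
  simp only [abs_norm] at h3
  refine h3.trans ((Real.sqrt_le_sqrt (M.W_bound hm hξ h0 n)).trans ?_)
  rw [Real.sqrt_mul (by positivity), Real.sqrt_sq (Nq_nonneg _)]

end

end

section

section
universe u
variable {Ω : Type*} [MeasurableSpace Ω] {P : Measure Ω} [IsProbabilityMeasure P]
variable {𝒵 : Type*} [MeasurableSpace 𝒵] {Z : ℕ → Ω → 𝒵} {θ : Measure 𝒵} {ε r C : ℝ}
  {H : Type u} [NormedAddCommGroup H] [InnerProductSpace ℝ H] [CompleteSpace H]

/-- The limit theorem for Lipschitz test functions of the norm. -/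
lemma MixProc.lip_limit (M : MixProc P Z θ ε r C) {ξ : 𝒵 → H} (hm : StronglyMeasurable ξ)
    (hξ : MemLp ξ (qe ε) θ) (h0 : ∫ z, ξ z ∂θ = 0) {e : ℕ → H} (he : OrthF e)
    (hT : ∀ᵐ z ∂θ, Tendsto (fun K => pj e K (ξ z)) atTop (𝓝 (ξ z)))
    {σ : ℕ → ℝ} (hσ : ∀ k, 0 ≤ σ k) {φ : ℕ → 𝒵 → ℝ}
    (hφ : ∀ k z, inner ℝ (e k) (ξ z) = √(σ k) * φ k z) (hφm : ∀ k, Measurable (φ k))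
    {ζ : ℕ → (ℕ → ℝ) → ℝ} (hζ : ∀ k, Measurable (ζ k))
    (hchar : ∀ K (c : ℕ → ℝ), Tendsto (fun n : ℕ => ∫ ω, ee (∑ k ∈ Finset.range K,
          c k * ((√n)⁻¹ * ∑ t ∈ Finset.range n, φ k (Z t ω))) ∂P) atTop
        (𝓝 (∫ η, ee (∑ k ∈ Finset.range K, c k * ζ k η) ∂gam)))
    (hsum : ∀ᵐ η ∂gam, Summable fun k => σ k * ζ k η ^ 2)
    {T : ℕ → Ω → ℝ} (hTm : ∀ n, Measurable (T n)) {ρ : ℕ → ℝ} (hρ : Tendsto ρ atTop (𝓝 0))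
    (hR : ∀ n, ∃ R : Ω → ℝ, Integrable R P ∧ ∫ ω, R ω ∂P ≤ ρ n ∧
      ∀ ω, |T n ω - ‖(√(n : ℝ))⁻¹ • ∑ t ∈ Finset.range n, ξ (Z t ω)‖| ≤ R ω)
    (G : ℝ → ℝ) (hB : ∃ B : ℝ, ∀ x, |G x| ≤ B) (hL : ∃ L, LipschitzWith L G) :
    Tendsto (fun n => ∫ ω, G (T n ω) ∂P) atTop
      (𝓝 (∫ η, G (√(∑' k, σ k * ζ k η ^ 2)) ∂gam)) := by
  obtain ⟨B, hB⟩ := hB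
  obtain ⟨L, hL⟩ := hL
  have := M.prob
  have hξ1 := hξ.integrable (qe_ge_one M.eps)
  have hξ2 := hξ.mono_exponent (qe_ge_two M.eps)
  let W : ℕ → Ω → H := fun n ω => (√(n : ℝ))⁻¹ • ∑ t ∈ Finset.range n, ξ (Z t ω)
  let S : ℕ → ℕ → Ω → ℝ := fun n k ω => (√n)⁻¹ * ∑ t ∈ Finset.range n, φ k (Z t ω)
  have hSm : ∀ n k, Measurable (S n k) := fun n k =>
    (Finset.measurable_sum _ fun t _ => (hφm k).comp (M.meas t)).const_mul _
  have hWm : ∀ n, AEStronglyMeasurable (W n) P := fun n => (M.W_memLp hξ2 n).1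
  have hPW : ∀ K n ω, ‖pj e K (W n ω)‖ = √(∑ k ∈ Finset.range K, σ k * S n k ω ^ 2) := by
    intro K n ω
    rw [← Real.sqrt_sq (norm_nonneg _), pj_norm he]
    congr 1
    refine Finset.sum_congr rfl fun k _ => ?_
    have : inner ℝ (e k) (W n ω) = √(σ k) * S n k ω := by
      simp only [W, S]
      rw [real_inner_smul_right, inner_sum]
      simp_rw [hφ]
      rw [← Finset.mul_sum]; ring
    rw [this, mul_pow, Real.sq_sqrt (hσ k)]
  refine double_limit (b := fun K n => ∫ ω, G ‖pj e K (W n ω)‖ ∂P)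
    (c := fun K => ∫ η, G (√(∑ k ∈ Finset.range K, σ k * ζ k η ^ 2)) ∂gam)
    (ρ := ρ) (η := fun K => √(4 * cc C) * Nq ε θ fun z => ξ z - pj e K (ξ z)) (L := L)
    ?_ hρ ?_ ?_ ?_
  · intro K n
    obtain ⟨R, hRi, hRb, hRT⟩ := hR n
    have hQm : StronglyMeasurable fun z => ξ z - pj e K (ξ z) :=
      hm.sub ((pj e K).continuous.comp_stronglyMeasurable hm)
    have hQq : MemLp (fun z => ξ z - pj e K (ξ z)) (qe ε) θ :=
      hξ.sub ((pj e K).comp_memLp' hξ)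
    have hQ0 : ∫ z, (ξ z - pj e K (ξ z)) ∂θ = 0 := by
      rw [integral_sub hξ1 ((pj e K).integrable_comp hξ1), (pj e K).integral_comp_comm hξ1, h0]
      simp
    have hQb := M.W_bound1 hQm hQq hQ0 n
    have hQW : ∀ ω, (√(n : ℝ))⁻¹ • ∑ t ∈ Finset.range n, (ξ (Z t ω) - pj e K (ξ (Z t ω))) =
        W n ω - pj e K (W n ω) := by
      intro ω
      simp only [W]
      rw [map_smul, map_sum, Finset.sum_sub_distrib, smul_sub]
    simp_rw [hQW] at hQb
    have hQi : Integrable (fun ω => ‖W n ω - pj e K (W n ω)‖) P := by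
      have h1 := (M.W_memLp hQq n).integrable (qe_ge_one M.eps)
      simp_rw [hQW] at h1
      exact h1.norm
    have i1 : Integrable (fun ω => G (T n ω)) P :=
      Integrable.of_bound (hL.continuous.measurable.comp (hTm n)).aestronglyMeasurable B
        (Eventually.of_forall fun ω => hB _)
    have i2 : Integrable (fun ω => G ‖pj e K (W n ω)‖) P :=
      Integrable.of_bound (hL.continuous.comp_aestronglyMeasurable
        ((pj e K).continuous.comp_aestronglyMeasurable (hWm n)).norm) B
        (Eventually.of_forall fun ω => hB _)
    rw [← integral_sub i1 i2]
    calc |∫ ω, (G (T n ω) - G ‖pj e K (W n ω)‖) ∂P|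
        ≤ ∫ ω, L * (R ω + ‖W n ω - pj e K (W n ω)‖) ∂P := by
          rw [← Real.norm_eq_abs]
          refine norm_integral_le_of_norm_le ((hRi.add hQi).const_mul _)
            (Eventually.of_forall fun ω => ?_)
          have h1 := hL.dist_le_mul (T n ω) ‖pj e K (W n ω)‖
          rw [Real.dist_eq, Real.dist_eq] at h1
          refine h1.trans (mul_le_mul_of_nonneg_left ?_ L.2)
          have h2 := abs_sub_le (T n ω) ‖W n ω‖ ‖pj e K (W n ω)‖
          have h3 := abs_norm_sub_norm_le (W n ω) (pj e K (W n ω))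
          have h4 := hRT ω
          simp only [W] at *
          linarith
      _ = L * (∫ ω, R ω ∂P + ∫ ω, ‖W n ω - pj e K (W n ω)‖ ∂P) := by
          rw [integral_const_mul, integral_add hRi hQi]
      _ ≤ _ := mul_le_mul_of_nonneg_left (add_le_add hRb hQb) L.2
  · simpa using (Nq_tail M.eps he hξ hT).const_mul (√(4 * cc C))
  · intro K
    have hc : Continuous fun x : EuclideanSpace ℝ (Fin K) => G (√(∑ k : Fin K, σ k * x k ^ 2)) :=
      hL.continuous.comp (by fun_prop)
    have := weak_of_ee (P := P) (P' := gam) K hSm hζ (hchar K)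
      (BoundedContinuousFunction.ofNormedAddCommGroup _ hc B fun x => hB _)
    simp only [BoundedContinuousFunction.coe_ofNormedAddCommGroup] at this
    simp_rw [hPW, Finset.sum_range]
    exact this
  · refine tendsto_integral_of_dominated_convergence (fun _ => B) ?_ (integrable_const _) ?_ ?_
    · intro K
      refine (hL.continuous.measurable.comp (Measurable.sqrt ?_)).aestronglyMeasurable
      exact Finset.measurable_sum _ fun k _ => ((hζ k).pow_const 2).const_mul _
    · exact fun K => Eventually.of_forall fun ω => hB _
    · filter_upwards [hsum] with η hη
      exact (hL.continuous.tendsto _).comp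
        ((Real.continuous_sqrt.tendsto _).comp hη.hasSum.tendsto_sum_nat)

/-- The abstract limit theorem. -/
theorem MixProc.limit (M : MixProc P Z θ ε r C) {ξ : 𝒵 → H} (hm : StronglyMeasurable ξ)
    (hξ : MemLp ξ (qe ε) θ) (h0 : ∫ z, ξ z ∂θ = 0) :
    ∃ (lam : ℕ → ℝ) (φ : ℕ → 𝒵 → ℝ), (∀ k, 0 ≤ lam k) ∧ (∀ k, Measurable (φ k)) ∧
      (∀ k z, ∫ z', inner ℝ (ξ z) (ξ z') * φ k z' ∂θ = lam k * φ k z) ∧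
      (∀ k, lam k ≠ 0 → ∫ z, φ k z ^ 2 ∂θ = 1) ∧ (∀ k, ∫ z, φ k z ∂θ = 0) ∧
      ∃ ζ : ℕ → (ℕ → ℝ) → ℝ, (∀ k, Measurable (ζ k)) ∧
        (∀ k, ∃ v : ℝ≥0, gam.map (ζ k) = gaussianReal 0 v) ∧
        (∀ k, ∫ η, ζ k η ∂gam = 0) ∧
        (∀ i j, Tendsto (fun n : ℕ => (n : ℝ)⁻¹ * ∑ t ∈ Finset.range n, ∑ u ∈ Finset.range n,
          ∫ ω, φ i (Z t ω) * φ j (Z u ω) ∂P) atTop (𝓝 (∫ η, ζ i η * ζ j η ∂gam))) ∧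
        ∀ (T : ℕ → Ω → ℝ), (∀ n, Measurable (T n)) → ∀ ρ : ℕ → ℝ, Tendsto ρ atTop (𝓝 0) →
          (∀ n, ∃ R : Ω → ℝ, Integrable R P ∧ ∫ ω, R ω ∂P ≤ ρ n ∧
            ∀ ω, |T n ω - ‖(√(n : ℝ))⁻¹ • ∑ t ∈ Finset.range n, ξ (Z t ω)‖| ≤ R ω) →
          ∀ f : BoundedContinuousFunction ℝ ℝ, Tendsto (fun n => ∫ ω, f (T n ω ^ 2) ∂P) atTop
            (𝓝 (∫ η, f (∑' k, lam k * ζ k η ^ 2) ∂gam)) := by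
  have := M.prob
  have hξ1 := hξ.integrable (qe_ge_one M.eps)
  have hξ2 := hξ.mono_exponent (qe_ge_two M.eps)
  obtain ⟨e, σ, he1, he2, he3, he4⟩ := eig_exists hm hξ2
  have he : OrthF e := ⟨he1, fun k => (he2 k).imp (fun h => h.1) (fun h => h.1)⟩
  have hσ : ∀ k, 0 ≤ σ k := fun k => by
    rcases he2 k with h | h
    · exact h.2.ge
    · exact h.2.le
  let φ : ℕ → 𝒵 → ℝ := fun k z => (√(σ k))⁻¹ * inner ℝ (e k) (ξ z)
  have hφ : ∀ k z, inner ℝ (e k) (ξ z) = √(σ k) * φ k z := by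
    intro k z
    simp only [φ]
    rcases he2 k with h | h
    · simp [h.1]
    · rw [← mul_assoc, mul_inv_cancel₀ (Real.sqrt_pos.2 h.2).ne', one_mul]
  have hφm : ∀ k, Measurable (φ k) := fun k =>
    (((innerSL ℝ (e k)).continuous.comp_stronglyMeasurable hm).measurable).const_mul _
  have hφq : ∀ k, MemLp (φ k) (qe ε) θ := fun k => ((innerSL ℝ (e k)).comp_memLp' hξ).const_mul _
  have hφ0 : ∀ k, ∫ z, φ k z ∂θ = 0 := by
    intro k
    simp only [φ]
    rw [integral_const_mul]
    have := (innerSL ℝ (e k)).integral_comp_comm hξ1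
    simp only [innerSL_apply_apply, h0, inner_zero_right] at this
    rw [this, mul_zero]
  obtain ⟨ζ, z1, z2, z3, z4, z5, z6⟩ := M.gauss_limit hφm hφq hφ0
  have hsum : ∀ᵐ η ∂gam, Summable fun k => σ k * ζ k η ^ 2 := by
    refine ae_summable_of_bound (fun k => ((z1 k).pow_const 2).const_mul _)
      (fun k η => mul_nonneg (hσ k) (sq_nonneg _)) (fun k => (z3 k).integrable_sq.const_mul _)
      (B := 4 * cc C * Nq ε θ ξ ^ 2) fun K => ?_
    have hφ2 : ∀ k, MemLp (φ k) 2 θ := fun k => (hφq k).mono_exponent (qe_ge_two M.eps)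
    have hlim : Tendsto (fun n : ℕ => ∑ k ∈ Finset.range K, σ k * ((n : ℝ)⁻¹ *
        ∑ t ∈ Finset.range n, ∑ u ∈ Finset.range n, ∫ ω, φ k (Z t ω) * φ k (Z u ω) ∂P)) atTop
        (𝓝 (∑ k ∈ Finset.range K, ∫ η, σ k * ζ k η ^ 2 ∂gam)) := by
      refine tendsto_finsetSum _ fun k _ => ?_
      rw [integral_const_mul]
      simp_rw [sq]
      exact (z5 k k).const_mul _
    refine le_of_tendsto' hlim fun n => ?_
    refine le_trans ?_ (M.W_bound hm hξ h0 n)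
    have hS2 : ∀ k, MemLp (fun ω => ∑ t ∈ Finset.range n, φ k (Z t ω)) 2 P := fun k => by
      simpa using M.sum_memLp (hφ2 k) n 1
    have e1 : ∀ k, σ k * ((n : ℝ)⁻¹ *
        ∑ t ∈ Finset.range n, ∑ u ∈ Finset.range n, ∫ ω, φ k (Z t ω) * φ k (Z u ω) ∂P) =
        ∫ ω, σ k * ((n : ℝ)⁻¹ * (∑ t ∈ Finset.range n, φ k (Z t ω)) ^ 2) ∂P := by
      intro k
      rw [← M.var_eq (hφ2 k) (hφ2 k), integral_const_mul, integral_const_mul]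
      simp_rw [sq]
    simp_rw [e1]
    have hI : ∀ k, Integrable (fun ω => σ k * ((n : ℝ)⁻¹ * (∑ t ∈ Finset.range n, φ k (Z t ω)) ^ 2)) P :=
      fun k => ((hS2 k).integrable_sq.const_mul _).const_mul _
    rw [← integral_finsetSum _ fun k _ => hI k]
    refine integral_mono (integrable_finsetSum _ fun k _ => hI k)
      ((M.W_memLp hξ2 n).norm.integrable_sq) fun ω => ?_
    simp only
    refine le_trans (le_of_eq ?_) (pow_le_pow_left₀ (norm_nonneg _) (pj_norm_le he K _) 2)
    rw [pj_norm he]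
    refine Finset.sum_congr rfl fun k _ => ?_
    rw [real_inner_smul_right, inner_sum]
    have e2 : ∑ t ∈ Finset.range n, inner ℝ (e k) (ξ (Z t ω)) =
        √(σ k) * ∑ t ∈ Finset.range n, φ k (Z t ω) := by
      rw [Finset.sum_congr rfl fun t _ => hφ k (Z t ω), Finset.mul_sum]
    rw [e2]
    generalize ∑ t ∈ Finset.range n, φ k (Z t ω) = A
    rw [mul_pow, mul_pow, inv_pow, Real.sq_sqrt (hσ k), Real.sq_sqrt (Nat.cast_nonneg n)]
    ring
  refine ⟨σ, φ, hσ, hφm, fun k z => ?_, fun k hk => ?_, hφ0, ζ, z1, z2, z4, z5,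
    fun T hTm ρ hρ hR f => ?_⟩
  · have h1 := he3 k (ξ z)
    have h2 : ∀ z', inner ℝ (ξ z) (ξ z') * φ k z' =
        (√(σ k))⁻¹ * (inner ℝ (ξ z') (e k) * inner ℝ (ξ z') (ξ z)) := by
      intro z'
      simp only [φ]
      rw [real_inner_comm (ξ z') (ξ z), real_inner_comm (ξ z') (e k)]; ring
    simp_rw [h2]
    rw [integral_const_mul, h1]
    simp only [φ]; ring
  · have hk' : 0 < σ k := lt_of_le_of_ne (hσ k) (Ne.symm hk)
    have hn : ‖e k‖ = 1 := by
      rcases he2 k with h | h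
      · exact absurd h.2 hk
      · exact h.1
    have h1 := he3 k (e k)
    rw [real_inner_self_eq_norm_sq, hn] at h1
    have h2 : ∀ z, φ k z ^ 2 = (σ k)⁻¹ * (inner ℝ (ξ z) (e k) * inner ℝ (ξ z) (e k)) := by
      intro z
      simp only [φ]
      rw [real_inner_comm (ξ z) (e k), mul_pow, inv_pow, Real.sq_sqrt (hσ k)]; ring
    simp_rw [h2]
    rw [integral_const_mul, h1]
    field_simp
  · have hbm : Measurable fun η => √(∑' k, σ k * ζ k η ^ 2) :=
      (Measurable.tsum fun k => ((z1 k).pow_const 2).const_mul _).sqrt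
    have hT' : ∀ᵐ z ∂θ, Tendsto (fun K => pj e K (ξ z)) atTop (𝓝 (ξ z)) := by
      simp_rw [pj_apply]; exact he4
    have := weak_sq hTm hbm (M.lip_limit hm hξ h0 he hT' hσ hφ hφm z1 z6 hsum hTm hρ hR) f
    convert this using 6 with η
    rw [Real.sq_sqrt (tsum_nonneg fun k => mul_nonneg (hσ k) (sq_nonneg _))]

end

end

section

section
open scoped TensorProduct
variable (H₁ H₂ : Type*) [NormedAddCommGroup H₁] [InnerProductSpace ℝ H₁]
    [NormedAddCommGroup H₂] [InnerProductSpace ℝ H₂]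

/-- Hilbert space tensor product. -/
abbrev TH := UniformSpace.Completion (H₁ ⊗[ℝ] H₂)

/-- The canonical bilinear map into the Hilbert tensor product. -/
def tB : H₁ →L[ℝ] H₂ →L[ℝ] TH H₁ H₂ :=
  LinearMap.mkContinuous₂
    ((TensorProduct.mk ℝ H₁ H₂).compr₂
      (UniformSpace.Completion.toComplL (𝕜 := ℝ) (E := H₁ ⊗[ℝ] H₂)).toLinearMap) 1 (by
    intro x y
    simp)

variable {H₁ H₂}
lemma tB_inner (a a' : H₁) (b b' : H₂) :
    inner ℝ (tB H₁ H₂ a b) (tB H₁ H₂ a' b') = inner ℝ a a' * inner ℝ b b' := by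
  simp [tB]

lemma tB_norm (a : H₁) (b : H₂) : ‖tB H₁ H₂ a b‖ = ‖a‖ * ‖b‖ := by
  simp [tB]
end

section
variable {X : Type*} [MetricSpace X] [SecondCountableTopology X]
  [MeasurableSpace X] [BorelSpace X] {H : Type*} [NormedAddCommGroup H] [InnerProductSpace ℝ H]
  [CompleteSpace H]

lemma emb_cont {φ : X → H} (hφ : ∀ x x', dist x x' = ‖φ x - φ x'‖ ^ 2) : Continuous φ := by
  rw [continuous_iff_continuousAt]
  intro x
  rw [ContinuousAt, tendsto_iff_norm_sub_tendsto_zero]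
  have : ∀ y, ‖φ y - φ x‖ = √(dist y x) := fun y => by rw [hφ, Real.sqrt_sq (norm_nonneg _)]
  simp_rw [this]
  have h : Continuous fun y => √(dist y x) := by fun_prop
  simpa using h.tendsto x

lemma dM_eq {φ : X → H} (hφ : ∀ x x', dist x x' = ‖φ x - φ x'‖ ^ 2) (μ : Measure X)
    [IsProbabilityMeasure μ] (h2 : MemLp φ 2 μ) (x x' : X) :
    dM (fun a b : X => dist a b) μ x x' =
      -2 * inner ℝ (φ x - ∫ u, φ u ∂μ) (φ x' - ∫ u, φ u ∂μ) := by
  set m := ∫ u, φ u ∂μ with hm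
  have h1 : Integrable φ μ := h2.integrable (by norm_num)
  have hc2 : MemLp (fun u => φ u - m) 2 μ := h2.sub (memLp_const m)
  have hc1 : Integrable (fun u => φ u - m) μ := h1.sub (integrable_const m)
  have hc0 : ∫ u, (φ u - m) ∂μ = 0 := by
    rw [integral_sub h1 (integrable_const m)]; simp [hm]
  have hsq : Integrable (fun u => ‖φ u - m‖ ^ 2) μ := hc2.norm.integrable_sq
  have hd : ∀ a b, dist a b = ‖φ a - m‖ ^ 2 + ‖φ b - m‖ ^ 2 - 2 * inner ℝ (φ a - m) (φ b - m) := by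
    intro a b
    rw [hφ, show φ a - φ b = (φ a - m) - (φ b - m) by abel, norm_sub_sq_real]; ring
  set v := ∫ u, ‖φ u - m‖ ^ 2 ∂μ with hv
  have ha : ∀ a, aM (fun a b : X => dist a b) μ a = ‖φ a - m‖ ^ 2 + v := by
    intro a
    simp only [aM, hd]
    have i1 : Integrable (fun b => ‖φ a - m‖ ^ 2 + ‖φ b - m‖ ^ 2) μ := (integrable_const _).add hsq
    rw [integral_sub i1 ((hc1.const_inner _).const_mul _),
      integral_add (integrable_const _) hsq, integral_const_mul, integral_inner hc1, hc0]
    simp [hv]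
  have hI : Integrable (fun p : X × X => dist p.1 p.2) (μ.prod μ) := by
    have := ((hsq.comp_fst μ).add (hsq.comp_snd μ)).const_mul 2
    refine this.mono' (by fun_prop) (Eventually.of_forall fun p => ?_)
    rw [Real.norm_of_nonneg dist_nonneg, hd]
    have h3 := abs_real_inner_le_norm (φ p.1 - m) (φ p.2 - m)
    have h4 := (abs_le.1 h3).1
    simp only [Pi.add_apply]
    nlinarith [sq_nonneg (‖φ p.1 - m‖ - ‖φ p.2 - m‖)]
  have hD : DM (fun a b : X => dist a b) μ = 2 * v := by
    simp only [DM]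
    rw [integral_prod _ hI]
    have : ∀ a, ∫ b, dist a b ∂μ = ‖φ a - m‖ ^ 2 + v := ha
    simp_rw [this]
    rw [integral_add hsq (integrable_const _)]
    simp [← hv]; ring
  simp only [dM]
  rw [ha, ha, hD, hd]; ring

end

end

section

section
variable {X : Type*} [MetricSpace X] [SecondCountableTopology X]
  [MeasurableSpace X] [BorelSpace X] {Y : Type*} [MetricSpace Y] [SecondCountableTopology Y]
  [MeasurableSpace Y] [BorelSpace Y]
  {H₁ : Type*} [NormedAddCommGroup H₁] [InnerProductSpace ℝ H₁] [CompleteSpace H₁]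
  {H₂ : Type*} [NormedAddCommGroup H₂] [InnerProductSpace ℝ H₂] [CompleteSpace H₂]

/-- centred feature map -/
def cen {X H : Type*} [MeasurableSpace X] [NormedAddCommGroup H] [NormedSpace ℝ H]
    (φ : X → H) (μ : Measure X) (x : X) : H := φ x - ∫ u, φ u ∂μ

/-- tensor feature map -/
def feat (φ : X → H₁) (ψ : Y → H₂) (θ : Measure (X × Y)) (z : X × Y) : TH H₁ H₂ :=
  (2 : ℝ) • tB H₁ H₂ (cen φ (θ.map Prod.fst) z.1) (cen ψ (θ.map Prod.snd) z.2)

variable {φ : X → H₁} {ψ : Y → H₂}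

lemma feat_norm (θ : Measure (X × Y)) (z : X × Y) : ‖feat φ ψ θ z‖ =
    2 * (‖cen φ (θ.map Prod.fst) z.1‖ * ‖cen ψ (θ.map Prod.snd) z.2‖) := by
  rw [feat, norm_smul, tB_norm]; simp

lemma delta_eq (hφ : ∀ x x', dist x x' = ‖φ x - φ x'‖ ^ 2)
    (hψ : ∀ x x', dist x x' = ‖ψ x - ψ x'‖ ^ 2) (θ : Measure (X × Y)) [IsProbabilityMeasure θ]
    (h1 : MemLp φ 2 (θ.map Prod.fst)) (h2 : MemLp ψ 2 (θ.map Prod.snd)) (z z' : X × Y) :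
    deltaTheta (fun a b : X => dist a b) (fun a b : Y => dist a b) θ z z' =
      inner ℝ (feat φ ψ θ z) (feat φ ψ θ z') := by
  have : IsProbabilityMeasure (θ.map Prod.fst) := Measure.isProbabilityMeasure_map (by fun_prop)
  have : IsProbabilityMeasure (θ.map Prod.snd) := Measure.isProbabilityMeasure_map (by fun_prop)
  rw [deltaTheta, dM_eq hφ _ h1, dM_eq hψ _ h2, feat, feat, real_inner_smul_left,
    real_inner_smul_right, tB_inner]
  simp only [cen]; ring

lemma feat_sm (hφ : ∀ x x', dist x x' = ‖φ x - φ x'‖ ^ 2)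
    (hψ : ∀ x x', dist x x' = ‖ψ x - ψ x'‖ ^ 2) (θ : Measure (X × Y)) :
    StronglyMeasurable (feat φ ψ θ) := by
  have c1 := emb_cont hφ
  have c2 := emb_cont hψ
  have cA : Continuous fun z : X × Y => cen φ (θ.map Prod.fst) z.1 :=
    (c1.comp continuous_fst).sub continuous_const
  have cB : Continuous fun z : X × Y => cen ψ (θ.map Prod.snd) z.2 :=
    (c2.comp continuous_snd).sub continuous_const
  have : Continuous (feat φ ψ θ) := (((tB H₁ H₂).continuous.comp cA).clm_apply cB).const_smul (2 : ℝ)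
  exact this.stronglyMeasurable

lemma cen_sm (hφ : ∀ x x', dist x x' = ‖φ x - φ x'‖ ^ 2) (μ : Measure X) :
    StronglyMeasurable (cen φ μ) := by
  have c1 := emb_cont hφ
  have : Continuous (cen φ μ) := by unfold cen; fun_prop
  exact this.stronglyMeasurable

lemma cen_memLp {q : ℝ≥0∞} {μ : Measure X} [IsFiniteMeasure μ] (h : MemLp φ q μ) :
    MemLp (cen φ μ) q μ := h.sub (memLp_const _)

lemma cen_zero {μ : Measure X} [IsProbabilityMeasure μ] (h : Integrable φ μ) :
    ∫ x, cen φ μ x ∂μ = 0 := by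
  unfold cen
  rw [integral_sub h (integrable_const _)]; simp

lemma mp_fst (θ : Measure (X × Y)) : MeasurePreserving Prod.fst θ (θ.map Prod.fst) :=
  ⟨measurable_fst, rfl⟩
lemma mp_snd (θ : Measure (X × Y)) : MeasurePreserving Prod.snd θ (θ.map Prod.snd) :=
  ⟨measurable_snd, rfl⟩

lemma dcov_eq (hφ : ∀ x x', dist x x' = ‖φ x - φ x'‖ ^ 2)
    (hψ : ∀ x x', dist x x' = ‖ψ x - ψ x'‖ ^ 2) (θ : Measure (X × Y)) [IsProbabilityMeasure θ]
    (h1 : MemLp φ 2 (θ.map Prod.fst)) (h2 : MemLp ψ 2 (θ.map Prod.snd)) :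
    dcov (fun a b : X => dist a b) (fun a b : Y => dist a b) θ = ‖∫ z, feat φ ψ θ z ∂θ‖ ^ 2 := by
  have : IsProbabilityMeasure (θ.map Prod.fst) := Measure.isProbabilityMeasure_map (by fun_prop)
  have : IsProbabilityMeasure (θ.map Prod.snd) := Measure.isProbabilityMeasure_map (by fun_prop)
  have hI : Integrable (feat φ ψ θ) θ := by
    have a1 := ((cen_memLp h1).norm.comp_measurePreserving (mp_fst θ))
    have a2 := ((cen_memLp h2).norm.comp_measurePreserving (mp_snd θ))
    have := (a1.integrable_mul a2).const_mul 2
    refine this.mono' (feat_sm hφ hψ θ).aestronglyMeasurable (Eventually.of_forall fun z => ?_)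
    rw [feat_norm]; rfl
  have hII : Integrable (fun p : (X × Y) × (X × Y) => inner ℝ (feat φ ψ θ p.1) (feat φ ψ θ p.2))
      (θ.prod θ) := by
    refine (hI.norm.mul_prod hI.norm).mono' ?_ (Eventually.of_forall fun p => ?_)
    · have sm := feat_sm hφ hψ θ
      exact ((sm.comp_measurable measurable_fst).inner
        (sm.comp_measurable measurable_snd)).aestronglyMeasurable
    · exact norm_inner_le_norm _ _
  simp only [dcov]
  simp_rw [delta_eq hφ hψ θ h1 h2]
  rw [integral_prod _ hII]
  simp only
  have e1 : ∀ z, ∫ z', inner ℝ (feat φ ψ θ z) (feat φ ψ θ z') ∂θ =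
      inner ℝ (∫ z', feat φ ψ θ z' ∂θ) (feat φ ψ θ z) := fun z => by
    rw [integral_inner hI, real_inner_comm]
  simp_rw [e1]
  rw [integral_inner hI, real_inner_self_eq_norm_sq]

/-! Empirical measure. -/

variable {Ω : Type*} {Z : ℕ → Ω → X × Y}

lemma emp_prob {n : ℕ} (hn : 0 < n) (ω : Ω) : IsProbabilityMeasure (emp Z n ω) := by
  refine ⟨?_⟩
  simp only [emp, Measure.smul_apply, Measure.coe_finsetSum, Finset.sum_apply, measure_univ]
  simp only [Finset.sum_const, Finset.card_range, nsmul_eq_mul, mul_one, smul_eq_mul]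
  exact ENNReal.inv_mul_cancel (by exact_mod_cast hn.ne') (ENNReal.natCast_ne_top n)

lemma emp_int {E : Type*} [NormedAddCommGroup E] [NormedSpace ℝ E] [CompleteSpace E]
    {g : X × Y → E} (hg : StronglyMeasurable g) (n : ℕ) (ω : Ω) :
    ∫ z, g z ∂(emp Z n ω) = (n : ℝ)⁻¹ • ∑ k ∈ Finset.range n, g (Z k ω) := by
  simp only [emp]
  rw [integral_smul_measure, integral_finsetSum_measure]
  · simp_rw [integral_dirac' _ _ hg]; simp
  · intro k _
    exact integrable_dirac' hg (by simp)

lemma emp_memLp {E : Type*} [NormedAddCommGroup E] [NormedSpace ℝ E] [CompleteSpace E]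
    {g : X × Y → E} (hg : StronglyMeasurable g) {n : ℕ} (hn : 0 < n) (ω : Ω) :
    MemLp g 2 (emp Z n ω) := by
  have := emp_prob (Z := Z) hn ω
  refine MemLp.of_bound hg.aestronglyMeasurable (∑ k ∈ Finset.range n, ‖g (Z k ω)‖) ?_
  rw [ae_iff]
  simp only [emp, Measure.smul_apply, Measure.coe_finsetSum, Finset.sum_apply]
  rw [Finset.sum_eq_zero, smul_zero]
  intro k hk
  rw [Measure.dirac_apply' _ (by
    exact (measurableSet_le hg.norm.measurable measurable_const).compl)]
  simp only [Set.indicator_apply_eq_zero]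
  intro h
  exact absurd (Finset.single_le_sum (f := fun k => ‖g (Z k ω)‖) (fun _ _ => norm_nonneg _) hk) h

end

end

section

section
variable {X : Type*} [MetricSpace X] [SecondCountableTopology X]
  [MeasurableSpace X] [BorelSpace X] {Y : Type*} [MetricSpace Y] [SecondCountableTopology Y]
  [MeasurableSpace Y] [BorelSpace Y]
  {H₁ : Type*} [NormedAddCommGroup H₁] [InnerProductSpace ℝ H₁] [CompleteSpace H₁]
  {H₂ : Type*} [NormedAddCommGroup H₂] [InnerProductSpace ℝ H₂] [CompleteSpace H₂]
  {φ : X → H₁} {ψ : Y → H₂} {Ω : Type*} {Z : ℕ → Ω → X × Y}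

lemma tensor_mean (a : ℕ → H₁) (b : ℕ → H₂) (m : H₁) (m' : H₂) {n : ℕ} (hn : 0 < n) :
    (n : ℝ)⁻¹ • ∑ k ∈ Finset.range n, tB H₁ H₂
      (a k - (n : ℝ)⁻¹ • ∑ i ∈ Finset.range n, a i) (b k - (n : ℝ)⁻¹ • ∑ i ∈ Finset.range n, b i) =
    (n : ℝ)⁻¹ • ∑ k ∈ Finset.range n, tB H₁ H₂ (a k - m) (b k - m') -
      tB H₁ H₂ ((n : ℝ)⁻¹ • ∑ i ∈ Finset.range n, (a i - m))
        ((n : ℝ)⁻¹ • ∑ i ∈ Finset.range n, (b i - m')) := by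
  have hn' : (n : ℝ) ≠ 0 := by exact_mod_cast hn.ne'
  set A := (n : ℝ)⁻¹ • ∑ i ∈ Finset.range n, (a i - m) with hA
  set B := (n : ℝ)⁻¹ • ∑ i ∈ Finset.range n, (b i - m') with hB
  have ea : (n : ℝ)⁻¹ • ∑ i ∈ Finset.range n, a i = A + m := by
    rw [hA, Finset.sum_sub_distrib, smul_sub, Finset.sum_const, Finset.card_range,
      ← Nat.cast_smul_eq_nsmul ℝ, smul_smul, inv_mul_cancel₀ hn', one_smul, sub_add_cancel]
  have eb : (n : ℝ)⁻¹ • ∑ i ∈ Finset.range n, b i = B + m' := by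
    rw [hB, Finset.sum_sub_distrib, smul_sub, Finset.sum_const, Finset.card_range,
      ← Nat.cast_smul_eq_nsmul ℝ, smul_smul, inv_mul_cancel₀ hn', one_smul, sub_add_cancel]
  rw [ea, eb]
  have e1 : ∀ k, tB H₁ H₂ (a k - (A + m)) (b k - (B + m')) =
      tB H₁ H₂ (a k - m) (b k - m') - tB H₁ H₂ (a k - m) B - tB H₁ H₂ A (b k - m') +
        tB H₁ H₂ A B := by
    intro k
    rw [show a k - (A + m) = (a k - m) - A by abel, show b k - (B + m') = (b k - m') - B by abel]
    simp only [map_sub, sub_apply]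
    abel
  simp_rw [e1]
  rw [Finset.sum_add_distrib, Finset.sum_sub_distrib, Finset.sum_sub_distrib, smul_add, smul_sub,
    smul_sub]
  have s1 : (n : ℝ)⁻¹ • ∑ k ∈ Finset.range n, tB H₁ H₂ (a k - m) B = tB H₁ H₂ A B := by
    have := congrArg (fun x => (tB H₁ H₂).flip B x) hA
    simp only [map_smul, map_sum, ContinuousLinearMap.flip_apply] at this
    exact this.symm
  have s2 : (n : ℝ)⁻¹ • ∑ k ∈ Finset.range n, tB H₁ H₂ A (b k - m') = tB H₁ H₂ A B := by
    have := congrArg (fun x => tB H₁ H₂ A x) hB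
    simp only [map_smul, map_sum] at this
    exact this.symm
  have s3 : (n : ℝ)⁻¹ • ∑ k ∈ Finset.range n, tB H₁ H₂ A B = tB H₁ H₂ A B := by
    rw [Finset.sum_const, Finset.card_range,
      ← Nat.cast_smul_eq_nsmul ℝ, smul_smul, inv_mul_cancel₀ hn', one_smul]
  rw [s1, s2, s3]; abel

/-- scaled sums -/
def WW {Ω 𝒵 E : Type*} [NormedAddCommGroup E] [NormedSpace ℝ E] (ξ : 𝒵 → E) (Z : ℕ → Ω → 𝒵)
    (n : ℕ) (ω : Ω) : E := (√(n : ℝ))⁻¹ • ∑ t ∈ Finset.range n, ξ (Z t ω)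

lemma n_dcov (hφ : ∀ x x', dist x x' = ‖φ x - φ x'‖ ^ 2)
    (hψ : ∀ x x', dist x x' = ‖ψ x - ψ x'‖ ^ 2) (θ : Measure (X × Y)) (n : ℕ) (ω : Ω) :
    (n : ℝ) * dcov (fun a b : X => dist a b) (fun a b : Y => dist a b) (emp Z n ω) =
    ‖WW (feat φ ψ θ) Z n ω - (2 * (√(n : ℝ))⁻¹) •
      tB H₁ H₂ (WW (fun z => cen φ (θ.map Prod.fst) z.1) Z n ω)
        (WW (fun z => cen ψ (θ.map Prod.snd) z.2) Z n ω)‖ ^ 2 := by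
  rcases Nat.eq_zero_or_pos n with rfl | hn
  · simp [WW]
  have hn' : (0 : ℝ) < n := by exact_mod_cast hn
  have := emp_prob (Z := Z) hn ω
  have c1 := emb_cont hφ
  have c2 := emb_cont hψ
  have s1 : StronglyMeasurable fun z : X × Y => φ z.1 := c1.stronglyMeasurable.comp_measurable measurable_fst
  have s2 : StronglyMeasurable fun z : X × Y => ψ z.2 := c2.stronglyMeasurable.comp_measurable measurable_snd
  have h1 : MemLp φ 2 ((emp Z n ω).map Prod.fst) :=
    (memLp_map_measure_iff c1.stronglyMeasurable.aestronglyMeasurable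
      measurable_fst.aemeasurable).2 (emp_memLp s1 hn ω)
  have h2 : MemLp ψ 2 ((emp Z n ω).map Prod.snd) :=
    (memLp_map_measure_iff c2.stronglyMeasurable.aestronglyMeasurable
      measurable_snd.aemeasurable).2 (emp_memLp s2 hn ω)
  rw [dcov_eq hφ hψ _ h1 h2, emp_int (feat_sm hφ hψ _)]
  have m1 : ∫ u, φ u ∂((emp Z n ω).map Prod.fst) = (n : ℝ)⁻¹ • ∑ i ∈ Finset.range n, φ (Z i ω).1 := by
    rw [integral_map measurable_fst.aemeasurable c1.stronglyMeasurable.aestronglyMeasurable,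
      emp_int s1]
  have m2 : ∫ u, ψ u ∂((emp Z n ω).map Prod.snd) = (n : ℝ)⁻¹ • ∑ i ∈ Finset.range n, ψ (Z i ω).2 := by
    rw [integral_map measurable_snd.aemeasurable c2.stronglyMeasurable.aestronglyMeasurable,
      emp_int s2]
  have key := tensor_mean (fun i => φ (Z i ω).1) (fun i => ψ (Z i ω).2)
    (∫ u, φ u ∂(θ.map Prod.fst)) (∫ u, ψ u ∂(θ.map Prod.snd)) hn
  simp only [feat, cen, m1, m2, WW] at key ⊢
  rw [← Finset.smul_sum, ← Finset.smul_sum, smul_comm, key]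
  set A := ∑ i ∈ Finset.range n, (φ (Z i ω).1 - ∫ u, φ u ∂(θ.map Prod.fst))
  set B := ∑ i ∈ Finset.range n, (ψ (Z i ω).2 - ∫ u, ψ u ∂(θ.map Prod.snd))
  set D := ∑ k ∈ Finset.range n, tB H₁ H₂ (φ (Z k ω).1 - ∫ u, φ u ∂(θ.map Prod.fst))
    (ψ (Z k ω).2 - ∫ u, ψ u ∂(θ.map Prod.snd))
  simp only [map_smul, smul_apply]
  have hs : √(n : ℝ) ≠ 0 := (Real.sqrt_pos.2 hn').ne'
  have hss : √(n : ℝ) ^ 2 = n := Real.sq_sqrt hn'.le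
  have e : (√(n : ℝ))⁻¹ • (2 : ℝ) • D - (2 * (√(n : ℝ))⁻¹) • ((√(n : ℝ))⁻¹ • (√(n : ℝ))⁻¹ • tB H₁ H₂ A B) =
      √(n : ℝ) • ((2 : ℝ) • ((n : ℝ)⁻¹ • D - (n : ℝ)⁻¹ • (n : ℝ)⁻¹ • tB H₁ H₂ A B)) := by
    simp only [smul_sub, smul_smul]
    generalize √(n : ℝ) = s at hs hss
    rw [← hss]
    congr 2 <;> field_simp
  rw [e, norm_smul (√(n : ℝ)), mul_pow ‖√(n : ℝ)‖, Real.norm_eq_abs (√(n : ℝ)), sq_abs, hss]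

lemma emb_memLp {ε : ℝ} (hε : 0 < ε) (hφ : ∀ x x', dist x x' = ‖φ x - φ x'‖ ^ 2) (μ : Measure X)
    [IsProbabilityMeasure μ] (x₀ : X) (h : Integrable (fun x => dist x x₀ ^ (1 + ε)) μ) :
    MemLp φ (qe ε) μ := by
  have c1 := emb_cont hφ
  have h1 : MemLp (fun x => φ x - φ x₀) (qe ε) μ := by
    have c3 : Continuous fun x => φ x - φ x₀ := c1.sub continuous_const
    rw [← integrable_norm_rpow_iff c3.stronglyMeasurable.aestronglyMeasurable
      (qe_ne_zero hε) qe_ne_top, qe_toReal hε]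
    refine h.congr (Eventually.of_forall fun x => ?_)
    simp only
    rw [hφ, ← Real.rpow_natCast, ← Real.rpow_mul (norm_nonneg _)]
    congr 1; push_cast; ring
  have := h1.add (memLp_const (φ x₀))
  refine this.ae_eq (Eventually.of_forall fun x => ?_)
  simp

lemma feat_memLp {ε : ℝ} (hε : 0 < ε) (hφ : ∀ x x', dist x x' = ‖φ x - φ x'‖ ^ 2)
    (hψ : ∀ x x', dist x x' = ‖ψ x - ψ x'‖ ^ 2) (θ : Measure (X × Y)) [IsProbabilityMeasure θ]
    (hindep : θ = (θ.map Prod.fst).prod (θ.map Prod.snd))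
    (h1 : MemLp φ (qe ε) (θ.map Prod.fst)) (h2 : MemLp ψ (qe ε) (θ.map Prod.snd)) :
    MemLp (feat φ ψ θ) (qe ε) θ ∧ ∫ z, feat φ ψ θ z ∂θ = 0 := by
  have : IsProbabilityMeasure (θ.map Prod.fst) := Measure.isProbabilityMeasure_map (by fun_prop)
  have : IsProbabilityMeasure (θ.map Prod.snd) := Measure.isProbabilityMeasure_map (by fun_prop)
  have a1 := cen_memLp h1
  have a2 := cen_memLp h2
  have hmem : MemLp (feat φ ψ θ) (qe ε) θ := by
    rw [← integrable_norm_rpow_iff (feat_sm hφ hψ θ).aestronglyMeasurable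
      (qe_ne_zero hε) qe_ne_top]
    have b1 := a1.integrable_norm_rpow (qe_ne_zero hε) qe_ne_top
    have b2 := a2.integrable_norm_rpow (qe_ne_zero hε) qe_ne_top
    have b3 := (b1.mul_prod b2).const_mul (2 ^ (qe ε).toReal)
    rw [← hindep] at b3
    refine b3.congr (Eventually.of_forall fun z => ?_)
    simp only
    rw [feat_norm, Real.mul_rpow (by norm_num) (by positivity),
      Real.mul_rpow (by positivity) (by positivity)]
  refine ⟨hmem, ?_⟩
  have hI := hmem.integrable (qe_ge_one hε)
  have hI' := hI
  rw [hindep] at hI'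
  have e : ∫ z, feat φ ψ θ z ∂θ = ∫ z, feat φ ψ θ z ∂((θ.map Prod.fst).prod (θ.map Prod.snd)) := by
    rw [← hindep]
  rw [e, integral_prod _ (by rw [← hindep]; exact hI)]
  have : ∀ x, ∫ y, feat φ ψ θ (x, y) ∂(θ.map Prod.snd) = 0 := by
    intro x
    simp only [feat]
    rw [integral_smul, ContinuousLinearMap.integral_comp_comm _ (a2.integrable (qe_ge_one hε)),
      cen_zero (h2.integrable (qe_ge_one hε))]
    simp
  simp [this]

end

end

lemma WW_sm {Ω 𝒵 E : Type*} [MeasurableSpace Ω] [MeasurableSpace 𝒵] [NormedAddCommGroup E]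
    [NormedSpace ℝ E] {Z : ℕ → Ω → 𝒵} (hZ : ∀ i, Measurable (Z i)) {g : 𝒵 → E}
    (hg : StronglyMeasurable g) (n : ℕ) : StronglyMeasurable (WW g Z n) :=
  (Finset.stronglyMeasurable_fun_sum _
    fun t _ => hg.comp_measurable (hZ t)).const_smul _

/-- Asymptotic distribution of `n · dcov(θₙ)` for independent `X, Y`
with values in separable metric spaces of negative type, `𝒳 × 𝒴` σ-compact, finite
`(1+ε)`-moments, and an absolutely regular strictly stationary sequence with
`β(n) = O(n^{-r})`, `r > 6(1 + 2/ε)`. -/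
theorem dcov_asymptotic_distribution
    {X Y : Type*}
    [MetricSpace X] [TopologicalSpace.SeparableSpace X] [MeasurableSpace X] [BorelSpace X]
    [MetricSpace Y] [TopologicalSpace.SeparableSpace Y] [MeasurableSpace Y] [BorelSpace Y]
    [SigmaCompactSpace (X × Y)]
    -- 𝒳 is of negative type via φemb, 𝒴 via ψemb
    {H₁ H₂ : Type*} [NormedAddCommGroup H₁] [InnerProductSpace ℝ H₁]
    [NormedAddCommGroup H₂] [InnerProductSpace ℝ H₂]
    (φemb : X → H₁) (hφ : ∀ x x' : X, dist x x' = ‖φemb x - φemb x'‖ ^ 2)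
    (ψemb : Y → H₂) (hψ : ∀ y y' : Y, dist y y' = ‖ψemb y - ψemb y'‖ ^ 2)
    {Ω : Type*} [MeasurableSpace Ω] (P : Measure Ω) [IsProbabilityMeasure P]
    (Z : ℕ → Ω → X × Y) (hZmeas : ∀ i, Measurable (Z i))
    -- strict stationarity
    (hstat : MeasurePreserving shift (P.map fun ω i => Z i ω) (P.map fun ω i => Z i ω))
    (θ : Measure (X × Y)) (hθ : θ = P.map (Z 0))
    -- independence of X and Y
    (hindep : θ = (θ.map Prod.fst).prod (θ.map Prod.snd))
    -- finite (1+ε)-moments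
    (ε : ℝ) (hε : 0 < ε) (x₀ : X) (y₀ : Y)
    (hmomX : Integrable (fun x => dist x x₀ ^ (1 + ε)) (θ.map Prod.fst))
    (hmomY : Integrable (fun y => dist y y₀ ^ (1 + ε)) (θ.map Prod.snd))
    -- absolute regularity with β(n) = O(n^{-r}), r > 6(1 + 2/ε)
    (habsreg : Tendsto (betaProc P Z) atTop (𝓝 0))
    (r : ℝ) (hr : 6 * (1 + 2 / ε) < r)
    (C : ℝ) (hmix : ∀ n : ℕ, 1 ≤ n → betaProc P Z n ≤ C * (n : ℝ) ^ (-r)) :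
    ∃ (lam : ℕ → ℝ) (φ : ℕ → X × Y → ℝ),
      (∀ k, 0 ≤ lam k) ∧
      (∀ k, Measurable (φ k)) ∧
      -- eigenpairs of the integral operator f ↦ ∫ δ_θ(·,z) f(z) dθ(z)
      (∀ k, ∀ᵐ z ∂θ, ∫ z', deltaTheta (fun a b : X => dist a b) (fun a b : Y => dist a b) θ
          z z' * φ k z' ∂θ = lam k * φ k z) ∧
      (∀ k, lam k ≠ 0 → ∫ z, φ k z ^ 2 ∂θ = 1) ∧
      ∃ (Ω' : Type) (mΩ' : MeasurableSpace Ω') (P' : Measure Ω')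
        (_ : IsProbabilityMeasure P') (ζ : ℕ → Ω' → ℝ),
        (∀ k, Measurable (ζ k)) ∧
        -- the ζ_k are centered Gaussian
        (∀ k, ∃ v : ℝ≥0, P'.map (ζ k) = gaussianReal 0 v) ∧
        -- covariance structure determined by the dependence structure of (Z_k)
        (∀ i j, Tendsto
          (fun n : ℕ => (n : ℝ)⁻¹ * ∑ t ∈ Finset.range n, ∑ u ∈ Finset.range n,
            (∫ ω, φ i (Z t ω) * φ j (Z u ω) ∂P
              - (∫ ω, φ i (Z t ω) ∂P) * (∫ ω, φ j (Z u ω) ∂P)))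
          atTop
          (𝓝 (∫ ω', ζ i ω' * ζ j ω' ∂P'
              - (∫ ω', ζ i ω' ∂P') * (∫ ω', ζ j ω' ∂P')))) ∧
        -- convergence in distribution of n · dcov(θₙ) to ζ = ∑ λ_k ζ_k²
        (∀ f : BoundedContinuousFunction ℝ ℝ,
          Tendsto (fun n : ℕ => ∫ ω,
              f ((n : ℝ) * dcov (fun a b : X => dist a b) (fun a b : Y => dist a b)
                (emp Z n ω)) ∂P)
            atTop (𝓝 (∫ ω', f (∑' k, lam k * ζ k ω' ^ 2) ∂P'))) := by
  have hprob : IsProbabilityMeasure θ := by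
    rw [hθ]; exact Measure.isProbabilityMeasure_map (hZmeas 0).aemeasurable
  have : SecondCountableTopology X := UniformSpace.secondCountable_of_separable X
  have : SecondCountableTopology Y := UniformSpace.secondCountable_of_separable Y
  have M : MixProc P Z θ ε r |C| :=
    { meas := hZmeas
      stat := hstat
      law0 := hθ
      eps := hε
      hr := hr
      C0 := abs_nonneg _
      mix := fun n hn => (hmix n hn).trans
        (mul_le_mul_of_nonneg_right (le_abs_self C) (by positivity)) }
  have pX : IsProbabilityMeasure (θ.map Prod.fst) :=
    Measure.isProbabilityMeasure_map measurable_fst.aemeasurable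
  have pY : IsProbabilityMeasure (θ.map Prod.snd) :=
    Measure.isProbabilityMeasure_map measurable_snd.aemeasurable
  let φc : X → UniformSpace.Completion H₁ := fun x => (φemb x : UniformSpace.Completion H₁)
  let ψc : Y → UniformSpace.Completion H₂ := fun y => (ψemb y : UniformSpace.Completion H₂)
  have hφc : ∀ x x', dist x x' = ‖φc x - φc x'‖ ^ 2 := fun x x' => by
    simp only [φc]
    rw [← UniformSpace.Completion.coe_sub, UniformSpace.Completion.norm_coe, hφ]
  have hψc : ∀ x x', dist x x' = ‖ψc x - ψc x'‖ ^ 2 := fun x x' => by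
    simp only [ψc]
    rw [← UniformSpace.Completion.coe_sub, UniformSpace.Completion.norm_coe, hψ]
  have q1 := emb_memLp hε hφc _ x₀ hmomX
  have q2 := emb_memLp hε hψc _ y₀ hmomY
  have q1' := q1.mono_exponent (qe_ge_two hε)
  have q2' := q2.mono_exponent (qe_ge_two hε)
  obtain ⟨hξ, hξ0⟩ := feat_memLp hε hφc hψc θ hindep q1 q2
  have hm := feat_sm hφc hψc θ
  obtain ⟨lam, φ, l1, l2, l3, l4, l5, ζ, z1, z2, z3, z4, z5⟩ := M.limit hm hξ hξ0
  refine ⟨lam, φ, l1, l2, fun k => Eventually.of_forall fun z => ?_, l4,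
    ℕ → ℝ, inferInstance, gam, inferInstance, ζ, z1, z2, fun i j => ?_, fun f => ?_⟩
  · simp_rw [delta_eq hφc hψc θ q1' q2']
    exact l3 k z
  · have e : ∀ k t, ∫ ω, φ k (Z t ω) ∂P = 0 := fun k t => by
      rw [M.int_comp (l2 k).aestronglyMeasurable t, l5]
    simp only [e, z3, mul_zero, sub_zero]
    exact z4 i j
  · let a : X × Y → UniformSpace.Completion H₁ := fun z => cen φc (θ.map Prod.fst) z.1
    let b : X × Y → UniformSpace.Completion H₂ := fun z => cen ψc (θ.map Prod.snd) z.2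
    have am : StronglyMeasurable a := (cen_sm hφc _).comp_measurable measurable_fst
    have bm : StronglyMeasurable b := (cen_sm hψc _).comp_measurable measurable_snd
    have aq : MemLp a (qe ε) θ := (cen_memLp q1).comp_measurePreserving (mp_fst θ)
    have bq : MemLp b (qe ε) θ := (cen_memLp q2).comp_measurePreserving (mp_snd θ)
    have a0 : ∫ z, a z ∂θ = 0 := by
      rw [← cen_zero (q1.integrable (qe_ge_one hε)),
        integral_map measurable_fst.aemeasurable (cen_sm hφc _).aestronglyMeasurable]
    have b0 : ∫ z, b z ∂θ = 0 := by
      rw [← cen_zero (q2.integrable (qe_ge_one hε)),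
        integral_map measurable_snd.aemeasurable (cen_sm hψc _).aestronglyMeasurable]
    let T : ℕ → Ω → ℝ := fun n ω => ‖WW (feat φc ψc θ) Z n ω - (2 * (√(n : ℝ))⁻¹) •
      tB _ _ (WW a Z n ω) (WW b Z n ω)‖
    have hTm : ∀ n, Measurable (T n) := fun n => by
      have h1 := WW_sm hZmeas am n
      have h2 := WW_sm hZmeas bm n
      have hc : Continuous fun p : UniformSpace.Completion H₁ × UniformSpace.Completion H₂ =>
          tB _ _ p.1 p.2 := by fun_prop
      exact ((WW_sm hZmeas hm n).sub
        ((hc.comp_stronglyMeasurable (h1.prodMk h2)).const_smul (2 * (√(n : ℝ))⁻¹))).norm.measurable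
    let K : ℝ := 4 * cc |C| * Nq ε θ a ^ 2 + 4 * cc |C| * Nq ε θ b ^ 2
    have hρ : Tendsto (fun n : ℕ => (√(n : ℝ))⁻¹ * K) atTop (𝓝 0) := by
      have h : Tendsto (fun n : ℕ => (√(n : ℝ))⁻¹) atTop (𝓝 0) :=
        tendsto_inv_atTop_zero.comp (Real.tendsto_sqrt_atTop.comp tendsto_natCast_atTop_atTop)
      simpa using h.mul_const K
    have key := z5 T hTm _ hρ (fun n => by
      have i1 := (M.W_memLp (aq.mono_exponent (qe_ge_two hε)) n).norm.integrable_sq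
      have i2 := (M.W_memLp (bq.mono_exponent (qe_ge_two hε)) n).norm.integrable_sq
      refine ⟨fun ω => (√(n : ℝ))⁻¹ * (‖WW a Z n ω‖ ^ 2 + ‖WW b Z n ω‖ ^ 2),
        (i1.add i2).const_mul _, ?_, ?_⟩
      · rw [integral_const_mul]
        refine mul_le_mul_of_nonneg_left ?_ (by positivity)
        have e := integral_add i1 i2
        have w1 := M.W_bound am aq a0 n
        have w2 := M.W_bound bm bq b0 n
        exact e.le.trans (add_le_add w1 w2)
      · intro ω
        refine (abs_norm_sub_norm_le _ _).trans ?_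
        have e : WW (feat φc ψc θ) Z n ω - (2 * (√(n : ℝ))⁻¹) •
            tB _ _ (WW a Z n ω) (WW b Z n ω) -
              (√(n : ℝ))⁻¹ • ∑ t ∈ Finset.range n, feat φc ψc θ (Z t ω) =
            -((2 * (√(n : ℝ))⁻¹) • tB _ _ (WW a Z n ω) (WW b Z n ω)) := by
          simp only [WW]; abel
        rw [e, norm_neg, norm_smul, tB_norm, Real.norm_of_nonneg (by positivity)]
        have h0 : 0 ≤ (√(n : ℝ))⁻¹ := by positivity
        nlinarith [mul_nonneg h0 (sq_nonneg (‖WW a Z n ω‖ - ‖WW b Z n ω‖))]) f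
    simp_rw [n_dcov hφc hψc θ]
    exact key
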